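/- Let t be a semifinite template. Every strictly positive, semifinite, indecomposable harmonic function φ on the graph Z(t) is proportional to φ_{t,w} for some semifinite zigzag growth model (t,w); that is, there exist a tuple w of positive reals summing to 1 indexed by the infinite clusters of t and a constant c > 0 such that φ = c · φ_{t,w}. -/

import Mathlib

/-!
Common definitions: the zigzag graph on binary words, templates and their coideals,
zigzag flanges and sections, the functions `F_λ(u)` and `φ_{t,w}`, and harmonic /
semifinite / indecomposable functions on subgraphs of the zigzag graph.
-/

open scoped ENNReal NNReal

namespace Zigzag

/-- Binary words: `true` is `+`, `false` is `−`. -/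
abbrev BW := List Bool

/-- `CoveredBy a b`: `b` covers `a` in the subword order, i.e. `|b| = |a| + 1` and `a`
is a subword of `b`; these are the edges of the zigzag graph. -/
def CoveredBy (a b : BW) : Prop := a.Sublist b ∧ b.length = a.length + 1

/-- The set of upper neighbours of `a` lying in `S` is finite. -/
lemma upSet_finite (S : Set BW) (a : BW) : {b | b ∈ S ∧ CoveredBy a b}.Finite :=
  (List.finite_length_eq Bool (a.length + 1)).subset (fun _ hb => hb.2.2)

/-- The finset of upper neighbours of `a` inside `S`. -/
noncomputable def upFinset (S : Set BW) (a : BW) : Finset BW :=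
  (upSet_finite S a).toFinset

/-- A `[0,∞]`-valued function is harmonic on `S ⊆ Z` (with the edges induced from the
zigzag graph) if its value at any vertex of `S` equals the sum of its values at the
upper neighbours lying in `S`. -/
def HarmonicOn (S : Set BW) (φ : BW → ℝ≥0∞) : Prop :=
  ∀ a ∈ S, φ a = ∑ b ∈ upFinset S a, φ b

/-- A template: a nonempty sequence of clusters with alternating signs, each cluster
being a sign (`true` = `+`, `false` = `−`) with a multiplicity in `{1,2,…} ∪ {∞}`,
containing at least one infinite cluster. -/
structure Template where
  clusters : List (Bool × ℕ∞)
  ne : clusters ≠ []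
  pos : ∀ c ∈ clusters, c.2 ≠ 0
  alternating : clusters.Chain' fun c d => c.1 ≠ d.1
  hasInf : ∃ c ∈ clusters, c.2 = ⊤

/-- The binary word obtained from a list of clusters by replacing every infinite
multiplicity by `N` (and keeping the finite multiplicities). -/
def clWord (cs : List (Bool × ℕ∞)) (N : ℕ) : BW :=
  (cs.map fun c => List.replicate (if c.2 = ⊤ then N else c.2.toNat) c.1).flatten

/-- The coideal generated by a list of clusters: all binary words that are subwords of
some instantiation. -/
def Zcl (cs : List (Bool × ℕ∞)) : Set BW := {a | ∃ N, a.Sublist (clWord cs N)}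

/-- The coideal `Z(t)` of the zigzag graph attached to a template `t`. -/
def Zt (t : Template) : Set BW := Zcl t.clusters

/-- The cluster in position `i` of `t` is a separating cluster: a one-symbol finite
cluster which is not outermost and whose two neighbours are infinite clusters
(necessarily of the same sign). -/
def Template.isSep (t : Template) (i : ℕ) : Prop :=
  0 < i ∧ i + 1 < t.clusters.length ∧
  (t.clusters.getD i (true, 1)).2 = 1 ∧
  (t.clusters.getD (i - 1) (true, 1)).2 = ⊤ ∧
  (t.clusters.getD (i + 1) (true, 1)).2 = ⊤

/-- A template is finite if all its finite clusters are separating; otherwise it is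
semifinite. -/
def Template.IsFiniteTemplate (t : Template) : Prop :=
  ∀ i < t.clusters.length, (t.clusters.getD i (true, 1)).2 ≠ ⊤ → t.isSep i

/-- The number of infinite clusters of a template. -/
def Template.numInf (t : Template) : ℕ :=
  (t.clusters.filter fun c => decide (c.2 = ⊤)).length

/-- Position `p` of `t` carries a finite non-separating cluster, i.e. a cluster
contributing to the zigzag flange of `t`. -/
def IsFlangePos (t : Template) (p : ℕ) : Prop :=
  p < t.clusters.length ∧ (t.clusters.getD p (true, 1)).2 ≠ ⊤ ∧ ¬t.isSep p

/-- Decrease by one the multiplicity of the cluster in position `p`. -/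
def decAt (cs : List (Bool × ℕ∞)) (p : ℕ) : List (Bool × ℕ∞) :=
  cs.set p ((cs.getD p (true, 1)).1, (cs.getD p (true, 1)).2 - 1)

/-- The coideal `J(t)`: the union of the coideals `Z(r)` over all `r` obtained from `t`
by removing a single symbol from a cluster corresponding to a block of a binary word
from the zigzag flange of `t` (no merging of clusters is needed to generate `Z(r)`). -/
def Jt (t : Template) : Set BW :=
  {a | ∃ p, IsFlangePos t p ∧ a ∈ Zcl (decAt t.clusters p)}

/-- The canonical splitting of a template `t` into its zigzag flange
`fl(t) = (a₀, …, a_k)` (given by the lists `A 0, …, A k` of clusters, each consisting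
of finite non-separating clusters of `t`) and its sections `t₁, …, t_k` (the maximal
groups of consecutive clusters forming finite templates), so that
`t = (a₀, t₁, a₁, …, a_{k−1}, t_k, a_k)`.  The two `interior` conditions express the
maximality of the decomposition. -/
structure SectionData (t : Template) where
  k : ℕ
  A : Fin (k + 1) → List (Bool × ℕ∞)
  T : Fin k → Template
  concat : t.clusters
      = A 0 ++ (List.ofFn fun i : Fin k => (T i).clusters ++ A i.succ).flatten
  finA : ∀ j, ∀ c ∈ A j, c.2 ≠ ⊤
  secFin : ∀ i, (T i).IsFiniteTemplate
  interior_ne : ∀ j : Fin (k + 1), (j : ℕ) ≠ 0 → (j : ℕ) ≠ k → A j ≠ []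
  interior_not_sep : ∀ j : Fin (k + 1), (j : ℕ) ≠ 0 → (j : ℕ) ≠ k →
      ∀ s : Bool, A j ≠ [(s, 1)]

/-- The binary word corresponding to a list of finite clusters (a flange word). -/
def flangeWord (cs : List (Bool × ℕ∞)) : BW :=
  (cs.map fun c => List.replicate c.2.toNat c.1).flatten

/-- `a₀ ⊔ ℓ 1 ⊔ a₁ ⊔ … ⊔ ℓ k ⊔ a_k` (empty flange words disappear). -/
def assemble {t : Template} (D : SectionData t) (ℓ : Fin D.k → BW) : BW :=
  flangeWord (D.A 0) ++ (List.ofFn fun i : Fin D.k => ℓ i ++ flangeWord (D.A i.succ)).flatten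

/-- `ℓ` is a decomposition of `a` along the sections of `t`:
`bw(a) = a₀ ⊔ bw(ℓ 1) ⊔ a₁ ⊔ … ⊔ bw(ℓ k) ⊔ a_k` with `ℓ i ∈ Z(tᵢ)`. -/
def decompOf {t : Template} (D : SectionData t) (a : BW) (ℓ : Fin D.k → BW) : Prop :=
  (∀ i, ℓ i ∈ Zt (D.T i)) ∧ a = assemble D ℓ

/-- The signs of the infinite clusters of a list of clusters, in order. -/
def infSigns (cs : List (Bool × ℕ∞)) : List Bool :=
  (cs.filter fun c => decide (c.2 = ⊤)).map Prod.fst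

/-- The number of weights consumed by the sections preceding the `i`-th one. -/
def secOffset {t : Template} (D : SectionData t) (i : Fin D.k) : ℕ :=
  ∑ i' ∈ Finset.univ.filter (· < i), (infSigns (D.T i').clusters).length

/-- The part `vᵢ` of the tuple of weights `w` corresponding to the infinite clusters of
the `i`-th section, as a sequence of (sign, weight) pairs. -/
def vD {t : Template} (D : SectionData t) (w : List ℝ) (i : Fin D.k) : List (Bool × ℝ) :=
  (infSigns (D.T i).clusters).zip (w.drop (secOffset D i))

/-- `F_λ(u)` for a finite sequence `u` of (sign, length) pairs and a zigzag `λ`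
(encoded by its binary word `a`, so that `λ` has `a.length + 1` boxes): the sum, over
all decompositions of `λ` into `u.length` consecutive (possibly empty) zigzags
`λ(1), …, λ(m)` with `λ(i)` a row when the `i`-th sign is `+` and a column when it is
`−`, of `u₁ ^ |λ(1)| ⋯ u_m ^ |λ(m)|`.  A decomposition is recorded by the tuple `c` of
the numbers of boxes of the pieces; the row/column constraint says that the letters of
`a` strictly inside the `i`-th group of boxes all equal the `i`-th sign. -/
noncomputable def Fword (u : List (Bool × ℝ)) (a : BW) : ℝ :=
  ∑ c ∈ (Finset.Nat.antidiagonalTuple u.length (a.length + 1)).filter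
      (fun c => ∀ i : Fin u.length,
        (a.drop (∑ i' ∈ Finset.univ.filter (· < i), c i')).take (c i - 1)
          = List.replicate (c i - 1) (u.get i).1),
    ∏ i, (u.get i).2 ^ c i

open Classical in
/-- The function `φ_{t,w}` attached to a semifinite zigzag growth model `(t, w)`:
it equals `+∞` on `J(t)`, and on `Z(t) ∖ J(t)` it equals
`F_{λ^{(1)}}(v₁) ⋯ F_{λ^{(k)}}(v_k)`, where `(λ^{(1)}, …, λ^{(k)})` is the (unique)
decomposition of `λ` along the sections of `t` (it is `0` off `Z(t)`). -/
noncomputable def phiTW (t : Template) (D : SectionData t) (w : List ℝ) (a : BW) : ℝ≥0∞ :=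
  if a ∉ Zt t then 0
  else if a ∈ Jt t then ⊤
  else if h : ∃ ℓ : Fin D.k → BW, decompOf D a ℓ then
    ENNReal.ofReal (∏ i, Fword (vD D w i) (h.choose i))
  else 0

section Kcone

/-- The relation `λ = ∑_{μ : λ ↗ μ} μ` (within `S`) as an element of the free module. -/
noncomputable def relOf (S : Set BW) (a : BW) : BW →₀ ℝ :=
  Finsupp.single a 1 - ∑ b ∈ upFinset S a, Finsupp.single b 1

/-- The submodule of relations defining `K(S)`. -/
noncomputable def Krel (S : Set BW) : Submodule ℝ (BW →₀ ℝ) :=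
  Submodule.span ℝ {f | ∃ a ∈ S, f = relOf S a}

/-- The class of `f` in `K(S) = (⊕_{λ ∈ S} ℝ λ) ⧸ (relations)`. -/
noncomputable def kmk (S : Set BW) (f : BW →₀ ℝ) : (BW →₀ ℝ) ⧸ Krel S :=
  Submodule.Quotient.mk f

/-- Nonnegative formal combinations of vertices of `S`. -/
def NonnegOn (S : Set BW) (f : BW →₀ ℝ) : Prop :=
  (∀ x, 0 ≤ f x) ∧ ∀ x ∈ f.support, x ∈ S

/-- The cone `K⁺(S)` spanned by the vertices of `S` in `K(S)`. -/
noncomputable def Kpos (S : Set BW) : Set ((BW →₀ ℝ) ⧸ Krel S) :=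
  kmk S '' {f | NonnegOn S f}

/-- The order defined by the cone `K⁺(S)`: `x ≤_K y` iff `y − x ∈ K⁺(S)`. -/
def leK (S : Set BW) (x y : (BW →₀ ℝ) ⧸ Krel S) : Prop := y - x ∈ Kpos S

/-- The value of (the canonical extension of) `φ` at a nonnegative combination of
vertices. -/
noncomputable def phiHat (φ : BW → ℝ≥0∞) (f : BW →₀ ℝ) : ℝ≥0∞ :=
  ∑ x ∈ f.support, ENNReal.ofReal (f x) * φ x

/-- `φ` is finite on `S`. -/
def FiniteOn (S : Set BW) (φ : BW → ℝ≥0∞) : Prop := ∀ a ∈ S, φ a ≠ ⊤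

/-- `φ` is a semifinite function on (the graph) `S`: it is not everywhere finite, and
its value at any element `a` of the cone `K⁺` is the supremum of its values at the
elements `b ≤_K a` of the cone where it is finite. -/
def SemifiniteOn (S : Set BW) (φ : BW → ℝ≥0∞) : Prop :=
  (∃ a ∈ S, φ a = ⊤) ∧
  ∀ f : BW →₀ ℝ, NonnegOn S f →
    phiHat φ f =
      ⨆ g ∈ {g : BW →₀ ℝ |
        NonnegOn S g ∧ leK S (kmk S g) (kmk S f) ∧ phiHat φ g ≠ ⊤}, phiHat φ g

/-- A semifinite harmonic function `φ` on `S` is indecomposable if any finite or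
semifinite harmonic function `φ′ ≤ φ` on `S` which does not vanish identically on the
finiteness ideal of `φ` is a constant multiple of `φ` on that ideal. -/
def IndecSemifiniteOn (S : Set BW) (φ : BW → ℝ≥0∞) : Prop :=
  ∀ φ' : BW → ℝ≥0∞, HarmonicOn S φ' →
    (FiniteOn S φ' ∨ SemifiniteOn S φ') →
    (∀ a ∈ S, φ' a ≤ φ a) →
    (∃ a ∈ S, φ a ≠ ⊤ ∧ φ' a ≠ 0) →
    ∃ c : ℝ≥0, ∀ a ∈ S, φ a ≠ ⊤ → φ' a = (c : ℝ≥0∞) * φ a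

end Kcone

end Zigzag

open scoped ENNReal NNReal

namespace Zigzag

/-! ### The averaging operator on functions on a graded subgraph -/

lemma mem_upFinset {S : Set BW} {a b : BW} : b ∈ upFinset S a ↔ b ∈ S ∧ CoveredBy a b := by
  simp [upFinset]

/-- Sum of a function over the upper neighbours of a vertex. -/
noncomputable def upSum (S : Set BW) (g : BW → ℝ≥0∞) (a : BW) : ℝ≥0∞ :=
  ∑ b ∈ upFinset S a, g b

/-- The iterates of `upSum`. -/
noncomputable def upIter (S : Set BW) (N : ℕ) (g : BW → ℝ≥0∞) : BW → ℝ≥0∞ :=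
  (upSum S)^[N] g

@[simp] lemma upIter_zero (S : Set BW) (g : BW → ℝ≥0∞) : upIter S 0 g = g := rfl

lemma upIter_succ (S : Set BW) (N : ℕ) (g : BW → ℝ≥0∞) (a : BW) :
    upIter S (N + 1) g a = ∑ b ∈ upFinset S a, upIter S N g b := by
  simp only [upIter, Function.iterate_succ_apply']
  rfl

lemma upIter_mono {S : Set BW} {g g' : BW → ℝ≥0∞} (h : ∀ a ∈ S, g a ≤ g' a) (N : ℕ) :
    ∀ a ∈ S, upIter S N g a ≤ upIter S N g' a := by
  induction N with
  | zero => simpa using h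
  | succ N ih =>
    intro a _
    simp only [upIter_succ]
    exact Finset.sum_le_sum fun b hb => ih b (mem_upFinset.1 hb).1

lemma upIter_add (S : Set BW) (g g' : BW → ℝ≥0∞) (N : ℕ) (a : BW) :
    upIter S N (fun x => g x + g' x) a = upIter S N g a + upIter S N g' a := by
  induction N generalizing a with
  | zero => rfl
  | succ N ih => simp only [upIter_succ, ih, Finset.sum_add_distrib]

lemma upIter_mul (S : Set BW) (c : ℝ≥0∞) (g : BW → ℝ≥0∞) (N : ℕ) (a : BW) :
    upIter S N (fun x => c * g x) a = c * upIter S N g a := by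
  induction N generalizing a with
  | zero => rfl
  | succ N ih => simp only [upIter_succ, ih, Finset.mul_sum]

lemma upIter_ne_top {S : Set BW} {g : BW → ℝ≥0∞} (h : ∀ a, g a ≠ ⊤) (N : ℕ) (a : BW) :
    upIter S N g a ≠ ⊤ := by
  induction N generalizing a with
  | zero => exact h a
  | succ N ih => simp only [upIter_succ]; exact ENNReal.sum_ne_top.2 fun b _ => ih b

lemma HarmonicOn.upIter_eq {S : Set BW} {φ : BW → ℝ≥0∞} (h : HarmonicOn S φ) (N : ℕ) :
    ∀ a ∈ S, upIter S N φ a = φ a := by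
  induction N with
  | zero => simp
  | succ N ih =>
    intro a ha
    rw [upIter_succ, h a ha]
    exact Finset.sum_congr rfl fun b hb => ih b (mem_upFinset.1 hb).1

/-- A set of binary words closed under passing to subwords. -/
def IsDown (S : Set BW) : Prop := ∀ a b : BW, a.Sublist b → b ∈ S → a ∈ S

lemma exists_coveredBy {a b : BW} (h : a.Sublist b) (hlt : a.length < b.length) :
    ∃ c, CoveredBy a c ∧ c.Sublist b := by
  induction h with
  | slnil => simp at hlt
  | @cons l₁ l₂ x h ih => exact ⟨x :: l₁, ⟨List.sublist_cons_self _ _, rfl⟩, h.cons_cons x⟩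
  | @cons_cons l₁ l₂ x h ih =>
    obtain ⟨c, hc, hc'⟩ := ih (by simpa using hlt)
    exact ⟨x :: c, ⟨hc.1.cons_cons x, by simp [hc.2]⟩, hc'.cons_cons x⟩

lemma sum_le_upIter {S : Set BW} (hS : IsDown S) (g : BW → ℝ≥0∞) (L : ℕ) :
    ∀ (a : BW) (B : Finset BW), (∀ b ∈ B, b ∈ S ∧ a.Sublist b ∧ b.length = a.length + L) →
      ∑ b ∈ B, g b ≤ upIter S L g a := by
  classical
  induction L with
  | zero =>
    intro a B hB
    have : B ⊆ {a} := fun b hb => by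
      obtain ⟨_, h1, h2⟩ := hB b hb
      simpa using (h1.eq_of_length (by simpa using h2.symm)).symm
    simpa using Finset.sum_le_sum_of_subset (f := g) this
  | succ L ih =>
    intro a B hB
    rw [upIter_succ]
    calc ∑ b ∈ B, g b
        ≤ ∑ b ∈ B, ∑ c ∈ upFinset S a, if c.Sublist b then g b else 0 := by
          refine Finset.sum_le_sum fun b hb => ?_
          obtain ⟨h0, h1, h2⟩ := hB b hb
          obtain ⟨c, hc, hc'⟩ := exists_coveredBy h1 (by omega)
          refine le_trans (by simp [hc']) (Finset.single_le_sum
            (f := fun c => if c.Sublist b then g b else 0) (fun _ _ => zero_le)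
            (mem_upFinset.2 ⟨hS _ _ hc' h0, hc⟩))
      _ = ∑ c ∈ upFinset S a, ∑ b ∈ B.filter (fun b => c.Sublist b), g b := by
          rw [Finset.sum_comm]
          simp only [Finset.sum_filter]
      _ ≤ _ := by
          refine Finset.sum_le_sum fun c hc => ih c _ fun b hb => ?_
          obtain ⟨hb1, hb2⟩ := Finset.mem_filter.1 hb
          obtain ⟨h0, h1, h2⟩ := hB b hb1
          have := (mem_upFinset.1 hc).2.2
          exact ⟨h0, hb2, by omega⟩

lemma HarmonicOn.antitone {S : Set BW} (hS : IsDown S) {φ : BW → ℝ≥0∞} (h : HarmonicOn S φ)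
    {a b : BW} (hab : a.Sublist b) (hb : b ∈ S) : φ b ≤ φ a := by
  have := sum_le_upIter hS φ (b.length - a.length) a {b} (by
    have := hab.length_le
    simp [hb, hab]; omega)
  rwa [Finset.sum_singleton, h.upIter_eq _ a (hS _ _ hab hb)] at this

/-! ### Elementary properties of `phiHat` -/

lemma phiHat_eq_sum {φ : BW → ℝ≥0∞} {f : BW →₀ ℝ} {s : Finset BW} (hs : f.support ⊆ s) :
    phiHat φ f = ∑ x ∈ s, ENNReal.ofReal (f x) * φ x := by
  refine Finset.sum_subset hs fun x _ hx => ?_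
  simp [Finsupp.notMem_support_iff.1 hx]

lemma phiHat_add {φ : BW → ℝ≥0∞} {f g : BW →₀ ℝ} (hf : ∀ x, 0 ≤ f x) (hg : ∀ x, 0 ≤ g x) :
    phiHat φ (f + g) = phiHat φ f + phiHat φ g := by
  classical
  rw [phiHat_eq_sum (Finsupp.support_add (g₁ := f) (g₂ := g)),
    phiHat_eq_sum (s := f.support ∪ g.support) Finset.subset_union_left,
    phiHat_eq_sum (f := g) (s := f.support ∪ g.support) Finset.subset_union_right,
    ← Finset.sum_add_distrib]
  refine Finset.sum_congr rfl fun x _ => ?_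
  rw [Finsupp.add_apply, ENNReal.ofReal_add (hf x) (hg x), add_mul]

lemma phiHat_smul {φ : BW → ℝ≥0∞} {f : BW →₀ ℝ} {r : ℝ} (hr : 0 ≤ r) :
    phiHat φ (r • f) = ENNReal.ofReal r * phiHat φ f := by
  rw [phiHat_eq_sum (Finsupp.support_smul (b := r) (g := f)), phiHat, Finset.mul_sum]
  refine Finset.sum_congr rfl fun x _ => ?_
  rw [Finsupp.smul_apply, smul_eq_mul, ENNReal.ofReal_mul hr, mul_assoc]

lemma phiHat_zero (φ : BW → ℝ≥0∞) : phiHat φ 0 = 0 := by simp [phiHat]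

lemma phiHat_single (φ : BW → ℝ≥0∞) (a : BW) : phiHat φ (Finsupp.single a 1) = φ a := by
  rw [phiHat_eq_sum (s := {a}) (Finsupp.support_single_subset)]
  simp

lemma phiHat_sum {φ : BW → ℝ≥0∞} {ι : Type*} (s : Finset ι) (f : ι → BW →₀ ℝ)
    (hf : ∀ i ∈ s, ∀ x, 0 ≤ f i x) :
    phiHat φ (∑ i ∈ s, f i) = ∑ i ∈ s, phiHat φ (f i) := by
  classical
  induction s using Finset.induction_on with
  | empty => simp [phiHat_zero]
  | insert i s hi ih =>
    rw [Finset.sum_insert hi, Finset.sum_insert hi, phiHat_add, ih]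
    · exact fun j hj => hf j (Finset.mem_insert_of_mem hj)
    · exact hf i (Finset.mem_insert_self _ _)
    · intro x
      rw [Finsupp.finsetSum_apply]
      exact Finset.sum_nonneg fun j hj => hf j (Finset.mem_insert_of_mem hj) x

lemma NonnegOn.zero (S : Set BW) : NonnegOn S 0 := by simp [NonnegOn]

lemma NonnegOn.add {S : Set BW} {f g : BW →₀ ℝ} (hf : NonnegOn S f) (hg : NonnegOn S g) :
    NonnegOn S (f + g) := by
  classical
  refine ⟨fun x => add_nonneg (hf.1 x) (hg.1 x), fun x hx => ?_⟩
  rcases Finset.mem_union.1 (Finsupp.support_add hx) with h | h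
  exacts [hf.2 x h, hg.2 x h]

lemma NonnegOn.smul {S : Set BW} {f : BW →₀ ℝ} {r : ℝ} (hr : 0 ≤ r) (hf : NonnegOn S f) :
    NonnegOn S (r • f) :=
  ⟨fun x => mul_nonneg hr (hf.1 x), fun x hx => hf.2 x (Finsupp.support_smul hx)⟩

lemma NonnegOn.sum {S : Set BW} {ι : Type*} (s : Finset ι) {f : ι → BW →₀ ℝ}
    (hf : ∀ i ∈ s, NonnegOn S (f i)) : NonnegOn S (∑ i ∈ s, f i) := by
  classical
  induction s using Finset.induction_on with
  | empty => simpa using NonnegOn.zero S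
  | insert i s hi ih =>
    rw [Finset.sum_insert hi]
    exact (hf i (Finset.mem_insert_self _ _)).add
      (ih fun j hj => hf j (Finset.mem_insert_of_mem hj))

lemma NonnegOn.single {S : Set BW} {a : BW} (ha : a ∈ S) : NonnegOn S (Finsupp.single a 1) := by
  classical
  refine ⟨fun x => ?_, fun x hx => ?_⟩
  · rw [Finsupp.single_apply]; split_ifs <;> norm_num
  · have := Finsupp.support_single_subset hx
    rw [Finset.mem_singleton] at this
    rwa [this]

lemma NonnegOn.mono {S T : Set BW} (h : S ⊆ T) {f : BW →₀ ℝ} (hf : NonnegOn S f) :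
    NonnegOn T f := ⟨hf.1, fun x hx => h (hf.2 x hx)⟩

lemma kmk_add (S : Set BW) (f g : BW →₀ ℝ) : kmk S (f + g) = kmk S f + kmk S g := rfl

lemma kmk_single_eq {S : Set BW} {a : BW} (ha : a ∈ S) :
    kmk S (Finsupp.single a 1) = kmk S (∑ b ∈ upFinset S a, Finsupp.single b 1) :=
  (Submodule.Quotient.eq _).2 (Submodule.subset_span ⟨a, ha, rfl⟩)

lemma sum_iSup_of_monotone {ι : Type*} {s : Finset ι} {f : ι → ℕ → ℝ≥0∞}
    (hf : ∀ a ∈ s, Monotone (f a)) : (∑ a ∈ s, ⨆ n, f a n) = ⨆ n, ∑ a ∈ s, f a n := by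
  rw [← Finset.sum_attach s]
  simp_rw [← Finset.sum_attach s fun a => f a _]
  exact ENNReal.finsetSum_iSup_of_monotone fun a => hf a a.2

/-! ### Minimal extension of a finite harmonic function from an upper subset -/

/-- A finite harmonic function on an upper subset `U` of `S`, extended by zero. -/
structure UpperHarmonic (S U : Set BW) (θ : BW → ℝ≥0∞) : Prop where
  subset : U ⊆ S
  up : ∀ a ∈ U, ∀ b ∈ S, CoveredBy a b → b ∈ U
  zero : ∀ a, a ∉ U → θ a = 0
  fin : ∀ a, θ a ≠ ⊤
  harm : ∀ a ∈ U, θ a = ∑ b ∈ upFinset S a, θ b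

/-- The minimal extension. -/
noncomputable def minExt (S : Set BW) (θ : BW → ℝ≥0∞) (a : BW) : ℝ≥0∞ := ⨆ N, upIter S N θ a

namespace UpperHarmonic

variable {S U : Set BW} {θ : BW → ℝ≥0∞}

lemma upIter_eq (h : UpperHarmonic S U θ) (N : ℕ) : ∀ a ∈ U, upIter S N θ a = θ a := by
  induction N with
  | zero => simp
  | succ N ih =>
    intro a ha
    rw [upIter_succ, h.harm a ha]
    exact Finset.sum_congr rfl fun b hb =>
      ih b (h.up a ha b (mem_upFinset.1 hb).1 (mem_upFinset.1 hb).2)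

lemma upIter_le_succ (h : UpperHarmonic S U θ) (N : ℕ) :
    ∀ a ∈ S, upIter S N θ a ≤ upIter S (N + 1) θ a := by
  induction N with
  | zero =>
    intro a _
    by_cases ha : a ∈ U
    · rw [h.upIter_eq _ a ha, h.upIter_eq _ a ha]
    · simp [h.zero a ha]
  | succ N ih =>
    intro a _
    rw [upIter_succ, upIter_succ S (N + 1)]
    exact Finset.sum_le_sum fun b hb => ih b (mem_upFinset.1 hb).1

lemma monotone_upIter (h : UpperHarmonic S U θ) {a : BW} (ha : a ∈ S) :
    Monotone fun N => upIter S N θ a := monotone_nat_of_le_succ fun N => h.upIter_le_succ N a ha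

lemma minExt_eq (h : UpperHarmonic S U θ) {a : BW} (ha : a ∈ U) : minExt S θ a = θ a := by
  simp [minExt, h.upIter_eq _ a ha]

lemma harmonicOn_minExt (h : UpperHarmonic S U θ) : HarmonicOn S (minExt S θ) := by
  intro a ha
  unfold minExt
  rw [sum_iSup_of_monotone fun b hb => h.monotone_upIter (mem_upFinset.1 hb).1]
  rw [← (h.monotone_upIter ha).iSup_nat_add 1]
  simp only [upIter_succ]

lemma minExt_le (_h : UpperHarmonic S U θ) {φ : BW → ℝ≥0∞} (hφ : HarmonicOn S φ)
    (hle : ∀ a ∈ S, θ a ≤ φ a) : ∀ a ∈ S, minExt S θ a ≤ φ a := by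
  intro a ha
  refine iSup_le fun N => ?_
  rw [← hφ.upIter_eq N a ha]
  exact upIter_mono hle N a ha

lemma phiHat_minExt (h : UpperHarmonic S U θ) {f : BW →₀ ℝ} (hf : NonnegOn S f) :
    phiHat (minExt S θ) f =
      ⨆ N, ∑ x ∈ f.support, ENNReal.ofReal (f x) * upIter S (N - x.length) θ x := by
  unfold phiHat minExt
  rw [← sum_iSup_of_monotone]
  · refine Finset.sum_congr rfl fun x hx => ?_
    rw [← ENNReal.mul_iSup]
    congr 1
    apply le_antisymm
    · exact iSup_le fun N => le_iSup_of_le (N + x.length) (by simp)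
    · exact iSup_le fun N => le_iSup (fun N => upIter S N θ x) _
  · intro x hx N N' hN
    exact mul_le_mul_right (h.monotone_upIter (hf.2 x hx) (Nat.sub_le_sub_right hN _)) _

/-- The real linear functional computing `upIter` at a given level. -/
noncomputable def level (S : Set BW) (θ : BW → ℝ≥0∞) (N : ℕ) : (BW →₀ ℝ) →ₗ[ℝ] ℝ :=
  Finsupp.linearCombination ℝ fun x => (upIter S (N - x.length) θ x).toReal

lemma level_relOf (h : UpperHarmonic S U θ) {a : BW} {N : ℕ} (hN : a.length < N) :
    level S θ N (relOf S a) = 0 := by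
  rw [relOf, map_sub, map_sum, level]
  simp only [Finsupp.linearCombination_single, one_smul]
  obtain ⟨k, rfl⟩ := Nat.exists_eq_add_of_lt hN
  rw [show a.length + k + 1 - a.length = k + 1 by omega, upIter_succ,
    ENNReal.toReal_sum fun b _ => upIter_ne_top h.fin _ _, sub_eq_zero]
  refine Finset.sum_congr rfl fun b hb => ?_
  have := (mem_upFinset.1 hb).2.2
  congr 2
  omega

lemma level_krel (h : UpperHarmonic S U θ) {r : BW →₀ ℝ} (hr : r ∈ Krel S) :
    ∃ N₀, ∀ N ≥ N₀, level S θ N r = 0 := by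
  induction hr using Submodule.span_induction with
  | mem x hx =>
    obtain ⟨a, -, rfl⟩ := hx
    exact ⟨a.length + 1, fun N hN => h.level_relOf hN⟩
  | zero => exact ⟨0, fun N _ => map_zero _⟩
  | add x y _ _ hx hy =>
    obtain ⟨N₁, h₁⟩ := hx
    obtain ⟨N₂, h₂⟩ := hy
    refine ⟨max N₁ N₂, fun N hN => ?_⟩
    rw [map_add, h₁ N (le_trans (le_max_left _ _) hN), h₂ N (le_trans (le_max_right _ _) hN),
      add_zero]
  | smul c x _ hx =>
    obtain ⟨N₁, h₁⟩ := hx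
    exact ⟨N₁, fun N hN => by rw [map_smul, h₁ N hN, smul_zero]⟩

lemma ofReal_level (h : UpperHarmonic S U θ) {f : BW →₀ ℝ} (hf : NonnegOn S f) (N : ℕ) :
    ENNReal.ofReal (level S θ N f) =
      ∑ x ∈ f.support, ENNReal.ofReal (f x) * upIter S (N - x.length) θ x := by
  rw [level, Finsupp.linearCombination_apply, Finsupp.sum,
    ENNReal.ofReal_sum_of_nonneg fun x _ => smul_nonneg (hf.1 x) ENNReal.toReal_nonneg]
  refine Finset.sum_congr rfl fun x _ => ?_
  rw [smul_eq_mul, ENNReal.ofReal_mul (hf.1 x), ENNReal.ofReal_toReal (upIter_ne_top h.fin _ _)]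

lemma phiHat_minExt_mono (h : UpperHarmonic S U θ) {f g : BW →₀ ℝ} (hf : NonnegOn S f)
    (hg : NonnegOn S g) (hgf : leK S (kmk S g) (kmk S f)) :
    phiHat (minExt S θ) g ≤ phiHat (minExt S θ) f := by
  obtain ⟨p, hp, hpe⟩ := hgf
  have hr : p - (f - g) ∈ Krel S := (Submodule.Quotient.eq _).1 hpe
  obtain ⟨N₀, hN₀⟩ := h.level_krel hr
  rw [h.phiHat_minExt hg]
  refine iSup_le fun N => ?_
  have hmono := h.phiHat_minExt hf
  rw [hmono]
  refine le_iSup_of_le (max N N₀) ?_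
  calc _ ≤ ∑ x ∈ g.support, ENNReal.ofReal (g x) * upIter S (max N N₀ - x.length) θ x :=
        Finset.sum_le_sum fun x hx => mul_le_mul_right (h.monotone_upIter (hg.2 x hx)
          (Nat.sub_le_sub_right (le_max_left _ _) _)) _
    _ = ENNReal.ofReal (level S θ (max N N₀) g) := (h.ofReal_level hg _).symm
    _ ≤ ENNReal.ofReal (level S θ (max N N₀) f) := by
        apply ENNReal.ofReal_le_ofReal
        have h1 := hN₀ (max N N₀) (le_max_right _ _)
        have h2 : 0 ≤ level S θ (max N N₀) p := by
          rw [level, Finsupp.linearCombination_apply]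
          exact Finset.sum_nonneg fun x _ => mul_nonneg (hp.1 x) ENNReal.toReal_nonneg
        rw [map_sub, map_sub] at h1
        linarith
    _ = _ := h.ofReal_level hf _

lemma exists_push_single (h : UpperHarmonic S U θ) (k : ℕ) : ∀ x ∈ S, ∃ g p : BW →₀ ℝ,
    NonnegOn U g ∧ NonnegOn S p ∧ kmk S (Finsupp.single x 1) = kmk S (g + p) ∧
      phiHat θ g = upIter S k θ x := by
  induction k with
  | zero =>
    intro x hx
    by_cases hU : x ∈ U
    · exact ⟨Finsupp.single x 1, 0, .single hU, .zero S, by simp, by simp [phiHat_single]⟩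
    · exact ⟨0, Finsupp.single x 1, .zero U, .single hx, by simp,
        by simp [phiHat_zero, h.zero x hU]⟩
  | succ k ih =>
    intro x hx
    choose! g p hg hp he hv using ih
    have hmem : ∀ b ∈ upFinset S x, b ∈ S := fun b hb => (mem_upFinset.1 hb).1
    refine ⟨∑ b ∈ upFinset S x, g b, ∑ b ∈ upFinset S x, p b,
      .sum _ fun b hb => hg b (hmem b hb), .sum _ fun b hb => hp b (hmem b hb), ?_, ?_⟩
    · rw [kmk_single_eq hx, ← Finset.sum_add_distrib]
      change (Krel S).mkQ _ = (Krel S).mkQ _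
      rw [map_sum, map_sum]
      exact Finset.sum_congr rfl fun b hb => he b (hmem b hb)
    · rw [phiHat_sum _ _ fun b hb => (hg b (hmem b hb)).1, upIter_succ]
      exact Finset.sum_congr rfl fun b hb => hv b (hmem b hb)

lemma exists_push (h : UpperHarmonic S U θ) {f : BW →₀ ℝ} (hf : NonnegOn S f) (k : BW → ℕ) :
    ∃ g p : BW →₀ ℝ, NonnegOn U g ∧ NonnegOn S p ∧ kmk S f = kmk S (g + p) ∧
      phiHat θ g = ∑ x ∈ f.support, ENNReal.ofReal (f x) * upIter S (k x) θ x := by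
  have := fun x (hx : x ∈ S) => h.exists_push_single (k x) x hx
  choose! g p hg hp he hv using this
  refine ⟨∑ x ∈ f.support, f x • g x, ∑ x ∈ f.support, f x • p x,
    .sum _ fun x hx => (hg x (hf.2 x hx)).smul (hf.1 x),
    .sum _ fun x hx => (hp x (hf.2 x hx)).smul (hf.1 x), ?_, ?_⟩
  · have hfs : f = ∑ x ∈ f.support, f x • Finsupp.single x (1 : ℝ) := by
      conv_lhs => rw [← Finsupp.sum_single f]
      simp [Finsupp.sum]
    conv_lhs => rw [hfs]
    rw [← Finset.sum_add_distrib]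
    change (Krel S).mkQ _ = (Krel S).mkQ _
    rw [map_sum, map_sum]
    refine Finset.sum_congr rfl fun x hx => ?_
    rw [← smul_add, map_smul, map_smul]
    congr 1
    exact he x (hf.2 x hx)
  · rw [phiHat_sum _ _ fun x hx => ((hg x (hf.2 x hx)).smul (hf.1 x)).1]
    refine Finset.sum_congr rfl fun x hx => ?_
    rw [phiHat_smul (hf.1 x), hv x (hf.2 x hx)]

lemma phiHat_minExt_of_upper (h : UpperHarmonic S U θ) {g : BW →₀ ℝ} (hg : NonnegOn U g) :
    phiHat (minExt S θ) g = phiHat θ g :=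
  Finset.sum_congr rfl fun x hx => by rw [h.minExt_eq (hg.2 x hx)]

lemma finiteOn_or_semifiniteOn (h : UpperHarmonic S U θ) :
    FiniteOn S (minExt S θ) ∨ SemifiniteOn S (minExt S θ) := by
  by_cases hfin : FiniteOn S (minExt S θ)
  · exact Or.inl hfin
  right
  refine ⟨by simpa [FiniteOn] using hfin, fun f hf => le_antisymm ?_ ?_⟩
  · rw [h.phiHat_minExt hf]
    refine iSup_le fun N => ?_
    obtain ⟨g, p, hg, hp, he, hv⟩ := h.exists_push hf fun x => N - x.length
    have hgθ := h.phiHat_minExt_of_upper hg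
    rw [← hv, ← hgθ]
    refine le_iSup₂_of_le (f := fun g (_ : g ∈ {g : BW →₀ ℝ | NonnegOn S g ∧
      leK S (kmk S g) (kmk S f) ∧ phiHat (minExt S θ) g ≠ ⊤}) => phiHat (minExt S θ) g)
      g ⟨hg.mono h.subset, ?_, ?_⟩ le_rfl
    · refine ⟨p, hp, ?_⟩
      rw [he, kmk_add, add_sub_cancel_left]
    · rw [hgθ]
      exact ENNReal.sum_ne_top.2 fun x _ => ENNReal.mul_ne_top ENNReal.ofReal_ne_top (h.fin x)
  · exact iSup₂_le fun g hg => h.phiHat_minExt_mono hf hg.1 hg.2.1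

/-- A semifinite indecomposable function is proportional, on its finiteness ideal, to the minimal
extension of any function it dominates. -/
lemma exists_mul_eq (h : UpperHarmonic S U θ) {φ : BW → ℝ≥0∞} (hφ : HarmonicOn S φ)
    (hindec : IndecSemifiniteOn S φ) (hle : ∀ a ∈ S, θ a ≤ φ a)
    (hne : ∃ a ∈ U, φ a ≠ ⊤ ∧ θ a ≠ 0) :
    ∃ c : ℝ≥0, ∀ a ∈ S, φ a ≠ ⊤ → minExt S θ a = c * φ a := by
  refine hindec _ h.harmonicOn_minExt h.finiteOn_or_semifiniteOn (h.minExt_le hφ hle) ?_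
  obtain ⟨a, ha, h1, h2⟩ := hne
  exact ⟨a, h.subset ha, h1, by rwa [h.minExt_eq ha]⟩

/-- A semifinite function which agrees with a minimal extension on its finiteness ideal agrees
with it everywhere. -/
lemma eq_minExt (h : UpperHarmonic S U θ) {φ : BW → ℝ≥0∞} (hsemi : SemifiniteOn S φ)
    (hle : ∀ a ∈ S, minExt S θ a ≤ φ a)
    (heq : ∀ a ∈ S, φ a ≠ ⊤ → minExt S θ a = φ a) : ∀ a ∈ S, φ a = minExt S θ a := by
  intro a ha
  refine le_antisymm ?_ (hle a ha)
  rw [← phiHat_single φ a, hsemi.2 _ (.single ha)]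
  refine iSup₂_le fun g hg => ?_
  obtain ⟨hg1, hg2, hg3⟩ := hg
  have : phiHat φ g = phiHat (minExt S θ) g := by
    refine Finset.sum_congr rfl fun x hx => ?_
    rw [heq x (hg1.2 x hx)]
    intro htop
    apply hg3
    refine ENNReal.sum_eq_top.2 ⟨x, hx, ?_⟩
    rw [htop, ENNReal.mul_top]
    have := lt_of_le_of_ne (hg1.1 x) (Finsupp.mem_support_iff.1 hx).symm
    simpa using this
  rw [this, ← phiHat_single (minExt S θ) a]
  exact h.phiHat_minExt_mono (.single ha) hg1 hg2

end UpperHarmonic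
/-- The tail of a sequence of natural numbers. -/
def shift {α : Type*} (q : ℕ → α) : ℕ → α := fun i => q (i + 1)

@[simp] lemma shift_apply {α : Type*} (q : ℕ → α) (i : ℕ) : shift q i = q (i + 1) := rfl

lemma shift_add_single_zero (q : ℕ → ℕ) : shift (q + Pi.single 0 1) = shift q := by
  ext i; simp

lemma shift_add_single_succ (q : ℕ → ℕ) (p : ℕ) :
    shift (q + Pi.single (p + 1) 1) = shift q + Pi.single p 1 := by
  ext i; simp [Pi.single_apply]

/-- The word made of consecutive constant blocks with prescribed letters and lengths. -/
def blockWord : List Bool → (ℕ → ℕ) → BW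
  | [], _ => []
  | s :: ss, q => List.replicate (q 0) s ++ blockWord ss (shift q)

@[simp] lemma blockWord_nil (q : ℕ → ℕ) : blockWord [] q = [] := rfl

lemma blockWord_cons (s : Bool) (ss : List Bool) (q : ℕ → ℕ) :
    blockWord (s :: ss) q = List.replicate (q 0) s ++ blockWord ss (shift q) := rfl

lemma blockWord_congr {ss : List Bool} {q q' : ℕ → ℕ} (h : ∀ i < ss.length, q i = q' i) :
    blockWord ss q = blockWord ss q' := by
  induction ss generalizing q q' with
  | nil => rfl
  | cons s ss ih =>
    rw [blockWord_cons, blockWord_cons, h 0 (by simp), ih]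
    intro i hi
    exact h (i + 1) (by simpa using hi)

lemma blockWord_mono {ss : List Bool} {q q' : ℕ → ℕ} (h : ∀ i < ss.length, q i ≤ q' i) :
    (blockWord ss q).Sublist (blockWord ss q') := by
  induction ss generalizing q q' with
  | nil => simp
  | cons s ss ih =>
    exact (List.replicate_sublist_replicate s |>.2 (h 0 (by simp))).append
      (ih fun i hi => h (i + 1) (by simpa using hi))

lemma length_blockWord (ss : List Bool) (q : ℕ → ℕ) :
    (blockWord ss q).length = ∑ i ∈ Finset.range ss.length, q i := by
  induction ss generalizing q with
  | nil => simp
  | cons s ss ih => simp [blockWord_cons, ih, Finset.sum_range_succ', add_comm]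

lemma length_blockWord_add_single (ss : List Bool) (q : ℕ → ℕ) {p : ℕ} (hp : p < ss.length) :
    (blockWord ss (q + Pi.single p 1)).length = (blockWord ss q).length + 1 := by
  simp [length_blockWord, Finset.sum_add_distrib, Pi.single_apply, hp]

lemma coveredBy_blockWord (ss : List Bool) (q : ℕ → ℕ) {p : ℕ} (hp : p < ss.length) :
    CoveredBy (blockWord ss q) (blockWord ss (q + Pi.single p 1)) :=
  ⟨blockWord_mono fun i _ => by simp, length_blockWord_add_single ss q hp⟩

lemma sublist_replicate_append {s : Bool} {a b : BW} {n : ℕ} (ha : a.head? ≠ some s)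
    (h : a.Sublist (List.replicate n s ++ b)) : a.Sublist b := by
  induction n with
  | zero => simpa using h
  | succ n ih =>
    rw [List.replicate_succ, List.cons_append, List.sublist_cons_iff] at h
    rcases h with h | ⟨r, rfl, -⟩
    · exact ih h
    · simp at ha

/-- The letters of the consecutive blocks alternate. -/
abbrev Alt (ss : List Bool) : Prop := ss.IsChain (· ≠ ·)

lemma Alt.tail {s : Bool} {ss : List Bool} (h : Alt (s :: ss)) : Alt ss :=
  (List.isChain_cons.1 h).2

lemma Alt.head {s : Bool} {ss : List Bool} (h : Alt (s :: ss)) : ss.head? ≠ some s := by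
  intro h'
  exact (List.isChain_cons.1 h).1 s h' rfl

lemma head_blockWord {ss : List Bool} {q : ℕ → ℕ} {s : Bool} (h : ss.head? ≠ some s)
    (hq : ∀ i < ss.length, 1 ≤ q i) : (blockWord ss q).head? ≠ some s := by
  cases ss with
  | nil => simp
  | cons x ss =>
    obtain ⟨m, hm⟩ := Nat.exists_eq_succ_of_ne_zero (Nat.one_le_iff_ne_zero.1 (hq 0 (by simp)))
    simpa [blockWord_cons, hm, List.replicate_succ] using h

lemma not_cons_blockWord_sublist {ss : List Bool} (hss : Alt ss) {q q' : ℕ → ℕ} {x : Bool}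
    (hx : ss.head? ≠ some x) (hq : ∀ i < ss.length, 1 ≤ q i) :
    ¬(x :: blockWord ss q).Sublist (blockWord ss q') := by
  induction ss generalizing q q' x with
  | nil => simp
  | cons s ss ih =>
    intro h
    rw [blockWord_cons, blockWord_cons] at h
    have h1 := sublist_replicate_append (by simpa using fun h' => hx (by simp [h'])) h
    obtain ⟨m, hm⟩ := Nat.exists_eq_succ_of_ne_zero (Nat.one_le_iff_ne_zero.1 (hq 0 (by simp)))
    refine ih hss.tail hss.head (q := shift q) (q' := shift q')
      (fun i hi => hq (i + 1) (by simpa using hi)) (List.Sublist.trans ?_ h1)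
    rw [hm, List.replicate_succ']
    refine List.Sublist.cons _ ?_
    simp

lemma cover_replicate_append {s : Bool} {ss : List Bool} (hss : Alt (s :: ss))
    (ih : ∀ {q q' : ℕ → ℕ} {b : BW}, (∀ i < ss.length, 1 ≤ q i) →
      CoveredBy (blockWord ss q) b → b.Sublist (blockWord ss q') →
      ∃ p < ss.length, b = blockWord ss (q + Pi.single p 1) ∧ q p < q' p)
    {n m : ℕ} {q q' : ℕ → ℕ} {b : BW} (hq : ∀ i < ss.length, 1 ≤ q i)
    (hb : CoveredBy (List.replicate n s ++ blockWord ss q) b)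
    (hle : b.Sublist (List.replicate m s ++ blockWord ss q')) :
    (b = List.replicate (n + 1) s ++ blockWord ss q ∧ n < m) ∨
      ∃ p < ss.length, b = List.replicate n s ++ blockWord ss (q + Pi.single p 1) ∧
        q p < q' p := by
  have key : ∀ {q q' : ℕ → ℕ} {b : BW}, (∀ i < ss.length, 1 ≤ q i) →
      (blockWord ss q).Sublist b → ¬ (s :: b).Sublist (blockWord ss q') := fun hq h h' =>
    not_cons_blockWord_sublist hss.tail hss.head hq ((h.cons_cons s).trans h')
  induction n generalizing m b with
  | zero =>
    simp only [List.replicate_zero, List.nil_append] at hb ⊢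
    cases b with
    | nil => simp [CoveredBy] at hb
    | cons x b =>
      by_cases hx : x = s
      · subst hx
        have h1 : (blockWord ss q).Sublist b :=
          sublist_replicate_append (n := 1) (head_blockWord hss.head hq) hb.1
        have h2 := h1.eq_of_length (by have := hb.2; simp at this; omega)
        refine Or.inl ⟨by simp [h2], ?_⟩
        by_contra hm
        obtain rfl : m = 0 := by omega
        exact key hq h1 (by simpa using hle)
      · exact Or.inr (ih hq hb (sublist_replicate_append (by simpa using hx) hle))
  | succ n ihn =>
    have hlen := hb.2
    rw [List.replicate_succ, List.cons_append] at hb hlen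
    cases b with
    | nil => simp at hlen
    | cons x b =>
      by_cases hx : x = s
      · subst hx
        have hb1 : CoveredBy (List.replicate n x ++ blockWord ss q) b :=
          ⟨List.cons_sublist_cons.1 hb.1, by simp at hlen ⊢; omega⟩
        cases m with
        | zero =>
          exact absurd (by simpa using hle)
            (key (q' := q') hq ((List.sublist_append_right _ _).trans hb1.1))
        | succ m =>
          rw [List.replicate_succ, List.cons_append, List.cons_sublist_cons] at hle
          rcases ihn hb1 hle with ⟨h1, h2⟩ | ⟨p, hp, h1, h2⟩
          · exact Or.inl ⟨by rw [h1, List.replicate_succ (n := n + 1)]; simp, by omega⟩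
          · exact Or.inr ⟨p, hp, by rw [h1, List.replicate_succ]; simp, h2⟩
      · have h1 := sublist_replicate_append (n := 1) (s := x) (by simpa using Ne.symm hx) hb.1
        have h2 := sublist_replicate_append (by simpa using hx) hle
        exact absurd (((List.sublist_append_right _ _).cons_cons s).trans h1 |>.trans
          ((List.sublist_cons_self x b).trans h2))
          (key (q' := q') hq (List.Sublist.refl _))

lemma exists_eq_blockWord_add_single {ss : List Bool} (hss : Alt ss) {q q' : ℕ → ℕ} {b : BW}
    (hq : ∀ i < ss.length, 1 ≤ q i) (hb : CoveredBy (blockWord ss q) b)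
    (hle : b.Sublist (blockWord ss q')) :
    ∃ p < ss.length, b = blockWord ss (q + Pi.single p 1) ∧ q p < q' p := by
  induction ss generalizing q q' b with
  | nil =>
    have := hb.2
    simp_all
  | cons s ss ih =>
    rcases cover_replicate_append hss (ih hss.tail) (q := shift q) (q' := shift q')
      (fun i hi => hq (i + 1) (by simpa using hi)) hb hle with ⟨h1, h2⟩ | ⟨p, hp, h1, h2⟩
    · exact ⟨0, by simp, by simpa [blockWord_cons, shift_add_single_zero] using h1, h2⟩
    · exact ⟨p + 1, by simpa using hp,
        by simpa [blockWord_cons, shift_add_single_succ] using h1, h2⟩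

lemma le_of_blockWord_sublist {ss : List Bool} (hss : Alt ss) {q q' : ℕ → ℕ}
    (hq : ∀ i < ss.length, 1 ≤ q i) (h : (blockWord ss q).Sublist (blockWord ss q')) :
    ∀ i < ss.length, q i ≤ q' i := by
  induction ss generalizing q q' with
  | nil => simp
  | cons s ss ih =>
    have hq1 : ∀ i < ss.length, 1 ≤ shift q i := fun i hi => hq (i + 1) (by simpa using hi)
    rw [blockWord_cons, blockWord_cons] at h
    have key : ∀ n m : ℕ, (List.replicate n s ++ blockWord ss (shift q)).Sublist
        (List.replicate m s ++ blockWord ss (shift q')) →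
        n ≤ m ∧ (blockWord ss (shift q)).Sublist (blockWord ss (shift q')) := by
      intro n
      induction n with
      | zero =>
        intro m hm
        exact ⟨Nat.zero_le _, sublist_replicate_append (head_blockWord hss.head hq1) hm⟩
      | succ n ihn =>
        intro m hm
        cases m with
        | zero =>
          refine absurd (List.Sublist.trans ?_ (by simpa using hm))
            (not_cons_blockWord_sublist (q' := shift q') hss.tail hss.head hq1)
          simp [List.replicate_succ]
        | succ m =>
          rw [List.replicate_succ, List.replicate_succ, List.cons_append, List.cons_append,
            List.cons_sublist_cons] at hm
          exact ⟨by have := (ihn m hm).1; omega, (ihn m hm).2⟩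
    obtain ⟨h0, h1⟩ := key _ _ h
    rintro (_ | i) hi
    · exact h0
    · exact ih hss.tail hq1 h1 i (by simpa using hi)

lemma blockWord_inj {ss : List Bool} (hss : Alt ss) {q q' : ℕ → ℕ}
    (hq : ∀ i < ss.length, 1 ≤ q i) (hq' : ∀ i < ss.length, 1 ≤ q' i)
    (h : blockWord ss q = blockWord ss q') : ∀ i < ss.length, q i = q' i := fun i hi =>
  le_antisymm (le_of_blockWord_sublist hss hq (h ▸ List.Sublist.refl _) i hi)
    (le_of_blockWord_sublist hss hq' (h ▸ List.Sublist.refl _) i hi)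

lemma cons_blockWord_eq {ss : List Bool} {q : ℕ → ℕ} {s : Bool} {j : ℕ} (hj : j < ss.length)
    (h : s :: blockWord ss q = blockWord ss (q + Pi.single j 1)) :
    ss[j]? = some s ∧ ∀ k < j, ss[k]? ≠ some s → q k = 0 := by
  induction ss generalizing q j with
  | nil => simp at hj
  | cons x ss ih =>
    cases j with
    | zero => simp [blockWord_cons, List.replicate_succ] at h; simp [h.1]
    | succ j =>
      simp only [blockWord_cons, shift_add_single_succ] at h
      have hj' : j < ss.length := by simpa using hj
      have h0 : (q + Pi.single (j + 1) 1 : ℕ → ℕ) 0 = q 0 := by simp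
      rw [h0] at h
      rcases Nat.eq_zero_or_pos (q 0) with hz | hz
      · rw [hz] at h
        obtain ⟨h1, h2⟩ := ih hj' (by simpa using h)
        refine ⟨by simpa using h1, ?_⟩
        rintro (_ | k) hk hne
        · exact hz
        · exact h2 k (by omega) (by simpa using hne)
      · have hsx : s = x := by
          obtain ⟨m, hm⟩ := Nat.exists_eq_succ_of_ne_zero hz.ne'
          simp [hm, List.replicate_succ] at h
          exact h.1
        subst hsx
        rw [← List.cons_append, ← List.replicate_succ, List.replicate_succ', List.append_assoc,
          List.append_cancel_left_eq] at h
        obtain ⟨h1, h2⟩ := ih hj' (by simpa using h)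
        refine ⟨by simpa using h1, ?_⟩
        rintro (_ | k) hk hne
        · simp at hne
        · exact h2 k (by omega) (by simpa using hne)

lemma blockWord_add_single_eq {ss : List Bool} {q : ℕ → ℕ} {i j : ℕ} (hij : i < j)
    (hj : j < ss.length)
    (h : blockWord ss (q + Pi.single i 1) = blockWord ss (q + Pi.single j 1)) :
    ss[i]? = ss[j]? ∧ ∀ k, i < k → k < j → ss[k]? ≠ ss[i]? → q k = 0 := by
  induction ss generalizing q i j with
  | nil => simp at hj
  | cons x ss ih =>
    obtain ⟨j, rfl⟩ := Nat.exists_eq_succ_of_ne_zero (by omega : j ≠ 0)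
    have hj' : j < ss.length := by simpa using hj
    simp only [Nat.succ_eq_add_one, blockWord_cons, shift_add_single_succ] at h
    have h0 : (q + Pi.single (j + 1) 1 : ℕ → ℕ) 0 = q 0 := by simp
    rw [h0] at h
    cases i with
    | zero =>
      rw [shift_add_single_zero] at h
      have h1 : (q + Pi.single 0 1 : ℕ → ℕ) 0 = q 0 + 1 := by simp
      rw [h1, List.replicate_succ', List.append_assoc, List.append_cancel_left_eq] at h
      obtain ⟨h2, h3⟩ := cons_blockWord_eq hj' (by simpa using h)
      refine ⟨by simp [h2], ?_⟩
      rintro (_ | k) hk hk' hne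
      · omega
      · exact h3 k (by omega) (by simpa using hne)
    | succ i =>
      have h1 : (q + Pi.single (i + 1) 1 : ℕ → ℕ) 0 = q 0 := by simp
      rw [shift_add_single_succ, h1, List.append_cancel_left_eq] at h
      obtain ⟨h2, h3⟩ := ih (by omega) hj' h
      refine ⟨by simpa using h2, ?_⟩
      rintro (_ | k) hk hk' hne
      · omega
      · exact h3 k (by omega) (by omega) (by simpa using hne)

/-- The number of infinite clusters. -/
def numTop (cs : List (Bool × ℕ∞)) : ℕ := (infSigns cs).length

/-- The lengths of the blocks obtained by giving the `j`-th infinite cluster the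
multiplicity `n j`. -/
def mults : List (Bool × ℕ∞) → (ℕ → ℕ) → ℕ → ℕ
  | [], _, _ => 0
  | c :: _, n, 0 => if c.2 = ⊤ then n 0 else c.2.toNat
  | c :: cs, n, p + 1 => mults cs (if c.2 = ⊤ then shift n else n) p

/-- The word obtained by giving the `j`-th infinite cluster the multiplicity `n j`. -/
def infWord (cs : List (Bool × ℕ∞)) (n : ℕ → ℕ) : BW := blockWord (cs.map Prod.fst) (mults cs n)

/-- The position of the `j`-th infinite cluster. -/
def posOf : List (Bool × ℕ∞) → ℕ → ℕ
  | [], _ => 0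
  | c :: cs, j => if c.2 = ⊤ then (if j = 0 then 0 else posOf cs (j - 1) + 1) else posOf cs j + 1

variable {c : Bool × ℕ∞} {cs : List (Bool × ℕ∞)} {n n' : ℕ → ℕ}

@[simp] lemma numTop_nil : numTop [] = 0 := rfl

lemma numTop_cons_top (hc : c.2 = ⊤) : numTop (c :: cs) = numTop cs + 1 := by
  simp [numTop, infSigns, hc]

lemma numTop_cons_fin (hc : c.2 ≠ ⊤) : numTop (c :: cs) = numTop cs := by
  simp [numTop, infSigns, hc]

lemma numTop_append (cs ds : List (Bool × ℕ∞)) : numTop (cs ++ ds) = numTop cs + numTop ds := by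
  simp [numTop, infSigns]

lemma numTop_eq_zero (h : ∀ c ∈ cs, c.2 ≠ ⊤) : numTop cs = 0 := by
  simpa [numTop, infSigns] using h

@[simp] lemma infWord_nil : infWord [] n = [] := rfl

lemma shift_mults : shift (mults (c :: cs) n) = mults cs (if c.2 = ⊤ then shift n else n) := rfl

lemma infWord_cons_top (hc : c.2 = ⊤) :
    infWord (c :: cs) n = List.replicate (n 0) c.1 ++ infWord cs (shift n) := by
  rw [infWord, List.map_cons, blockWord_cons, shift_mults]
  simp [mults, hc, infWord]

lemma infWord_cons_fin (hc : c.2 ≠ ⊤) :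
    infWord (c :: cs) n = List.replicate c.2.toNat c.1 ++ infWord cs n := by
  rw [infWord, List.map_cons, blockWord_cons, shift_mults]
  simp [mults, hc, infWord]

lemma infWord_const (cs : List (Bool × ℕ∞)) (N : ℕ) : infWord cs (fun _ => N) = clWord cs N := by
  induction cs with
  | nil => rfl
  | cons c cs ih =>
    by_cases hc : c.2 = ⊤
    · rw [infWord_cons_top hc]
      change _ ++ infWord cs (fun _ => N) = _
      rw [ih]
      simp [clWord, hc]
    · rw [infWord_cons_fin hc, ih]; simp [clWord, hc]

lemma mults_mono (h : ∀ j, n j ≤ n' j) (p : ℕ) : mults cs n p ≤ mults cs n' p := by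
  induction cs generalizing n n' p with
  | nil => simp [mults]
  | cons c cs ih =>
    cases p with
    | zero => simp only [mults]; split_ifs <;> simp [h]
    | succ p =>
      simp only [mults]
      split_ifs
      · exact ih (fun j => h (j + 1)) p
      · exact ih h p

lemma mults_congr (h : ∀ j < numTop cs, n j = n' j) (p : ℕ) : mults cs n p = mults cs n' p := by
  induction cs generalizing n n' p with
  | nil => simp [mults]
  | cons c cs ih =>
    by_cases hc : c.2 = ⊤
    · rw [numTop_cons_top hc] at h
      cases p with
      | zero => simp [mults, hc, h]
      | succ p =>
        simp only [mults, hc, if_true]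
        exact ih (fun j hj => h (j + 1) (by omega)) p
    · rw [numTop_cons_fin hc] at h
      cases p with
      | zero => simp [mults, hc]
      | succ p =>
        simp only [mults, hc, if_false]
        exact ih h p

lemma infWord_mono (h : ∀ j, n j ≤ n' j) : (infWord cs n).Sublist (infWord cs n') :=
  blockWord_mono fun p _ => mults_mono h p

lemma infWord_congr (h : ∀ j < numTop cs, n j = n' j) : infWord cs n = infWord cs n' :=
  blockWord_congr fun p _ => mults_congr h p

lemma posOf_spec {j : ℕ} (hj : j < numTop cs) : ∃ s, cs[posOf cs j]? = some (s, ⊤) := by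
  induction cs generalizing j with
  | nil => simp at hj
  | cons c cs ih =>
    by_cases hc : c.2 = ⊤
    · rw [numTop_cons_top hc] at hj
      cases j with
      | zero => exact ⟨c.1, by simp [posOf, hc, Prod.ext_iff]⟩
      | succ j => simpa [posOf, hc] using ih (by omega : j < numTop cs)
    · rw [numTop_cons_fin hc] at hj
      simpa [posOf, hc] using ih hj

lemma posOf_lt {j : ℕ} (hj : j < numTop cs) : posOf cs j < cs.length := by
  obtain ⟨s, hs⟩ := posOf_spec hj
  exact (List.getElem?_eq_some_iff.1 hs).1

lemma exists_posOf {p : ℕ} {s : Bool} (hp : cs[p]? = some (s, ⊤)) :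
    ∃ j < numTop cs, posOf cs j = p := by
  induction cs generalizing p with
  | nil => simp at hp
  | cons c cs ih =>
    cases p with
    | zero =>
      have hc : c.2 = ⊤ := by simp at hp; simp [hp]
      exact ⟨0, by simp [numTop_cons_top hc], by simp [posOf, hc]⟩
    | succ p =>
      obtain ⟨j, hj, rfl⟩ := ih (by simpa using hp)
      by_cases hc : c.2 = ⊤
      · exact ⟨j + 1, by simp [numTop_cons_top hc, hj], by simp [posOf, hc]⟩
      · exact ⟨j, by simp [numTop_cons_fin hc, hj], by simp [posOf, hc]⟩

lemma posOf_lt_posOf {i j : ℕ} (hij : i < j) (hj : j < numTop cs) :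
    posOf cs i < posOf cs j := by
  induction cs generalizing i j with
  | nil => simp at hj
  | cons c cs ih =>
    by_cases hc : c.2 = ⊤
    · rw [numTop_cons_top hc] at hj
      obtain ⟨j, rfl⟩ := Nat.exists_eq_succ_of_ne_zero (by omega : j ≠ 0)
      cases i with
      | zero => simp [posOf, hc]
      | succ i => simpa [posOf, hc] using ih (by omega : i < j) (by omega)
    · rw [numTop_cons_fin hc] at hj
      simpa [posOf, hc] using ih hij hj

lemma posOf_inj {i j : ℕ} (hi : i < numTop cs) (hj : j < numTop cs)
    (h : posOf cs i = posOf cs j) : i = j := by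
  rcases lt_trichotomy i j with h' | h' | h'
  · exact absurd h (posOf_lt_posOf h' hj).ne
  · exact h'
  · exact absurd h (posOf_lt_posOf h' hi).ne'

lemma mults_add_single {j : ℕ} (hj : j < numTop cs) :
    mults cs (n + Pi.single j 1) = mults cs n + Pi.single (posOf cs j) 1 := by
  induction cs generalizing n j with
  | nil => simp at hj
  | cons c cs ih =>
    ext p
    by_cases hc : c.2 = ⊤
    · rw [numTop_cons_top hc] at hj
      cases j with
      | zero =>
        cases p with
        | zero => simp [mults, posOf, hc]
        | succ p => simp [mults, posOf, hc, shift_add_single_zero]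
      | succ j =>
        cases p with
        | zero => simp [mults, posOf, hc]
        | succ p =>
          have := congrFun (ih (n := shift n) (by omega : j < numTop cs)) p
          simp only [mults, posOf, hc, if_true, shift_add_single_succ, this]
          simp [Pi.single_apply, mults, hc]
    · rw [numTop_cons_fin hc] at hj
      cases p with
      | zero => simp [mults, posOf, hc]
      | succ p =>
        have := congrFun (ih (n := n) hj) p
        simp only [mults, posOf, hc, if_false, this]
        simp [Pi.single_apply, mults, hc]

lemma mults_posOf {j : ℕ} (hj : j < numTop cs) : mults cs n (posOf cs j) = n j := by
  induction cs generalizing n j with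
  | nil => simp at hj
  | cons c cs ih =>
    by_cases hc : c.2 = ⊤
    · rw [numTop_cons_top hc] at hj
      cases j with
      | zero => simp [mults, posOf, hc]
      | succ j => simpa [mults, posOf, hc] using ih (n := shift n) (by omega : j < numTop cs)
    · rw [numTop_cons_fin hc] at hj
      simpa [mults, posOf, hc] using ih hj

lemma mults_of_ne_top {p : ℕ} (hp : cs[p]? = some c) (hc : c.2 ≠ ⊤) :
    mults cs n p = c.2.toNat := by
  induction cs generalizing n p with
  | nil => simp at hp
  | cons d cs ih =>
    cases p with
    | zero =>
      simp only [List.getElem?_cons_zero, Option.some.injEq] at hp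
      subst hp
      simp [mults, hc]
    | succ p => exact ih (by simpa using hp)

lemma one_le_toNat {q : ℕ∞} (h0 : q ≠ 0) (h : q ≠ ⊤) : 1 ≤ q.toNat := by
  lift q to ℕ using h
  simpa [Nat.one_le_iff_ne_zero] using h0

lemma one_le_mults (hpos : ∀ c ∈ cs, c.2 ≠ 0) (hn : ∀ j, 1 ≤ n j) :
    ∀ p < cs.length, 1 ≤ mults cs n p := by
  intro p hp
  have hs : cs[p]? = some cs[p] := List.getElem?_eq_getElem hp
  by_cases hc : cs[p].2 = ⊤
  · obtain ⟨j, hj, rfl⟩ := exists_posOf (s := cs[p].1) (by rw [hs, ← hc])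
    rw [mults_posOf hj]
    exact hn j
  · rw [mults_of_ne_top hs hc]
    exact one_le_toNat (hpos _ (List.getElem_mem hp)) hc

lemma infWord_mem_Zcl (cs : List (Bool × ℕ∞)) (n : ℕ → ℕ) : infWord cs n ∈ Zcl cs := by
  refine ⟨∑ i ∈ Finset.range (numTop cs), n i, ?_⟩
  rw [← infWord_const, infWord_congr (n' := fun j => if j < numTop cs then n j else 0)
    (fun j hj => by simp [hj])]
  refine infWord_mono fun j => ?_
  split_ifs with h
  · exact Finset.single_le_sum (f := n) (fun _ _ => Nat.zero_le _) (Finset.mem_range.2 h)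
  · exact Nat.zero_le _

lemma isDown_Zcl (cs : List (Bool × ℕ∞)) : IsDown (Zcl cs) :=
  fun _ _ hab ⟨N, hN⟩ => ⟨N, hab.trans hN⟩

lemma infWord_inj (halt : Alt (cs.map Prod.fst)) (hpos : ∀ c ∈ cs, c.2 ≠ 0)
    (hn : ∀ j, 1 ≤ n j) (hn' : ∀ j, 1 ≤ n' j) (h : infWord cs n = infWord cs n') :
    ∀ j < numTop cs, n j = n' j := by
  intro j hj
  have := blockWord_inj halt (by simpa using one_le_mults hpos hn)
    (by simpa using one_le_mults hpos hn') h (posOf cs j) (by simpa using posOf_lt hj)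
  rwa [mults_posOf hj, mults_posOf hj] at this

lemma length_infWord_add_single {j : ℕ} (hj : j < numTop cs) :
    (infWord cs (n + Pi.single j 1)).length = (infWord cs n).length + 1 := by
  rw [infWord, mults_add_single hj, length_blockWord_add_single _ _ (by simpa using posOf_lt hj)]
  rfl

lemma coveredBy_infWord {j : ℕ} (hj : j < numTop cs) :
    CoveredBy (infWord cs n) (infWord cs (n + Pi.single j 1)) :=
  ⟨infWord_mono fun i => by simp, length_infWord_add_single hj⟩

lemma exists_eq_infWord_add_single (halt : Alt (cs.map Prod.fst)) (hpos : ∀ c ∈ cs, c.2 ≠ 0)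
    (hn : ∀ j, 1 ≤ n j) {b : BW} (hb : CoveredBy (infWord cs n) b) (hbS : b ∈ Zcl cs) :
    ∃ j < numTop cs, b = infWord cs (n + Pi.single j 1) := by
  obtain ⟨N, hN⟩ := hbS
  rw [← infWord_const] at hN
  obtain ⟨p, hp, h1, h2⟩ := exists_eq_blockWord_add_single halt
    (by simpa using one_le_mults hpos hn) hb hN
  rw [List.length_map] at hp
  have hs : cs[p]? = some cs[p] := List.getElem?_eq_getElem hp
  by_cases hc : cs[p].2 = ⊤
  · obtain ⟨j, hj, rfl⟩ := exists_posOf (s := cs[p].1) (by rw [hs, ← hc])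
    exact ⟨j, hj, by rw [h1, infWord, mults_add_single hj]⟩
  · rw [mults_of_ne_top hs hc, mults_of_ne_top hs hc] at h2
    exact absurd h2 (lt_irrefl _)

lemma sum_upFinset_infWord {M : Type*} [AddCommMonoid M] (halt : Alt (cs.map Prod.fst))
    (hpos : ∀ c ∈ cs, c.2 ≠ 0) (hn : ∀ j, 1 ≤ n j) (f : BW → M) :
    ∑ b ∈ upFinset (Zcl cs) (infWord cs n), f b =
      ∑ j ∈ Finset.range (numTop cs), f (infWord cs (n + Pi.single j 1)) := by
  symm
  refine Finset.sum_nbij (fun j => infWord cs (n + Pi.single j 1)) ?_ ?_ ?_ fun _ _ => rfl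
  · intro j hj
    exact mem_upFinset.2 ⟨infWord_mem_Zcl _ _, coveredBy_infWord (Finset.mem_range.1 hj)⟩
  · intro i hi j hj hij
    have := infWord_inj halt hpos (fun k => (hn k).trans (by simp)) (fun k => (hn k).trans (by simp))
      hij i (by simpa using hi)
    by_contra hne
    simp [hne] at this
  · intro b hb
    obtain ⟨hbS, hcov⟩ := mem_upFinset.1 hb
    obtain ⟨j, hj, rfl⟩ := exists_eq_infWord_add_single halt hpos hn hcov hbS
    exact ⟨j, by simpa using hj, rfl⟩

section decAt

variable {p : ℕ}

lemma decAt_cons_succ : decAt (c :: cs) (p + 1) = c :: decAt cs p := by simp [decAt]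

lemma decAt_cons_zero : decAt (c :: cs) 0 = (c.1, c.2 - 1) :: cs := by simp [decAt]

lemma sub_one_ne_top {q : ℕ∞} (h : q ≠ ⊤) : q - 1 ≠ ⊤ := by
  lift q to ℕ using h
  exact ENat.natCast_ne_top _

lemma map_fst_decAt (cs : List (Bool × ℕ∞)) (p : ℕ) :
    (decAt cs p).map Prod.fst = cs.map Prod.fst := by
  induction cs generalizing p with
  | nil => simp [decAt]
  | cons c cs ih =>
    cases p with
    | zero => simp [decAt_cons_zero]
    | succ p => simp [decAt_cons_succ, ih]

lemma numTop_decAt {d : Bool × ℕ∞} (hp : cs[p]? = some d) (hd : d.2 ≠ ⊤) :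
    numTop (decAt cs p) = numTop cs := by
  induction cs generalizing p with
  | nil => simp at hp
  | cons c cs ih =>
    cases p with
    | zero =>
      obtain rfl : c = d := by simpa using hp
      rw [decAt_cons_zero, numTop_cons_fin hd, numTop_cons_fin (sub_one_ne_top hd)]
    | succ p =>
      have := ih (by simpa using hp)
      rw [decAt_cons_succ]
      by_cases hc : c.2 = ⊤
      · rw [numTop_cons_top hc, numTop_cons_top hc, this]
      · rw [numTop_cons_fin hc, numTop_cons_fin hc, this]

lemma posOf_decAt {d : Bool × ℕ∞} (hp : cs[p]? = some d) (hd : d.2 ≠ ⊤) (j : ℕ) :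
    posOf (decAt cs p) j = posOf cs j := by
  induction cs generalizing p j with
  | nil => simp at hp
  | cons c cs ih =>
    cases p with
    | zero =>
      obtain rfl : c = d := by simpa using hp
      simp [decAt_cons_zero, posOf, hd, sub_one_ne_top hd]
    | succ p =>
      have := ih (by simpa using hp)
      simp [decAt_cons_succ, posOf, this]

lemma mults_decAt {d : Bool × ℕ∞} (hp : cs[p]? = some d) (hd : d.2 ≠ ⊤) (hd0 : d.2 ≠ 0)
    (n : ℕ → ℕ) : mults (decAt cs p) n + Pi.single p 1 = mults cs n := by
  induction cs generalizing p n with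
  | nil => simp at hp
  | cons c cs ih =>
    ext i
    cases p with
    | zero =>
      obtain rfl : c = d := by simpa using hp
      cases i with
      | zero =>
        simp only [decAt_cons_zero, mults, Pi.add_apply, hd, sub_one_ne_top hd, if_false,
          Pi.single_eq_same]
        obtain ⟨s, q⟩ := c
        lift q to ℕ using hd
        have : q ≠ 0 := by simpa using hd0
        have h1 : ((q : ℕ∞) - 1).toNat = q - 1 := by
          rw [← ENat.natCast_one, ← ENat.natCast_sub, ENat.toNat_natCast]
        simp only [ENat.toNat_natCast, h1]
        omega
      | succ i => simp [decAt_cons_zero, mults, hd, sub_one_ne_top hd]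
    | succ p =>
      cases i with
      | zero => simp [decAt_cons_succ, mults]
      | succ i =>
        have := congrFun (ih (by simpa using hp) (if c.2 = ⊤ then shift n else n)) i
        simp only [decAt_cons_succ, mults, Pi.add_apply] at this ⊢
        simpa [Pi.single_apply] using this

end decAt

end Zigzag

namespace Zigzag

lemma Template.alt (t : Template) : Alt (t.clusters.map Prod.fst) :=
  (List.isChain_map Prod.fst).2 t.alternating

lemma Alt.getElem?_succ_ne {ss : List Bool} (h : Alt ss) {i : ℕ} (hi : i + 1 < ss.length) :
    ss[i + 1]? ≠ ss[i]? := by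
  have := List.isChain_iff_getElem.1 h i hi
  rw [List.getElem?_eq_getElem hi, List.getElem?_eq_getElem (by omega)]
  simpa using Ne.symm this

lemma Alt.getElem?_add_two {ss : List Bool} (h : Alt ss) {i : ℕ} (hi : i + 2 < ss.length) :
    ss[i + 2]? = ss[i]? := by
  have h1 := List.isChain_iff_getElem.1 h i (by omega)
  have h2 := List.isChain_iff_getElem.1 h (i + 1) (by omega)
  rw [List.getElem?_eq_getElem hi, List.getElem?_eq_getElem (by omega)]
  revert h1 h2
  cases ss[i] <;> cases ss[i + 1] <;> cases ss[i + 2] <;> simp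

lemma zero_pattern_of_blockWord_eq {ss : List Bool} (hss : Alt ss) {q : ℕ → ℕ} {p i j : ℕ}
    (hq : ∀ k < ss.length, q k = 0 → k = p) (hij : i < j) (hj : j < ss.length)
    (h : blockWord ss (q + Pi.single i 1) = blockWord ss (q + Pi.single j 1)) :
    p = i + 1 ∧ j = i + 2 ∧ q p = 0 := by
  obtain ⟨h1, h2⟩ := blockWord_add_single_eq hij hj h
  have hj1 : j ≠ i + 1 := by
    rintro rfl
    exact hss.getElem?_succ_ne hj h1.symm
  have hp0 : q (i + 1) = 0 := h2 _ (by omega) (by omega) (hss.getElem?_succ_ne (by omega))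
  have hp := hq (i + 1) (by omega) hp0
  subst hp
  refine ⟨rfl, ?_, hp0⟩
  by_contra hj2
  have h3 : ss[i + 3]? ≠ ss[i]? := by
    rw [← hss.getElem?_add_two (by omega : i + 2 < ss.length)]
    exact hss.getElem?_succ_ne (i := i + 2) (by omega)
  have hj3 : j ≠ i + 3 := by
    rintro rfl
    exact h3 h1.symm
  have := hq (i + 3) (by omega) (h2 _ (by omega) (by omega) h3)
  omega

lemma isSep_of_pattern {t : Template} {i : ℕ} {s s' s'' : Bool}
    (h0 : t.clusters[i]? = some (s, ⊤)) (h1 : t.clusters[i + 1]? = some (s', 1))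
    (h2 : t.clusters[i + 2]? = some (s'', ⊤)) : t.isSep (i + 1) := by
  have hlen := (List.getElem?_eq_some_iff.1 h2).1
  refine ⟨by omega, by omega, ?_, ?_, ?_⟩
  · simp [List.getD_eq_getElem?_getD, h1]
  · simp [List.getD_eq_getElem?_getD, h0]
  · simp [List.getD_eq_getElem?_getD, h2]

lemma IsFlangePos.exists_getElem? {t : Template} {p : ℕ} (h : IsFlangePos t p) :
    ∃ d, t.clusters[p]? = some d ∧ d.2 ≠ ⊤ ∧ d.2 ≠ 0 := by
  refine ⟨t.clusters[p]'h.1, List.getElem?_eq_getElem h.1, ?_, t.pos _ (List.getElem_mem h.1)⟩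
  have := h.2.1
  rwa [List.getD_eq_getElem?_getD, List.getElem?_eq_getElem h.1] at this

lemma add_sum_le_of_isFlangePos {t : Template} {p : ℕ} (hp : IsFlangePos t p)
    {φ : BW → ℝ≥0∞} (hφ : HarmonicOn (Zt t) φ) {n : ℕ → ℕ} (hn : ∀ j, 1 ≤ n j) :
    φ (infWord t.clusters n) + ∑ j ∈ Finset.range (numTop t.clusters),
      φ (infWord (decAt t.clusters p) (n + Pi.single j 1)) ≤
      φ (infWord (decAt t.clusters p) n) := by
  obtain ⟨d, hd, hdt, hd0⟩ := hp.exists_getElem?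
  have hlen := (List.getElem?_eq_some_iff.1 hd).1
  set cs := t.clusters with hcs
  set ss := cs.map Prod.fst with hss
  set q := mults (decAt cs p) n with hq
  have hqp : q + Pi.single p 1 = mults cs n := mults_decAt hd hdt hd0 n
  set f : ℕ → BW := fun i => blockWord ss (q + Pi.single i 1) with hf
  have hf0 : f p = infWord cs n := by simp only [hf, hqp, infWord]; rfl
  have hfj : ∀ j < numTop cs, infWord (decAt cs p) (n + Pi.single j 1) = f (posOf cs j) := by
    intro j hj
    rw [infWord, map_fst_decAt, mults_add_single (by rwa [numTop_decAt hd hdt]),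
      posOf_decAt hd hdt]
  have hpn : ∀ j < numTop cs, posOf cs j ≠ p := by
    rintro j hj rfl
    obtain ⟨s, hs⟩ := posOf_spec hj
    exact hdt (by rw [hs] at hd; cases hd; rfl)
  have hq0 : ∀ k < ss.length, q k = 0 → k = p := by
    intro k hk hk0
    by_contra hne
    have := one_le_mults t.pos hn k (by simpa [hss] using hk)
    rw [← hcs, ← hqp] at this
    simp [hk0, hne] at this
  set P : Finset ℕ := insert p ((Finset.range (numTop cs)).image (posOf cs)) with hP
  have hPlt : ∀ i ∈ P, i < ss.length := by
    intro i hi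
    rw [hss, List.length_map]
    rcases Finset.mem_insert.1 hi with rfl | hi
    · exact hlen
    · obtain ⟨j, hj, rfl⟩ := Finset.mem_image.1 hi
      exact posOf_lt (Finset.mem_range.1 hj)
  have hPinf : ∀ i ∈ P, i ≠ p → ∃ s, cs[i]? = some (s, ⊤) := by
    intro i hi hne
    rcases Finset.mem_insert.1 hi with h | hi
    · exact absurd h hne
    · obtain ⟨j, hj, rfl⟩ := Finset.mem_image.1 hi
      exact posOf_spec (Finset.mem_range.1 hj)
  have hlt : ∀ i ∈ P, ∀ j ∈ P, i < j → f i ≠ f j := by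
    intro i hi j hj hij h
    obtain ⟨rfl, rfl, hz⟩ := zero_pattern_of_blockWord_eq t.alt hq0 hij (hPlt j hj) h
    obtain ⟨s, hs⟩ := hPinf i hi (by omega)
    obtain ⟨s', hs'⟩ := hPinf (i + 2) hj (by omega)
    refine hp.2.2 (isSep_of_pattern hs (s' := d.1) ?_ hs')
    rw [hd]
    have h1 := congrFun hqp (i + 1)
    rw [Pi.add_apply, hz, mults_of_ne_top hd hdt, Pi.single_eq_same, zero_add] at h1
    obtain ⟨x, y⟩ := d
    lift y to ℕ using hdt
    simp only [ENat.toNat_natCast] at h1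
    simp [← h1]
  have hinj : Set.InjOn f P := by
    intro i hi j hj h
    rcases lt_trichotomy i j with h' | h' | h'
    · exact absurd h (hlt i hi j hj h')
    · exact h'
    · exact absurd h.symm (hlt j hj i hi h')
  have hv : infWord (decAt cs p) n = blockWord ss q := by rw [infWord, map_fst_decAt]
  have hsub : ∀ i ∈ P, f i ∈ upFinset (Zcl cs) (infWord (decAt cs p) n) := by
    intro i hi
    rw [mem_upFinset, hv]
    refine ⟨?_, coveredBy_blockWord ss q (hPlt i hi)⟩
    rcases Finset.mem_insert.1 hi with rfl | hi
    · rw [hf0]; exact infWord_mem_Zcl _ _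
    · obtain ⟨j, hj, rfl⟩ := Finset.mem_image.1 hi
      refine isDown_Zcl cs _ (infWord cs (n + Pi.single j 1)) ?_ (infWord_mem_Zcl _ _)
      refine blockWord_mono fun k _ => ?_
      rw [mults_add_single (Finset.mem_range.1 hj), ← hqp]
      simp only [Pi.add_apply]
      omega
  have hmem : infWord (decAt cs p) n ∈ Zt t := by
    refine isDown_Zcl cs _ (infWord cs n) ?_ (infWord_mem_Zcl _ _)
    rw [hv]
    exact blockWord_mono fun k _ => by rw [← hqp]; simp
  rw [hφ _ hmem]
  calc φ (infWord cs n) + ∑ j ∈ Finset.range (numTop cs),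
        φ (infWord (decAt cs p) (n + Pi.single j 1)) = ∑ i ∈ P, φ (f i) := by
        rw [hP, Finset.sum_insert, hf0, Finset.sum_image]
        · congr 1
          exact Finset.sum_congr rfl fun j hj => by rw [hfj j (Finset.mem_range.1 hj)]
        · intro i hi j hj h
          exact posOf_inj (by simpa using hi) (by simpa using hj) h
        · intro h
          obtain ⟨j, hj, h⟩ := Finset.mem_image.1 h
          exact hpn j (Finset.mem_range.1 hj) h
    _ = ∑ b ∈ P.image f, φ b := (Finset.sum_image hinj).symm
    _ ≤ ∑ b ∈ upFinset (Zcl cs) (infWord (decAt cs p) n), φ b :=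
        Finset.sum_le_sum_of_subset (Finset.image_subset_iff.2 hsub)

lemma HarmonicOn.infWord_eq {t : Template} {φ : BW → ℝ≥0∞} (hφ : HarmonicOn (Zt t) φ)
    {n : ℕ → ℕ} (hn : ∀ j, 1 ≤ n j) :
    φ (infWord t.clusters n) =
      ∑ j ∈ Finset.range (numTop t.clusters), φ (infWord t.clusters (n + Pi.single j 1)) := by
  rw [hφ _ (infWord_mem_Zcl _ _)]
  exact sum_upFinset_infWord t.alt t.pos hn φ

lemma eq_top_of_mem_Jt {t : Template} {φ : BW → ℝ≥0∞} (hφ : HarmonicOn (Zt t) φ)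
    (hpos : ∀ a ∈ Zt t, 0 < φ a) {a : BW} (ha : a ∈ Jt t) : φ a = ⊤ := by
  obtain ⟨p, hp, N, hN⟩ := ha
  have key : ∀ k : ℕ, ∀ n : ℕ → ℕ, (∀ j, 1 ≤ n j) →
      k * φ (infWord t.clusters n) ≤ φ (infWord (decAt t.clusters p) n) := by
    intro k
    induction k with
    | zero => simp
    | succ k ih =>
      intro n hn
      refine le_trans ?_ (add_sum_le_of_isFlangePos hp hφ hn)
      rw [Nat.cast_succ, add_mul, one_mul, add_comm]
      refine add_le_add le_rfl ?_
      rw [hφ.infWord_eq hn, Finset.mul_sum]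
      exact Finset.sum_le_sum fun j _ => ih _ fun i => (hn i).trans (by simp)
  have htop : φ (infWord (decAt t.clusters p) fun _ => N + 1) = ⊤ := by
    by_contra hne
    obtain ⟨k, hk⟩ := ENNReal.exists_nat_mul_gt
      (hpos _ (infWord_mem_Zcl t.clusters fun _ => N + 1)).ne' hne
    exact absurd (key k (fun _ => N + 1) fun _ => by omega) (not_le.2 hk)
  obtain ⟨d, hd, hdt, hd0⟩ := hp.exists_getElem?
  have hmem : infWord (decAt t.clusters p) (fun _ => N + 1) ∈ Zt t := by
    refine isDown_Zcl t.clusters _ (infWord t.clusters fun _ => N + 1) ?_ (infWord_mem_Zcl _ _)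
    rw [infWord, map_fst_decAt]
    exact blockWord_mono fun k _ => by rw [← mults_decAt hd hdt hd0]; simp
  refine top_le_iff.1 (htop ▸ hφ.antitone (isDown_Zcl _) ?_ hmem)
  rw [← infWord_const] at hN
  exact hN.trans (infWord_mono fun _ => by omega)

/-- The words in which all infinite clusters have multiplicity at least `n₀`. -/
def bigWords (cs : List (Bool × ℕ∞)) (n₀ : ℕ) : Set BW :=
  {a | ∃ n : ℕ → ℕ, (∀ j, n₀ ≤ n j) ∧ a = infWord cs n}

lemma infWord_mem_bigWords {cs : List (Bool × ℕ∞)} {n₀ : ℕ} {n : ℕ → ℕ} (hn : ∀ j, n₀ ≤ n j) :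
    infWord cs n ∈ bigWords cs n₀ := ⟨n, hn, rfl⟩

lemma le_add_single {n₀ : ℕ} {n : ℕ → ℕ} (hn : ∀ j, n₀ ≤ n j) (i : ℕ) :
    ∀ j, n₀ ≤ (n + Pi.single i 1 : ℕ → ℕ) j := fun j => (hn j).trans (by simp)

lemma upperHarmonic_indicator {t : Template} {n₀ : ℕ} (h0 : 1 ≤ n₀) {ψ : BW → ℝ≥0∞}
    (hfin : ∀ n : ℕ → ℕ, (∀ j, n₀ ≤ n j) → ψ (infWord t.clusters n) ≠ ⊤)
    (hharm : ∀ n : ℕ → ℕ, (∀ j, n₀ ≤ n j) → ψ (infWord t.clusters n) =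
      ∑ j ∈ Finset.range (numTop t.clusters), ψ (infWord t.clusters (n + Pi.single j 1))) :
    UpperHarmonic (Zt t) (bigWords t.clusters n₀) ((bigWords t.clusters n₀).indicator ψ) where
  subset := by
    rintro _ ⟨n, -, rfl⟩
    exact infWord_mem_Zcl _ _
  up := by
    rintro _ ⟨n, hn, rfl⟩ b hb hcov
    obtain ⟨j, -, rfl⟩ :=
      exists_eq_infWord_add_single t.alt t.pos (fun j => h0.trans (hn j)) hcov hb
    exact infWord_mem_bigWords (le_add_single hn j)
  zero := fun a ha => Set.indicator_of_notMem ha _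
  fin := by
    intro a
    by_cases ha : a ∈ bigWords t.clusters n₀
    · rw [Set.indicator_of_mem ha]
      obtain ⟨n, hn, rfl⟩ := ha
      exact hfin n hn
    · simp [Set.indicator_of_notMem ha]
  harm := by
    rintro _ ⟨n, hn, rfl⟩
    rw [Zt, sum_upFinset_infWord t.alt t.pos (fun j => h0.trans (hn j)),
      Set.indicator_of_mem (infWord_mem_bigWords hn), hharm n hn]
    exact Finset.sum_congr rfl fun j _ => by
      rw [Set.indicator_of_mem (infWord_mem_bigWords (le_add_single hn j))]

lemma SemifiniteOn.exists_ne_top {S : Set BW} {φ : BW → ℝ≥0∞} (h : SemifiniteOn S φ) :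
    ∃ a ∈ S, φ a ≠ ⊤ := by
  by_contra! hall
  obtain ⟨a, ha, hat⟩ := h.1
  have h1 := h.2 _ (NonnegOn.single ha)
  rw [phiHat_single, hat] at h1
  have h2 : (⨆ g ∈ {g : BW →₀ ℝ | NonnegOn S g ∧
      leK S (kmk S g) (kmk S (Finsupp.single a 1)) ∧ phiHat φ g ≠ ⊤}, phiHat φ g) ≤ 0 := by
    refine iSup₂_le fun g ⟨hg, _, hgt⟩ => ?_
    by_contra hne
    obtain ⟨x, hx, -⟩ := Finset.exists_ne_zero_of_sum_ne_zero (not_le.1 hne).ne'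
    refine hgt (ENNReal.sum_eq_top.2 ⟨x, hx, ?_⟩)
    have := lt_of_le_of_ne (hg.1 x) (Finsupp.mem_support_iff.1 hx).symm
    rw [hall x (hg.2 x hx), ENNReal.mul_top]
    simpa using this
  rw [← h1] at h2
  simp at h2

lemma exists_forall_infWord_ne_top {t : Template} {φ : BW → ℝ≥0∞} (hφ : HarmonicOn (Zt t) φ)
    (hsemi : SemifiniteOn (Zt t) φ) :
    ∃ n₀ : ℕ, 1 ≤ n₀ ∧ ∀ n : ℕ → ℕ, (∀ j, n₀ ≤ n j) → φ (infWord t.clusters n) ≠ ⊤ := by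
  obtain ⟨a, ⟨N, hN⟩, ha⟩ := hsemi.exists_ne_top
  refine ⟨N + 1, by omega, fun n hn => ?_⟩
  rw [← infWord_const] at hN
  exact ne_top_of_le_ne_top ha (hφ.antitone (isDown_Zcl _)
    (hN.trans (infWord_mono fun j => (Nat.le_succ N).trans (hn j))) (infWord_mem_Zcl _ _))

lemma exists_mul_infWord_add_single {t : Template} {φ : BW → ℝ≥0∞} (hφ : HarmonicOn (Zt t) φ)
    (hpos : ∀ a ∈ Zt t, 0 < φ a) (hindec : IndecSemifiniteOn (Zt t) φ) {n₀ : ℕ} (h0 : 1 ≤ n₀)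
    (hfin : ∀ n : ℕ → ℕ, (∀ j, n₀ ≤ n j) → φ (infWord t.clusters n) ≠ ⊤)
    (j : ℕ) :
    ∃ w : ℝ≥0, ∀ n : ℕ → ℕ, (∀ j, n₀ ≤ n j) →
      φ (infWord t.clusters (n + Pi.single j 1)) = w * φ (infWord t.clusters n) := by
  classical
  set U := bigWords t.clusters n₀ with hU
  let ψ : BW → ℝ≥0∞ := fun b => if h : b ∈ U then
    φ (infWord t.clusters (h.choose + Pi.single j 1)) else 0
  have hψ : ∀ n : ℕ → ℕ, (∀ j, n₀ ≤ n j) →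
      ψ (infWord t.clusters n) = φ (infWord t.clusters (n + Pi.single j 1)) := by
    intro n hn
    have h : infWord t.clusters n ∈ U := infWord_mem_bigWords hn
    simp only [ψ, h, dif_pos]
    have hs := h.choose_spec
    have := infWord_inj t.alt t.pos (fun j => h0.trans (hn j)) (fun j => h0.trans (hs.1 j)) hs.2
    exact congrArg φ (infWord_congr fun i hi => by simp [this i hi])
  have hUH : UpperHarmonic (Zt t) U (U.indicator ψ) := by
    refine upperHarmonic_indicator h0 (fun n hn => ?_) fun n hn => ?_
    · rw [hψ n hn]
      exact hfin _ (le_add_single hn j)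
    · rw [hψ n hn, hφ.infWord_eq fun i => h0.trans (le_add_single hn j i)]
      refine Finset.sum_congr rfl fun i _ => ?_
      rw [hψ _ (le_add_single hn i), add_right_comm]
  have hle : ∀ a ∈ Zt t, U.indicator ψ a ≤ φ a := by
    intro a _
    by_cases ha : a ∈ U
    · rw [Set.indicator_of_mem ha]
      obtain ⟨n, hn, rfl⟩ := ha
      rw [hψ n hn]
      exact hφ.antitone (isDown_Zcl _) (infWord_mono fun i => by simp) (infWord_mem_Zcl _ _)
    · simp [Set.indicator_of_notMem ha]
  have hconst : ∀ i : ℕ, n₀ ≤ (fun _ => n₀ : ℕ → ℕ) i := fun _ => le_rfl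
  obtain ⟨w, hw⟩ := hUH.exists_mul_eq hφ hindec hle ⟨infWord t.clusters fun _ => n₀,
    infWord_mem_bigWords hconst, hfin _ hconst, by
      rw [Set.indicator_of_mem (infWord_mem_bigWords hconst), hψ _ hconst]
      exact (hpos _ (infWord_mem_Zcl _ _)).ne'⟩
  refine ⟨w, fun n hn => ?_⟩
  rw [← hw _ (infWord_mem_Zcl _ _) (hfin n hn), hUH.minExt_eq (infWord_mem_bigWords hn),
    Set.indicator_of_mem (infWord_mem_bigWords hn), hψ n hn]

lemma eq_minExt_bigWords {t : Template} {φ : BW → ℝ≥0∞} (hφ : HarmonicOn (Zt t) φ)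
    (hpos : ∀ a ∈ Zt t, 0 < φ a) (hsemi : SemifiniteOn (Zt t) φ)
    (hindec : IndecSemifiniteOn (Zt t) φ) {n₀ : ℕ} (h0 : 1 ≤ n₀)
    (hfin : ∀ n : ℕ → ℕ, (∀ j, n₀ ≤ n j) → φ (infWord t.clusters n) ≠ ⊤) :
    ∀ a ∈ Zt t, φ a = minExt (Zt t) ((bigWords t.clusters n₀).indicator φ) a := by
  set U := bigWords t.clusters n₀ with hU
  have hUH : UpperHarmonic (Zt t) U (U.indicator φ) := upperHarmonic_indicator h0 hfin
    fun n hn => hφ.infWord_eq fun i => h0.trans (hn i)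
  have hle : ∀ a ∈ Zt t, U.indicator φ a ≤ φ a := fun a _ => Set.indicator_le_self _ _ _
  have hconst : ∀ i : ℕ, n₀ ≤ (fun _ => n₀ : ℕ → ℕ) i := fun _ => le_rfl
  have hmem : infWord t.clusters (fun _ => n₀) ∈ U := infWord_mem_bigWords hconst
  have hp := (hpos _ (infWord_mem_Zcl t.clusters fun _ => n₀)).ne'
  obtain ⟨w, hw⟩ := hUH.exists_mul_eq hφ hindec hle ⟨infWord t.clusters fun _ => n₀,
    hmem, hfin _ hconst, by rwa [Set.indicator_of_mem hmem]⟩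
  have hw1 : (w : ℝ≥0∞) = 1 := by
    have := hw _ (infWord_mem_Zcl _ _) (hfin _ hconst)
    rw [hUH.minExt_eq hmem, Set.indicator_of_mem hmem] at this
    nth_rewrite 1 [← one_mul (φ _)] at this
    exact ((ENNReal.mul_left_inj hp (hfin _ hconst)).1 this).symm
  exact hUH.eq_minExt hsemi (hUH.minExt_le hφ hle) fun a ha hat => by rw [hw a ha hat, hw1, one_mul]

lemma exists_weights {t : Template} {φ : BW → ℝ≥0∞} (hφ : HarmonicOn (Zt t) φ)
    (hpos : ∀ a ∈ Zt t, 0 < φ a) (hindec : IndecSemifiniteOn (Zt t) φ) {n₀ : ℕ} (h0 : 1 ≤ n₀)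
    (hfin : ∀ n : ℕ → ℕ, (∀ j, n₀ ≤ n j) → φ (infWord t.clusters n) ≠ ⊤) :
    ∃ w : ℕ → ℝ, (∀ j, 0 < w j) ∧ ∑ j ∈ Finset.range (numTop t.clusters), w j = 1 ∧
      ∀ n : ℕ → ℕ, (∀ j, n₀ ≤ n j) → ∀ j,
        φ (infWord t.clusters (n + Pi.single j 1)) =
          ENNReal.ofReal (w j) * φ (infWord t.clusters n) := by
  choose v hv using exists_mul_infWord_add_single hφ hpos hindec h0 hfin
  have hconst : ∀ i : ℕ, n₀ ≤ (fun _ => n₀ : ℕ → ℕ) i := fun _ => le_rfl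
  have hp := (hpos _ (infWord_mem_Zcl t.clusters fun _ => n₀)).ne'
  have hvpos : ∀ j, v j ≠ 0 := by
    intro j hz
    have := hv j _ hconst
    rw [hz, ENNReal.coe_zero, zero_mul] at this
    exact (hpos _ (infWord_mem_Zcl _ _)).ne' this
  have hsum : ∑ j ∈ Finset.range (numTop t.clusters), v j = 1 := by
    have := hφ.infWord_eq (n := fun _ => n₀) fun i => h0
    rw [Finset.sum_congr rfl fun j _ => hv j _ hconst,
      ← Finset.sum_mul] at this
    nth_rewrite 1 [← one_mul (φ _)] at this
    have := ((ENNReal.mul_left_inj hp (hfin _ hconst)).1 this).symm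
    exact_mod_cast this
  refine ⟨fun j => v j, fun j => NNReal.coe_pos.2 (pos_iff_ne_zero.2 (hvpos j)),
    (by exact_mod_cast hsum : ∑ j ∈ _, (v j : ℝ) = 1), fun n hn j => ?_⟩
  rw [ENNReal.ofReal_coe_nnreal]
  exact hv j n hn

/-- The contribution to `fRec` of the decompositions with nonempty first piece, where `h` is the
contribution of the remaining pieces. -/
noncomputable def fHead (h : BW → ℝ) (s : Bool) (x : ℝ) : BW → ℝ
  | [] => 1
  | l :: a => h a + if l = s then x * fHead h s x a else 0

/-- A recursive description of `Fword`. -/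
noncomputable def fRec : List (Bool × ℝ) → BW → ℝ
  | [], _ => 0
  | v :: u, a => fRec u a + v.2 * fHead (fRec u) v.1 v.2 a

lemma fRec_cons (s : Bool) (x : ℝ) (u : List (Bool × ℝ)) (a : BW) :
    fRec ((s, x) :: u) a = fRec u a + x * fHead (fRec u) s x a := rfl

lemma fHead_cons (h : BW → ℝ) (s : Bool) (x : ℝ) (l : Bool) (a : BW) :
    fHead h s x (l :: a) = h a + if l = s then x * fHead h s x a else 0 := rfl

/-- The letters strictly inside each piece of the decomposition `c` have the right sign. -/
def Fits (u : List (Bool × ℝ)) (a : BW) (c : Fin u.length → ℕ) : Prop :=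
  ∀ i : Fin u.length, (a.drop (∑ i' ∈ Finset.univ.filter (· < i), c i')).take (c i - 1)
    = List.replicate (c i - 1) (u.get i).1

instance (u : List (Bool × ℝ)) (a : BW) : DecidablePred (Fits u a) := fun c => by
  unfold Fits; infer_instance

/-- The sum defining `Fword`, over decompositions with a prescribed number `n` of boxes. -/
noncomputable def fGen (u : List (Bool × ℝ)) (n : ℕ) (a : BW) : ℝ :=
  ∑ c ∈ Finset.Nat.antidiagonalTuple u.length n,
    if Fits u a c then ∏ i, (u.get i).2 ^ c i else 0

lemma Fword_eq_fGen (u : List (Bool × ℝ)) (a : BW) : Fword u a = fGen u (a.length + 1) a := by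
  rw [Fword, fGen, Finset.sum_filter]
  rfl

lemma fits_cons {v : Bool × ℝ} {u : List (Bool × ℝ)} {a : BW} {k : ℕ} {c : Fin u.length → ℕ} :
    Fits (v :: u) a (Fin.cons k c : Fin (u.length + 1) → ℕ) ↔
      a.take (k - 1) = List.replicate (k - 1) v.1 ∧ Fits u (a.drop k) c := by
  unfold Fits
  refine (Fin.forall_fin_succ (n := u.length)).trans (and_congr ?_ (forall_congr' fun i => ?_))
  · simp
  · have h : ∑ i' ∈ Finset.univ.filter (· < i.succ), (Fin.cons k c : Fin (u.length + 1) → ℕ) i' =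
        k + ∑ i' ∈ Finset.univ.filter (· < i), c i' := by
      rw [Finset.sum_filter, Fin.sum_univ_succ, Finset.sum_filter]
      simp
    simp only [Fin.cons_succ, List.drop_drop]
    erw [h]
    rfl

lemma sum_antidiagonalTuple_succ {M : Type*} [AddCommMonoid M] (k n : ℕ)
    (f : (Fin (k + 1) → ℕ) → M) :
    ∑ c ∈ Finset.Nat.antidiagonalTuple (k + 1) n, f c =
      ∑ p ∈ Finset.HasAntidiagonal.antidiagonal n, ∑ c ∈ Finset.Nat.antidiagonalTuple k p.2, f (Fin.cons p.1 c) := by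
  rw [Finset.sum_sigma']
  refine Finset.sum_bij' (fun c _ => ⟨(c 0, ∑ i : Fin k, c i.succ), Fin.tail c⟩)
    (fun x _ => Fin.cons x.1.1 x.2) ?_ ?_ ?_ ?_ ?_
  · intro c hc
    rw [Finset.Nat.mem_antidiagonalTuple, Fin.sum_univ_succ] at hc
    simp [Finset.Nat.mem_antidiagonalTuple, hc, Fin.tail]
  · rintro ⟨p, c⟩ hc
    simp only [Finset.mem_sigma, Finset.HasAntidiagonal.mem_antidiagonal, Finset.Nat.mem_antidiagonalTuple] at hc
    rw [Finset.Nat.mem_antidiagonalTuple, Fin.sum_univ_succ]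
    simp [hc]
  · intro c _
    simp
  · rintro ⟨⟨p, q⟩, c⟩ hc
    simp only [Finset.mem_sigma, Finset.HasAntidiagonal.mem_antidiagonal, Finset.Nat.mem_antidiagonalTuple] at hc
    obtain ⟨-, rfl⟩ := hc
    simp
  · intro c _
    simp

lemma fGen_cons (v : Bool × ℝ) (u : List (Bool × ℝ)) (n : ℕ) (a : BW) :
    fGen (v :: u) n a = ∑ p ∈ Finset.HasAntidiagonal.antidiagonal n,
      if a.take (p.1 - 1) = List.replicate (p.1 - 1) v.1 then
        v.2 ^ p.1 * fGen u p.2 (a.drop p.1) else 0 := by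
  rw [fGen]
  refine (sum_antidiagonalTuple_succ u.length n _).trans (Finset.sum_congr rfl fun p _ => ?_)
  simp only [fits_cons]
  split_ifs with h
  · rw [fGen, Finset.mul_sum]
    refine Finset.sum_congr rfl fun c _ => ?_
    simp only [h, true_and, mul_ite, mul_zero]
    congr 1
    refine (Fin.prod_univ_succ (n := u.length) _).trans ?_
    simp
  · simp [h]

lemma fGen_zero (u : List (Bool × ℝ)) (a : BW) : fGen u 0 a = 1 := by
  rw [fGen, Finset.Nat.antidiagonalTuple_zero_right, Finset.sum_singleton, if_pos] <;> simp [Fits]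

lemma fGen_eq_fRec (u : List (Bool × ℝ)) (a : BW) : fGen u (a.length + 1) a = fRec u a := by
  induction u generalizing a with
  | nil => simp [fGen, fRec]
  | cons v u ih =>
    have key : ∀ a : BW, ∑ p ∈ Finset.HasAntidiagonal.antidiagonal a.length,
        (if a.take p.1 = List.replicate p.1 v.1 then
          v.2 ^ p.1 * fGen u p.2 (a.drop (p.1 + 1)) else 0) = fHead (fRec u) v.1 v.2 a := by
      intro a
      induction a with
      | nil => simp [fHead, fGen_zero]
      | cons l a iha =>
        rw [List.length_cons, Finset.Nat.sum_antidiagonal_succ, fHead_cons, ← iha]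
        simp only [List.take_zero, List.replicate_zero, if_true, pow_zero, one_mul, zero_add,
          List.drop_zero, List.take_succ_cons, List.replicate_succ,
          List.cons.injEq, List.drop_succ_cons]
        rw [ih]
        congr 1
        split_ifs with h
        · rw [Finset.mul_sum]
          refine Finset.sum_congr rfl fun p _ => ?_
          simp only [h, true_and, mul_ite, mul_zero, pow_succ']
          simp only [mul_assoc]
        · simp [h]
    rw [fGen_cons, Finset.Nat.sum_antidiagonal_succ]
    simp only [List.drop_zero, ih, pow_zero, one_mul, Nat.add_sub_cancel, Nat.zero_sub,
      List.take_zero, List.replicate_zero, if_true]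
    rw [fRec, ← key, Finset.mul_sum]
    congr 1
    refine Finset.sum_congr rfl fun p _ => ?_
    simp only [mul_ite, mul_zero, pow_succ', mul_assoc]

lemma Fword_eq_fRec (u : List (Bool × ℝ)) (a : BW) : Fword u a = fRec u a := by
  rw [Fword_eq_fGen, fGen_eq_fRec]

/-! ### Harmonicity -/

lemma upFinset_univ_nil : upFinset Set.univ [] = {[true], [false]} := by
  ext b
  rw [mem_upFinset]
  constructor
  · rintro ⟨-, -, h⟩
    obtain ⟨x, rfl⟩ := List.length_eq_one_iff.1 h
    cases x <;> simp
  · intro h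
    simp only [Finset.mem_insert, Finset.mem_singleton] at h
    rcases h with rfl | rfl <;> exact ⟨trivial, by simp, rfl⟩

lemma sum_upFinset_univ_cons {M : Type*} [AddCommMonoid M] (f : BW → M) (s : Bool) (a : BW) :
    ∑ b ∈ upFinset Set.univ (s :: a), f b =
      f ((!s) :: s :: a) + ∑ b ∈ upFinset Set.univ a, f (s :: b) := by
  have h : upFinset Set.univ (s :: a) =
      insert ((!s) :: s :: a) ((upFinset Set.univ a).image (List.cons s)) := by
    ext b
    simp only [mem_upFinset, Finset.mem_insert, Finset.mem_image, Set.mem_univ, true_and]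
    constructor
    · rintro ⟨h1, h2⟩
      cases b with
      | nil => simp at h2
      | cons x b =>
        by_cases hx : x = s
        · subst hx
          exact Or.inr ⟨b, ⟨List.cons_sublist_cons.1 h1, by simpa using h2⟩, rfl⟩
        · left
          have h3 := sublist_replicate_append (n := 1) (s := x) (by simpa using Ne.symm hx) h1
          have h4 := h3.eq_of_length (by simpa using h2.symm)
          rw [h4]
          congr 1
          revert hx; cases x <;> cases s <;> simp
    · rintro (rfl | ⟨b, ⟨h1, h2⟩, rfl⟩)
      · exact ⟨List.sublist_cons_self _ _, rfl⟩
      · exact ⟨h1.cons_cons s, by simp [h2]⟩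
  rw [h, Finset.sum_insert, Finset.sum_image]
  · intro b _ b' _ h
    simpa using h
  · simp

lemma fRec_nil (u : List (Bool × ℝ)) : fRec u [] = (u.map Prod.snd).sum := by
  induction u with
  | nil => rfl
  | cons v u ih => simp [fRec, ih, fHead, add_comm]

lemma sum_fHead {u : List (Bool × ℝ)} (s : Bool) (x : ℝ)
    (ih : ∀ a, ∑ b ∈ upFinset Set.univ a, fRec u b = (u.map Prod.snd).sum * fRec u a) (a : BW) :
    ∑ b ∈ upFinset Set.univ a, fHead (fRec u) s x b =
      fRec u a + ((u.map Prod.snd).sum + x) * fHead (fRec u) s x a := by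
  induction a with
  | nil =>
    rw [upFinset_univ_nil, Finset.sum_pair (by simp)]
    simp only [fHead, fRec_nil]
    cases s
    · simp
    · simp
      ring
  | cons l a iha =>
    rw [sum_upFinset_univ_cons]
    simp only [fHead_cons, Finset.sum_add_distrib, ih]
    by_cases h : l = s
    · subst h
      simp only [if_true, ← Finset.mul_sum, iha]
      simp
      ring
    · have h' : (!l) = s := by revert h; cases l <;> cases s <;> simp
      simp only [h, h', if_true, if_false, Finset.sum_const_zero]
      ring

lemma sum_fRec (u : List (Bool × ℝ)) (a : BW) :
    ∑ b ∈ upFinset Set.univ a, fRec u b = (u.map Prod.snd).sum * fRec u a := by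
  induction u generalizing a with
  | nil => simp [fRec]
  | cons v u ih =>
    simp only [fRec, Finset.sum_add_distrib, ← Finset.mul_sum, ih, sum_fHead v.1 v.2 ih,
      List.map_cons, List.sum_cons]
    ring

lemma fHead_nonneg {h : BW → ℝ} {x : ℝ} (hx : 0 ≤ x) (hh : ∀ a, 0 ≤ h a) (s : Bool) (a : BW) :
    0 ≤ fHead h s x a := by
  induction a with
  | nil => simp [fHead]
  | cons l a ih =>
    rw [fHead_cons]
    split_ifs
    · exact add_nonneg (hh a) (mul_nonneg hx ih)
    · simpa using hh a

lemma fRec_nonneg {u : List (Bool × ℝ)} (hu : ∀ v ∈ u, 0 ≤ v.2) (a : BW) : 0 ≤ fRec u a := by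
  induction u generalizing a with
  | nil => simp [fRec]
  | cons v u ih =>
    have hv := hu v (by simp)
    have ih' := ih fun v' hv' => hu v' (by simp [hv'])
    exact add_nonneg (ih' a) (mul_nonneg hv (fHead_nonneg hv ih' _ _))

/-- Attach weights to a list of signs. -/
def weighted : List Bool → (ℕ → ℝ) → List (Bool × ℝ)
  | [], _ => []
  | s :: ss, w => (s, w 0) :: weighted ss (shift w)

@[simp] lemma length_weighted (ss : List Bool) (w : ℕ → ℝ) :
    (weighted ss w).length = ss.length := by
  induction ss generalizing w with
  | nil => rfl
  | cons s ss ih => simp [weighted, ih]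

@[simp] lemma map_fst_weighted (ss : List Bool) (w : ℕ → ℝ) :
    (weighted ss w).map Prod.fst = ss := by
  induction ss generalizing w with
  | nil => rfl
  | cons s ss ih => simp [weighted, ih]

lemma zip_eq_weighted {ss : List Bool} {l : List ℝ} {w : ℕ → ℝ}
    (h : ∀ i < ss.length, l[i]? = some (w i)) : ss.zip l = weighted ss w := by
  induction ss generalizing l w with
  | nil => rfl
  | cons s ss ih =>
    cases l with
    | nil => simpa using h 0
    | cons x l =>
      have h0 : x = w 0 := by simpa using h 0 (by simp)
      have ih' := ih (l := l) (w := shift w) fun i hi => by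
        simpa using h (i + 1) (by simpa using hi)
      rw [weighted, List.zip_cons_cons, h0, ih']

lemma prod_weighted (ss : List Bool) (w : ℕ → ℝ) (c : ℕ → ℕ) :
    ∏ i : Fin (weighted ss w).length, ((weighted ss w).get i).2 ^ c i =
      ∏ j ∈ Finset.range ss.length, w j ^ c j := by
  induction ss generalizing w c with
  | nil => rfl
  | cons s ss ih =>
    have ih' := ih (shift w) (shift c)
    simp only [shift_apply] at ih'
    rw [List.length_cons, Finset.prod_range_succ', ← ih', mul_comm]
    exact Fin.prod_univ_succ (n := (weighted ss (shift w)).length) _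

lemma sum_weighted (ss : List Bool) (w : ℕ → ℝ) :
    ((weighted ss w).map Prod.snd).sum = ∑ j ∈ Finset.range ss.length, w j := by
  induction ss generalizing w with
  | nil => rfl
  | cons s ss ih =>
    rw [List.length_cons, Finset.sum_range_succ', weighted, List.map_cons, List.sum_cons, ih,
      add_comm]
    rfl

lemma weighted_nonneg {ss : List Bool} {w : ℕ → ℝ} (hw : ∀ j, 0 < w j) :
    ∀ v ∈ weighted ss w, 0 ≤ v.2 := by
  induction ss generalizing w with
  | nil => simp [weighted]
  | cons s ss ih =>
    intro v hv
    rcases List.mem_cons.1 hv with rfl | hv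
    · exact (hw 0).le
    · exact ih (fun j => hw (j + 1)) v hv

/-- A recursive description of `Fits`. -/
def FitsRec : List Bool → (ℕ → ℕ) → BW → Prop
  | [], _, _ => True
  | s :: ss, c, a => a.take (c 0 - 1) = List.replicate (c 0 - 1) s ∧
      FitsRec ss (shift c) (a.drop (c 0))

lemma fits_iff_fitsRec (u : List (Bool × ℝ)) (a : BW) (c : ℕ → ℕ) :
    Fits u a (fun i => c i) ↔ FitsRec (u.map Prod.fst) c a := by
  induction u generalizing a c with
  | nil => simp [Fits, FitsRec]
  | cons v u ih =>
    have h : (fun i : Fin (v :: u).length => c i) =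
        (Fin.cons (c 0) (fun i : Fin u.length => shift c i) : Fin (u.length + 1) → ℕ) := by
      funext i
      refine Fin.cases ?_ (fun i => ?_) (i : Fin (u.length + 1))
      · simp
      · simp
    rw [h, fits_cons, ih]
    rfl

lemma exists_nat_extension {m : ℕ} (c : Fin m → ℕ) : ∃ c' : ℕ → ℕ, c = fun i : Fin m => c' i :=
  ⟨fun i => if h : i < m then c ⟨i, h⟩ else 0, by simp⟩

lemma sublist_infWord_of_fitsRec {cs : List (Bool × ℕ∞)} (halt : Alt (cs.map Prod.fst))
    (hpos : ∀ c ∈ cs, c.2 ≠ 0) {c : ℕ → ℕ} {a : BW} (hc : FitsRec (infSigns cs) c a)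
    (hsum : ∑ j ∈ Finset.range (numTop cs), c j = a.length + 1) {n : ℕ → ℕ}
    (hn : ∀ j, c j < n j) :
    ∀ s, (cs.map Prod.fst).head? = some s → (s :: a).Sublist (infWord cs n) := by
  induction cs generalizing c a n with
  | nil => simp at hsum
  | cons d cs ih =>
    have ih' : ∀ {c : ℕ → ℕ} {a : BW}, FitsRec (infSigns cs) c a →
        ∑ j ∈ Finset.range (numTop cs), c j = a.length + 1 → ∀ {n : ℕ → ℕ}, (∀ j, c j < n j) →
        a.Sublist (infWord cs n) ∧ ∀ s, s ≠ d.1 → (s :: a).Sublist (infWord cs n) := by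
      intro c a h1 h2 n h3
      have h4 := ih halt.tail (fun c hc => hpos c (by simp [hc])) h1 h2 h3
      cases cs with
      | nil => simp at h2
      | cons e cs =>
        refine ⟨(List.sublist_cons_self _ _).trans (h4 e.1 (by simp)), fun s hs => h4 s ?_⟩
        have := halt.head
        simp only [List.map_cons, List.head?_cons, ne_eq, Option.some.injEq] at this ⊢
        revert hs this
        cases s <;> cases e.1 <;> cases d.1 <;> simp
    rintro s hs
    obtain rfl : d.1 = s := by simpa using hs
    by_cases hd : d.2 = ⊤
    · have hcons : infSigns (d :: cs) = d.1 :: infSigns cs := by simp [infSigns, hd]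
      rw [hcons] at hc
      obtain ⟨hc1, hc2⟩ := hc
      rw [numTop_cons_top hd, Finset.sum_range_succ'] at hsum
      rw [infWord_cons_top hd]
      have hn' : ∀ j, shift c j < shift n j := fun j => hn (j + 1)
      rcases Nat.eq_zero_or_pos (c 0) with h0 | h0
      · rw [h0, List.drop_zero] at hc2
        have := (ih' hc2 (by simpa [h0] using hsum) hn').1
        exact (List.replicate_sublist_replicate d.1 |>.2
          (show 1 ≤ n 0 by have := hn 0; omega)).append this
      · obtain ⟨k, hk⟩ := Nat.exists_eq_succ_of_ne_zero h0.ne'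
        have hn0 := hn 0
        rw [hk] at hc1 hc2 hsum hn0
        simp only [Nat.succ_eq_add_one, Nat.add_sub_cancel] at hc1 hc2 hsum hn0
        have ha : a = List.replicate k d.1 ++ a.drop k := by rw [← hc1, List.take_append_drop]
        cases hda : a.drop k with
        | nil =>
          rw [hda, List.append_nil] at ha
          rw [ha, ← List.replicate_succ]
          exact ((List.replicate_sublist_replicate d.1).2 (by omega)).trans
            (List.sublist_append_left _ _)
        | cons l a' =>
          rw [hda] at ha
          have hdrop : a.drop (k + 1) = a' := by
            rw [← List.drop_drop, hda]; rfl
          have hlen : a.length = k + (a'.length + 1) := by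
            rw [ha]; simp
          rw [hdrop] at hc2
          obtain ⟨h1, h2⟩ := ih' hc2 (show ∑ j ∈ Finset.range (numTop cs), c (j + 1) = _ by omega) hn'
          rw [ha, ← List.cons_append, ← List.replicate_succ]
          by_cases hl : l = d.1
          · have : List.replicate (k + 1) d.1 ++ d.1 :: a' = List.replicate (k + 2) d.1 ++ a' := by
              rw [List.replicate_succ' (n := k + 1), List.append_assoc]; rfl
            rw [hl, this]
            exact ((List.replicate_sublist_replicate _).2 (by omega)).append h1
          · exact ((List.replicate_sublist_replicate _).2 (by omega)).append (h2 l hl)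
    · have hcons : infSigns (d :: cs) = infSigns cs := by simp [infSigns, hd]
      rw [hcons] at hc
      rw [numTop_cons_fin hd] at hsum
      rw [infWord_cons_fin hd]
      exact (List.replicate_sublist_replicate d.1 |>.2
        (one_le_toNat (hpos d (by simp)) hd)).append (ih' hc hsum hn).1

lemma fRec_weighted_eq_sum (ss : List Bool) (w : ℕ → ℝ) (a : BW) :
    fRec (weighted ss w) a =
      ∑ c ∈ Finset.Nat.antidiagonalTuple (weighted ss w).length (a.length + 1),
        if Fits (weighted ss w) a c then ∏ i, ((weighted ss w).get i).2 ^ c i else 0 := by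
  rw [← fGen_eq_fRec, fGen]

lemma sublist_infWord_of_fits {cs : List (Bool × ℕ∞)} (halt : Alt (cs.map Prod.fst))
    (hpos : ∀ c ∈ cs, c.2 ≠ 0) {w : ℕ → ℝ} {c : ℕ → ℕ} {a : BW}
    (hc : Fits (weighted (infSigns cs) w) a (fun i => c i))
    (hsum : ∑ i : Fin (weighted (infSigns cs) w).length, c i = a.length + 1) {n : ℕ → ℕ}
    (hn : ∀ j, c j < n j) : a.Sublist (infWord cs n) := by
  rw [fits_iff_fitsRec, map_fst_weighted] at hc
  rw [Fin.sum_univ_eq_sum_range, length_weighted] at hsum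
  have := sublist_infWord_of_fitsRec halt hpos hc hsum hn
  cases cs with
  | nil => simp [infSigns] at hsum
  | cons d cs => exact (List.sublist_cons_self _ _).trans (this d.1 (by simp))

lemma mem_Zcl_of_fRec_ne_zero {cs : List (Bool × ℕ∞)} (halt : Alt (cs.map Prod.fst))
    (hpos : ∀ c ∈ cs, c.2 ≠ 0) {w : ℕ → ℝ} {a : BW}
    (h : fRec (weighted (infSigns cs) w) a ≠ 0) : a ∈ Zcl cs := by
  rw [fRec_weighted_eq_sum] at h
  obtain ⟨c, hc, hne⟩ := Finset.exists_ne_zero_of_sum_ne_zero h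
  rw [Finset.Nat.mem_antidiagonalTuple] at hc
  obtain ⟨c', rfl⟩ := exists_nat_extension c
  have hfit : Fits (weighted (infSigns cs) w) a fun i => c' i := by
    by_contra hf
    exact hne (if_neg hf)
  exact isDown_Zcl cs _ _ (sublist_infWord_of_fits halt hpos hfit hc (n := fun j => c' j + 1)
    fun j => Nat.lt_succ_self _) (infWord_mem_Zcl _ _)

lemma fRec_cons_infWord_eq_zero {cs : List (Bool × ℕ∞)} (halt : Alt (cs.map Prod.fst))
    (hpos : ∀ c ∈ cs, c.2 ≠ 0) (w : ℕ → ℝ) {x : Bool} (hx : (cs.map Prod.fst).head? ≠ some x)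
    {n : ℕ → ℕ} (hn : ∀ j, 1 ≤ n j) {a : BW} (ha : (x :: infWord cs n).Sublist a) :
    fRec (weighted (infSigns cs) w) a = 0 := by
  by_contra h
  obtain ⟨N, hN⟩ := mem_Zcl_of_fRec_ne_zero halt hpos h
  rw [← infWord_const] at hN
  exact not_cons_blockWord_sublist halt hx (by simpa using one_le_mults hpos hn) (ha.trans hN)

/-- Cluster lists of finite templates with infinite first cluster. -/
inductive FinT : List (Bool × ℕ∞) → Prop
  | single (s : Bool) : FinT [(s, ⊤)]
  | cons (s : Bool) (R : List (Bool × ℕ∞)) (h : FinT ((!s, ⊤) :: R)) :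
      FinT ((s, ⊤) :: (!s, ⊤) :: R)
  | sep (s : Bool) (R : List (Bool × ℕ∞)) (h : FinT ((s, ⊤) :: R)) :
      FinT ((s, ⊤) :: (!s, 1) :: (s, ⊤) :: R)

lemma FinT.alt {cs : List (Bool × ℕ∞)} (h : FinT cs) : Alt (cs.map Prod.fst) := by
  induction h with
  | single s => exact List.isChain_singleton _
  | cons s R h ih => exact List.IsChain.cons_cons (by simp) ih
  | sep s R h ih => exact List.IsChain.cons_cons (by simp) (List.IsChain.cons_cons (by simp) ih)

lemma FinT.pos {cs : List (Bool × ℕ∞)} (h : FinT cs) : ∀ c ∈ cs, c.2 ≠ 0 := by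
  induction h with
  | single s => simp
  | cons s R h ih =>
    intro c hc
    rcases List.mem_cons.1 hc with rfl | hc
    · simp
    · exact ih c hc
  | sep s R h ih =>
    intro c hc
    rcases List.mem_cons.1 hc with rfl | hc
    · simp
    · rcases List.mem_cons.1 hc with rfl | hc
      · simp
      · exact ih c hc

lemma fRec_cons_cons_self (s : Bool) (x : ℝ) (u : List (Bool × ℝ)) (a : BW) :
    fRec ((s, x) :: u) (s :: a) = fRec u (s :: a) + x * fRec ((s, x) :: u) a := by
  rw [fRec_cons, fRec_cons, fHead_cons, if_pos rfl]

lemma fRec_cons_replicate_append {s : Bool} {u : List (Bool × ℝ)} {r : BW}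
    (h : ∀ k, fRec u (s :: (List.replicate k s ++ r)) = 0) (x : ℝ) (n : ℕ) :
    fRec ((s, x) :: u) (List.replicate n s ++ r) = x ^ n * fRec ((s, x) :: u) r := by
  induction n with
  | zero => simp
  | succ n ih =>
    rw [List.replicate_succ, List.cons_append, fRec_cons_cons_self, h, ih]
    ring

lemma FinT.exists_fRec_infWord {cs : List (Bool × ℕ∞)} (h : FinT cs) {w : ℕ → ℝ}
    (hw : ∀ j, 0 < w j) :
    ∃ κ : ℝ, 0 < κ ∧ ∀ n : ℕ → ℕ, (∀ j, 1 ≤ j → 1 ≤ n j) →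
      fRec (weighted (infSigns cs) w) (infWord cs n) =
        κ * ∏ j ∈ Finset.range (numTop cs), w j ^ n j := by
  have infc : ∀ (s : Bool) (R : List (Bool × ℕ∞)), infSigns ((s, ⊤) :: R) = s :: infSigns R := by
    intro s R; simp [infSigns]
  have inff : ∀ (s : Bool) (R : List (Bool × ℕ∞)), infSigns ((s, 1) :: R) = infSigns R := by
    intro s R; simp [infSigns]
  induction h generalizing w with
  | single s =>
    refine ⟨w 0, hw 0, fun n _ => ?_⟩
    rw [infc, weighted, infWord_cons_top rfl, fRec_cons_replicate_append, numTop_cons_top rfl]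
    · simp [infSigns, weighted, fRec, fHead, infWord_nil, numTop, mul_comm]
    · simp [infSigns, weighted, fRec]
  | cons s R h ih =>
    obtain ⟨κ, hκ, H⟩ := ih (w := shift w) fun j => hw _
    refine ⟨κ * (1 + w 0 / w 1), by have := hw 0; have := hw 1; positivity, fun n hn => ?_⟩
    have hn' : ∀ j, 1 ≤ shift n j := fun j => hn _ (by simp)
    rw [infc, weighted, infWord_cons_top rfl, fRec_cons_replicate_append, numTop_cons_top rfl,
      Finset.prod_range_succ', fRec_cons, H _ fun j _ => hn' j, infWord_cons_top rfl]
    · obtain ⟨k, hk⟩ : ∃ k, shift n 0 = k + 1 := ⟨_, (Nat.sub_add_cancel (hn' 0)).symm⟩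
      have h1 := H (fun j => if j = 0 then k else shift n j) (by
        intro j hj; rw [if_neg (by omega)]; exact hn' j)
      have h2 : shift (fun j => if j = 0 then k else shift n j) = shift (shift n) := by
        funext j; simp
      rw [infWord_cons_top rfl, h2] at h1
      simp only [if_true] at h1
      rw [hk, List.replicate_succ, List.cons_append, fHead_cons, if_neg (by simp), h1,
        add_zero]
      have hk' : n 1 = k + 1 := hk
      have hw1 := (hw 1).ne'
      have e1 : ∏ j ∈ Finset.range (numTop ((!s, ⊤) :: R)),
          shift w j ^ (if j = 0 then k else shift n j) =
          (∏ j ∈ Finset.range (numTop R), w (j + 2) ^ n (j + 2)) * w 1 ^ k := by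
        rw [numTop_cons_top rfl, Finset.prod_range_succ']
        simp
      have e2 : ∏ j ∈ Finset.range (numTop ((!s, ⊤) :: R)), w (j + 1) ^ n (j + 1) =
          (∏ j ∈ Finset.range (numTop R), w (j + 2) ^ n (j + 2)) * w 1 ^ (k + 1) := by
        rw [numTop_cons_top rfl, Finset.prod_range_succ']
        simp [hk']
      simp only [shift_apply] at e1 ⊢
      rw [e1, e2]
      field_simp
      ring
    · intro k
      exact fRec_cons_infWord_eq_zero h.alt h.pos _ (by simp) hn'
        ((List.sublist_append_right _ _).cons_cons s)
  | sep s R h ih =>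
    obtain ⟨κ, hκ, H⟩ := ih (w := shift w) fun j => hw _
    refine ⟨w 0 * κ, by have := hw 0; positivity, fun n hn => ?_⟩
    have hn' : ∀ j, 1 ≤ shift n j := fun j => hn _ (by simp)
    have hz : ∀ a, ((!s) :: infWord ((s, ⊤) :: R) (shift n)).Sublist a →
        fRec (weighted (infSigns ((s, ⊤) :: R)) (shift w)) a = 0 := fun a ha =>
      fRec_cons_infWord_eq_zero h.alt h.pos _ (by simp) hn' ha
    have hcons : infWord ((!s, 1) :: (s, ⊤) :: R) (shift n) =
        (!s) :: infWord ((s, ⊤) :: R) (shift n) := by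
      rw [infWord_cons_fin (by simp)]; simp
    rw [infc, inff, weighted, infWord_cons_top rfl, hcons, fRec_cons_replicate_append,
      numTop_cons_top rfl, numTop_cons_fin (by simp), Finset.prod_range_succ', fRec_cons,
      hz _ (List.Sublist.refl _), fHead_cons, if_neg (by simp), H _ fun j _ => hn' j]
    · simp only [shift_apply]; ring
    · intro k
      exact hz _ ((List.sublist_append_right _ _).cons s)

/-- If all finite clusters are separating, the cluster list has the recursive structure. -/
lemma finT_of_forall {cs : List (Bool × ℕ∞)} (halt : Alt (cs.map Prod.fst)) (hne : cs ≠ [])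
    (hsep : ∀ i < cs.length, (cs.getD i (true, 1)).2 ≠ ⊤ → 0 < i ∧ i + 1 < cs.length ∧
      (cs.getD i (true, 1)).2 = 1 ∧ (cs.getD (i - 1) (true, 1)).2 = ⊤ ∧
      (cs.getD (i + 1) (true, 1)).2 = ⊤) : FinT cs := by
  induction hl : cs.length using Nat.strong_induction_on generalizing cs with
  | _ l ih =>
  match cs, hne with
  | [c], _ =>
    have hc : c.2 = ⊤ := by
      by_contra hc
      have := (hsep 0 (by simp) (by simpa using hc)).1
      omega
    obtain ⟨s, m⟩ := c
    obtain rfl : m = ⊤ := hc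
    exact .single s
  | (s, m) :: (s', m') :: R, _ =>
    have hm : m = ⊤ := by
      by_contra hc
      have := (hsep 0 (by simp) (by simpa using hc)).1
      omega
    have hs' : s' = !s := by
      have := halt.head
      simp only [List.map_cons, List.head?_cons, ne_eq, Option.some.injEq] at this
      revert this; cases s <;> cases s' <;> simp
    subst hm hs'
    by_cases hm' : m' = ⊤
    · subst hm'
      refine .cons s R (ih _ (by simp [← hl]) halt.tail (by simp) ?_ rfl)
      intro i hi hit
      obtain ⟨-, h2, h3, h4, h5⟩ := hsep (i + 1) (by simpa using hi) (by simpa using hit)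
      rcases i with _ | i
      · simp at hit
      · exact ⟨by omega, by simpa using h2, by simpa using h3, by simpa using h4, by simpa using h5⟩
    · obtain ⟨-, h2, h3, h4, h5⟩ := hsep 1 (by simp) (by simpa using hm')
      match R with
      | [] => simp at h2
      | (s'', m'') :: R =>
        have hs'' : s'' = s := by
          have := halt.tail.head
          simp only [List.map_cons, List.head?_cons, ne_eq, Option.some.injEq] at this
          revert this; cases s <;> cases s'' <;> simp
        obtain rfl : m' = 1 := by simpa using h3
        obtain rfl : m'' = ⊤ := by simpa using h5
        subst hs''
        refine .sep _ R (ih _ (by simp [← hl]) halt.tail.tail (by simp) ?_ rfl)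
        intro i hi hit
        obtain ⟨-, h2, h3, h4, h5⟩ := hsep (i + 2) (by simpa using hi) (by simpa using hit)
        rcases i with _ | i
        · simp at hit
        · simp only [List.length_cons] at h2
          exact ⟨by omega, by simp only [List.length_cons]; omega, by simpa using h3,
            by simpa using h4, by simpa using h5⟩

lemma Template.IsFiniteTemplate.finT {t : Template} (h : t.IsFiniteTemplate) :
    FinT t.clusters :=
  finT_of_forall t.alt t.ne h

lemma clWord_append (L R : List (Bool × ℕ∞)) (N : ℕ) :
    clWord (L ++ R) N = clWord L N ++ clWord R N := by
  simp [clWord]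

lemma clWord_mono (L : List (Bool × ℕ∞)) {N M : ℕ} (h : N ≤ M) :
    (clWord L N).Sublist (clWord L M) := by
  rw [← infWord_const, ← infWord_const]
  exact infWord_mono fun _ => h

lemma append_mem_Zcl {L R : List (Bool × ℕ∞)} {x y : BW} (hx : x ∈ Zcl L) (hy : y ∈ Zcl R) :
    x ++ y ∈ Zcl (L ++ R) := by
  obtain ⟨N, hN⟩ := hx
  obtain ⟨M, hM⟩ := hy
  refine ⟨max N M, ?_⟩
  rw [clWord_append]
  exact (hN.trans (clWord_mono _ (le_max_left _ _))).append
    (hM.trans (clWord_mono _ (le_max_right _ _)))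

lemma exists_of_mem_Zcl_append {L R : List (Bool × ℕ∞)} {a : BW} (ha : a ∈ Zcl (L ++ R)) :
    ∃ x ∈ Zcl L, ∃ y ∈ Zcl R, a = x ++ y := by
  obtain ⟨N, hN⟩ := ha
  rw [clWord_append, List.sublist_append_iff] at hN
  obtain ⟨x, y, rfl, hx, hy⟩ := hN
  exact ⟨x, ⟨N, hx⟩, y, ⟨N, hy⟩, rfl⟩

lemma mem_Zcl_nil {a : BW} : a ∈ Zcl [] ↔ a = [] := by
  constructor
  · rintro ⟨N, hN⟩
    simpa [clWord] using hN
  · rintro rfl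
    exact ⟨0, List.nil_sublist _⟩

lemma clWord_of_ne_top {B : List (Bool × ℕ∞)} (hB : ∀ c ∈ B, c.2 ≠ ⊤) (N : ℕ) :
    clWord B N = flangeWord B := by
  rw [clWord, flangeWord]
  congr 1
  exact List.map_congr_left fun c hc => by rw [if_neg (hB c hc)]

lemma mem_Zcl_of_ne_top {B : List (Bool × ℕ∞)} (hB : ∀ c ∈ B, c.2 ≠ ⊤) {a : BW} :
    a ∈ Zcl B ↔ a.Sublist (flangeWord B) := by
  simp [Zcl, clWord_of_ne_top hB]

lemma exists_mem_Zcl_decAt {B : List (Bool × ℕ∞)} (hB : ∀ c ∈ B, c.2 ≠ ⊤) {f : BW}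
    (hf : f.Sublist (flangeWord B)) (hne : f ≠ flangeWord B) :
    ∃ r < B.length, f ∈ Zcl (decAt B r) := by
  induction B generalizing f with
  | nil =>
    refine absurd ?_ hne
    simpa [flangeWord] using hf
  | cons c B ih =>
    have hB' : ∀ c ∈ B, c.2 ≠ ⊤ := fun c hc => hB c (by simp [hc])
    have h1 : flangeWord (c :: B) = List.replicate c.2.toNat c.1 ++ flangeWord B := by
      simp [flangeWord]
    rw [h1] at hf hne
    obtain ⟨x, y, rfl, hx, hy⟩ := List.sublist_append_iff.1 hf
    by_cases hxe : x = List.replicate c.2.toNat c.1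
    · obtain ⟨r, hr, h⟩ := ih hB' hy fun hye => hne (by rw [hxe, hye])
      refine ⟨r + 1, by simpa using hr, ?_⟩
      rw [decAt_cons_succ]
      refine append_mem_Zcl (L := [c]) ?_ h
      rw [mem_Zcl_of_ne_top (by simpa using hB c (by simp))]
      simpa [flangeWord] using hx
    · refine ⟨0, by simp, ?_⟩
      rw [decAt_cons_zero]
      have hc := hB c (by simp)
      refine append_mem_Zcl (L := [(c.1, c.2 - 1)]) ?_ ((mem_Zcl_of_ne_top hB').2 hy)
      obtain ⟨k, hk, rfl⟩ := List.sublist_replicate_iff.1 hx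
      lift c.2 to ℕ using hc with m hm
      have hm1 : (m : ℕ∞) - 1 = ((m - 1 : ℕ) : ℕ∞) := by simp
      rw [hm1, mem_Zcl_of_ne_top (by simp)]
      simp only [ENat.toNat_natCast] at hk hxe
      simp only [flangeWord, List.map_cons, List.map_nil, List.flatten_cons, List.flatten_nil,
        List.append_nil, ENat.toNat_natCast, List.replicate_sublist_replicate]
      have : k ≠ m := fun h => hxe (by rw [h])
      omega

lemma decAt_append_append (L B R : List (Bool × ℕ∞)) {r : ℕ} (hr : r < B.length) :
    decAt (L ++ B ++ R) (L.length + r) = L ++ decAt B r ++ R := by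
  induction L with
  | nil =>
    have h : (B ++ R).getD r (true, 1) = B.getD r (true, 1) := by
      simp [List.getD_eq_getElem?_getD, List.getElem?_append_left hr]
    simp only [List.nil_append, List.length_nil, Nat.zero_add, decAt, h]
    rw [List.set_append_left _ _ hr]
  | cons c L ih =>
    rw [List.cons_append, List.cons_append, List.length_cons, Nat.add_right_comm, decAt_cons_succ,
      ih]
    rfl

lemma infWord_append (L R : List (Bool × ℕ∞)) (n : ℕ → ℕ) :
    infWord (L ++ R) n = infWord L n ++ infWord R (fun j => n (numTop L + j)) := by
  induction L generalizing n with
  | nil => simp [infWord_nil, numTop, infSigns]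
  | cons c L ih =>
    by_cases hc : c.2 = ⊤
    · rw [List.cons_append, infWord_cons_top hc, infWord_cons_top hc, ih, numTop_cons_top hc,
        List.append_assoc]
      simp only [shift_apply, Nat.add_right_comm]
    · rw [List.cons_append, infWord_cons_fin hc, infWord_cons_fin hc, ih, numTop_cons_fin hc,
        List.append_assoc]

lemma infWord_of_ne_top {B : List (Bool × ℕ∞)} (hB : ∀ c ∈ B, c.2 ≠ ⊤) (n : ℕ → ℕ) :
    infWord B n = flangeWord B := by
  rw [infWord_congr (n' := fun _ => 0) (by simp [numTop_eq_zero hB]), infWord_const,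
    clWord_of_ne_top hB]

/-! ### Sections and flange words -/

/-- The list of clusters obtained from sections `T` followed by flange pieces `B`. -/
def secCl {k : ℕ} (T B : Fin k → List (Bool × ℕ∞)) : List (Bool × ℕ∞) :=
  (List.ofFn fun i => T i ++ B i).flatten

/-- The word obtained from section words `ℓ` followed by the words of flange pieces `B`. -/
def secWord {k : ℕ} (B : Fin k → List (Bool × ℕ∞)) (ℓ : Fin k → BW) : BW :=
  (List.ofFn fun i => ℓ i ++ flangeWord (B i)).flatten

section

variable {k : ℕ}

lemma secCl_succ (T B : Fin (k + 1) → List (Bool × ℕ∞)) :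
    secCl T B = T 0 ++ B 0 ++ secCl (fun i => T i.succ) (fun i => B i.succ) := by
  simp [secCl, List.ofFn_succ]

lemma secWord_succ (B : Fin (k + 1) → List (Bool × ℕ∞)) (ℓ : Fin (k + 1) → BW) :
    secWord B ℓ = ℓ 0 ++ flangeWord (B 0) ++ secWord (fun i => B i.succ) (fun i => ℓ i.succ) := by
  simp [secWord, List.ofFn_succ]

lemma flangeWord_mem_Zcl {B : List (Bool × ℕ∞)} (hB : ∀ c ∈ B, c.2 ≠ ⊤) : flangeWord B ∈ Zcl B :=
  (mem_Zcl_of_ne_top hB).2 (List.Sublist.refl _)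

lemma secWord_mem_Zcl {T B : Fin k → List (Bool × ℕ∞)} (hB : ∀ i, ∀ c ∈ B i, c.2 ≠ ⊤)
    {ℓ : Fin k → BW} (hℓ : ∀ i, ℓ i ∈ Zcl (T i)) : secWord B ℓ ∈ Zcl (secCl T B) := by
  induction k with
  | zero => exact mem_Zcl_nil.2 rfl
  | succ k ih =>
    rw [secWord_succ, secCl_succ]
    exact append_mem_Zcl (append_mem_Zcl (hℓ 0) (flangeWord_mem_Zcl (hB 0)))
      (ih (fun i => hB i.succ) fun i => hℓ i.succ)

lemma length_secWord (B : Fin k → List (Bool × ℕ∞)) (ℓ : Fin k → BW) :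
    (secWord B ℓ).length = ∑ i, (ℓ i).length + ∑ i, (flangeWord (B i)).length := by
  induction k with
  | zero => rfl
  | succ k ih =>
    rw [secWord_succ, List.length_append, ih, Fin.sum_univ_succ, Fin.sum_univ_succ,
      List.length_append]
    omega

lemma secWord_mono (B : Fin k → List (Bool × ℕ∞)) {ℓ ℓ' : Fin k → BW}
    (h : ∀ i, (ℓ i).Sublist (ℓ' i)) : (secWord B ℓ).Sublist (secWord B ℓ') := by
  induction k with
  | zero => exact List.Sublist.refl _
  | succ k ih =>
    rw [secWord_succ, secWord_succ]
    exact ((h 0).append (List.Sublist.refl _)).append (ih _ fun i => h i.succ)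

/-- Words of the coideal of `secCl T B` missing a letter of some flange piece. -/
def secBad (T B : Fin k → List (Bool × ℕ∞)) : Set BW :=
  {a | ∃ (L : List (Bool × ℕ∞)) (j : Fin k) (R : List (Bool × ℕ∞)),
    secCl T B = L ++ B j ++ R ∧ ((j : ℕ) + 1 = k → R = []) ∧ ∃ x ∈ Zcl L, ∃ f,
      f.Sublist (flangeWord (B j)) ∧ f ≠ flangeWord (B j) ∧ ∃ y ∈ Zcl R, a = x ++ f ++ y}

lemma mem_secBad_head {T B : Fin (k + 1) → List (Bool × ℕ∞)} {x f y : BW} (hx : x ∈ Zcl (T 0))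
    (hf : f.Sublist (flangeWord (B 0))) (hne : f ≠ flangeWord (B 0))
    (hy : y ∈ Zcl (secCl (fun i => T i.succ) (fun i => B i.succ))) :
    x ++ f ++ y ∈ secBad T B := by
  refine ⟨T 0, 0, _, secCl_succ T B, ?_, x, hx, f, hf, hne, y, hy, rfl⟩
  intro h
  obtain rfl : k = 0 := by simpa using h.symm
  rfl

lemma mem_secBad_tail {T B : Fin (k + 1) → List (Bool × ℕ∞)} (hB : ∀ i, ∀ c ∈ B i, c.2 ≠ ⊤)
    {x y : BW} (hx : x ∈ Zcl (T 0))
    (hy : y ∈ secBad (fun i => T i.succ) (fun i => B i.succ)) :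
    x ++ flangeWord (B 0) ++ y ∈ secBad T B := by
  obtain ⟨L, j, R, h, hR, x', hx', f, hf, hne, y', hy', rfl⟩ := hy
  refine ⟨T 0 ++ B 0 ++ L, j.succ, R, ?_, fun hj => hR (by simpa using hj),
    x ++ flangeWord (B 0) ++ x',
    append_mem_Zcl (append_mem_Zcl hx (flangeWord_mem_Zcl (hB 0))) hx', f, hf, hne, y', hy', ?_⟩
  · rw [secCl_succ, h]; simp
  · simp

lemma exists_secWord_eq {T B : Fin k → List (Bool × ℕ∞)} (hB : ∀ i, ∀ c ∈ B i, c.2 ≠ ⊤) {a : BW}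
    {ℓ : Fin k → BW} (hℓ : ∀ i, ℓ i ∈ Zcl (T i)) (ha : a.Sublist (secWord B ℓ))
    (hJ : a ∉ secBad T B) : ∃ x : Fin k → BW, (∀ i, (x i).Sublist (ℓ i)) ∧ a = secWord B x := by
  induction k generalizing a with
  | zero => exact ⟨ℓ, fun i => List.Sublist.refl _, by simpa [secWord] using ha⟩
  | succ k ih =>
    rw [secWord_succ] at ha
    obtain ⟨a', y, rfl, ha', hy⟩ := List.sublist_append_iff.1 ha
    obtain ⟨x, f, rfl, hx, hf⟩ := List.sublist_append_iff.1 ha'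
    have hxZ := isDown_Zcl _ _ _ hx (hℓ 0)
    have hyZ := isDown_Zcl _ _ _ hy
      (secWord_mem_Zcl (fun i => hB i.succ) fun i => hℓ i.succ)
    have hfe : f = flangeWord (B 0) := by
      by_contra hne
      exact hJ (mem_secBad_head hxZ hf hne hyZ)
    subst hfe
    obtain ⟨x', hx', rfl⟩ := ih (fun i => hB i.succ) (fun i => hℓ i.succ) hy
      fun h => hJ (mem_secBad_tail hB hxZ h)
    refine ⟨Fin.cons x x', fun i => Fin.cases hx hx' i, ?_⟩
    rw [secWord_succ]
    rfl

lemma exists_sublist_secWord {T B : Fin k → List (Bool × ℕ∞)} (hB : ∀ i, ∀ c ∈ B i, c.2 ≠ ⊤)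
    {a : BW} (ha : a ∈ Zcl (secCl T B)) :
    ∃ ℓ : Fin k → BW, (∀ i, ℓ i ∈ Zcl (T i)) ∧ a.Sublist (secWord B ℓ) := by
  induction k generalizing a with
  | zero => exact ⟨fun _ => [], fun i => i.elim0, by simpa [secWord] using mem_Zcl_nil.1 ha⟩
  | succ k ih =>
    rw [secCl_succ] at ha
    obtain ⟨a', ha', y, hy, rfl⟩ := exists_of_mem_Zcl_append ha
    obtain ⟨x, hx, f, hf, rfl⟩ := exists_of_mem_Zcl_append ha'
    obtain ⟨ℓ, hℓ, hs⟩ := ih (fun i => hB i.succ) hy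
    refine ⟨Fin.cons x ℓ, fun i => Fin.cases hx hℓ i, ?_⟩
    rw [secWord_succ]
    exact ((List.Sublist.refl x).append ((mem_Zcl_of_ne_top (hB 0)).1 hf)).append hs

lemma secWord_inj {T B : Fin k → List (Bool × ℕ∞)} (hB : ∀ i, ∀ c ∈ B i, c.2 ≠ ⊤)
    (hB0 : ∀ i, ∀ c ∈ B i, c.2 ≠ 0) (hne : ∀ i : Fin k, (i : ℕ) + 1 ≠ k → B i ≠ [])
    {ℓ ℓ' : Fin k → BW} (hℓ : ∀ i, ℓ i ∈ Zcl (T i)) (hℓ' : ∀ i, ℓ' i ∈ Zcl (T i))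
    (h : secWord B ℓ = secWord B ℓ') (hJ : secWord B ℓ ∉ secBad T B) : ℓ = ℓ' := by
  induction k with
  | zero => exact Subsingleton.elim _ _
  | succ k ih =>
    have key : ∀ {ℓ ℓ' : Fin (k + 1) → BW}, (∀ i, ℓ i ∈ Zcl (T i)) → (∀ i, ℓ' i ∈ Zcl (T i)) →
        secWord B ℓ = secWord B ℓ' → secWord B ℓ ∉ secBad T B → ∀ z, ℓ' 0 = ℓ 0 ++ z → z = [] := by
      intro ℓ ℓ' hℓ hℓ' h hJ z hz
      rw [secWord_succ, secWord_succ, hz] at h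
      cases z with
      | nil => rfl
      | cons s z =>
        exfalso
        by_cases hk : k = 0
        · subst hk
          have := congrArg List.length h
          simp [secWord] at this
          omega
        · cases hB00 : B 0 with
          | nil => exact hne 0 (by simpa [eq_comm] using hk) hB00
          | cons c B' =>
            have hc := one_le_toNat (hB0 0 c (by simp [hB00])) (hB 0 c (by simp [hB00]))
            obtain ⟨m, hm⟩ := Nat.exists_eq_add_of_le' hc
            have hf : flangeWord (B 0) =
                c.1 :: (List.replicate m c.1 ++ flangeWord B') := by
              simp [hB00, flangeWord, hm, List.replicate_succ]
            have hs : c.1 = s := by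
              rw [hf] at h
              simp only [List.append_assoc, List.cons_append, List.append_cancel_left_eq,
                List.cons.injEq] at h
              exact h.1
            apply hJ
            rw [secWord_succ, hf]
            have : ℓ 0 ++ c.1 :: (List.replicate m c.1 ++ flangeWord B') ++
                secWord (fun i => B i.succ) (fun i => ℓ i.succ) =
                (ℓ 0 ++ [s]) ++ (List.replicate m c.1 ++ flangeWord B') ++
                secWord (fun i => B i.succ) (fun i => ℓ i.succ) := by
              simp [hs]
            rw [this]
            refine mem_secBad_head (isDown_Zcl _ _ _ ?_ (hℓ' 0)) ?_ ?_
              (secWord_mem_Zcl (fun i => hB i.succ) fun i => hℓ i.succ)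
            · rw [hz]
              exact (List.Sublist.refl _).append (by simp)
            · rw [hf]; exact List.sublist_cons_self _ _
            · rw [hf]
              intro h
              simpa using congrArg List.length h
    have h0 : ℓ 0 = ℓ' 0 := by
      have h1 := h
      rw [secWord_succ, secWord_succ, List.append_assoc, List.append_assoc] at h1
      rcases List.append_eq_append_iff.1 h1 with ⟨z, hz, -⟩ | ⟨z, hz, -⟩
      · rw [hz, key hℓ hℓ' h hJ z hz, List.append_nil]
      · rw [hz, key hℓ' hℓ h.symm (h ▸ hJ) z hz, List.append_nil]
    have hs : (fun i : Fin k => ℓ i.succ) = fun i => ℓ' i.succ := by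
      refine ih (T := fun i => T i.succ) (B := fun i => B i.succ) (fun i => hB i.succ)
        (fun i => hB0 i.succ) (fun i hi => hne i.succ (by simpa using hi)) (fun i => hℓ i.succ)
        (fun i => hℓ' i.succ) ?_ ?_
      · rw [secWord_succ, secWord_succ, h0] at h
        exact List.append_cancel_left h
      · intro hbad
        rw [secWord_succ] at hJ
        exact hJ (mem_secBad_tail hB (hℓ 0) hbad)
    funext i
    exact Fin.cases h0 (fun i => congrFun hs i) i

end

namespace SectionData

variable {t : Template} (D : SectionData t)

/-- The cluster lists of the sections. -/
def sec (i : Fin D.k) : List (Bool × ℕ∞) := (D.T i).clusters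

/-- The flange pieces following the sections. -/
def fl (i : Fin D.k) : List (Bool × ℕ∞) := D.A i.succ

lemma clusters_eq : t.clusters = D.A 0 ++ secCl D.sec D.fl := D.concat

lemma assemble_eq (ℓ : Fin D.k → BW) :
    assemble D ℓ = flangeWord (D.A 0) ++ secWord D.fl ℓ := rfl

lemma fl_ne_top : ∀ i, ∀ c ∈ D.fl i, c.2 ≠ ⊤ := fun i => D.finA i.succ

lemma fl_ne_zero : ∀ i, ∀ c ∈ D.fl i, c.2 ≠ 0 := by
  intro i c hc
  refine t.pos c ?_
  rw [D.clusters_eq]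
  refine List.mem_append_right _ (List.mem_flatten.2 ⟨_, (List.mem_ofFn' _ _).2 ⟨i, rfl⟩, ?_⟩)
  exact List.mem_append_right _ hc

lemma fl_ne_nil (i : Fin D.k) (h : (i : ℕ) + 1 ≠ D.k) : D.fl i ≠ [] :=
  D.interior_ne i.succ (by simp) (by simpa using h)

lemma k_ne_zero : D.k ≠ 0 := by
  intro hk
  obtain ⟨c, hc, hct⟩ := t.hasInf
  rw [D.clusters_eq] at hc
  rcases List.mem_append.1 hc with hc | hc
  · exact D.finA 0 c hc hct
  · obtain ⟨l, hl, -⟩ := List.mem_flatten.1 hc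
    obtain ⟨i, -⟩ := (List.mem_ofFn' _ _).1 hl
    exact absurd i.2 (by omega)

lemma isFlangePos {L R : List (Bool × ℕ∞)} {j : Fin (D.k + 1)}
    (h : t.clusters = L ++ D.A j ++ R) (hL : (j : ℕ) = 0 → L = []) (hR : (j : ℕ) = D.k → R = [])
    {r : ℕ} (hr : r < (D.A j).length) : IsFlangePos t (L.length + r) := by
  have hget : ∀ r' < (D.A j).length, t.clusters.getD (L.length + r') (true, 1) =
      (D.A j).getD r' (true, 1) := by
    intro r' hr'
    rw [List.getD_eq_getElem?_getD, List.getD_eq_getElem?_getD, h, List.append_assoc,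
      List.getElem?_append_right (by omega), List.getElem?_append_left (by omega)]
    congr 2
    omega
  have hfin : ∀ r' < (D.A j).length, (t.clusters.getD (L.length + r') (true, 1)).2 ≠ ⊤ := by
    intro r' hr'
    rw [hget r' hr', List.getD_eq_getElem _ _ hr']
    exact D.finA j _ (List.getElem_mem hr')
  refine ⟨by rw [h]; simp; omega, hfin r hr, ?_⟩
  rintro ⟨h1, h2, h3, h4, h5⟩
  have hr0 : r = 0 := by
    by_contra hr0
    exact hfin (r - 1) (by omega) (by rwa [← Nat.add_sub_assoc (by omega)])
  subst hr0
  have hlen : (D.A j).length = 1 := by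
    by_contra hlen
    exact hfin 1 (by omega) (by simpa using h5)
  have hj0 : (j : ℕ) ≠ 0 := fun hj => by simp [hL hj] at h1
  have hjk : (j : ℕ) ≠ D.k := fun hj => by
    rw [h, hR hj] at h2
    simp [hlen] at h2
  obtain ⟨⟨s, m⟩, hc⟩ := List.length_eq_one_iff.1 hlen
  refine D.interior_not_sep j hj0 hjk s ?_
  rw [hget 0 hr, hc] at h3
  rw [hc]
  simpa using h3

lemma mem_Jt {L R : List (Bool × ℕ∞)} {j : Fin (D.k + 1)}
    (h : t.clusters = L ++ D.A j ++ R) (hL : (j : ℕ) = 0 → L = []) (hR : (j : ℕ) = D.k → R = [])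
    {x f y : BW} (hx : x ∈ Zcl L) (hf : f.Sublist (flangeWord (D.A j)))
    (hne : f ≠ flangeWord (D.A j)) (hy : y ∈ Zcl R) : x ++ f ++ y ∈ Jt t := by
  obtain ⟨r, hr, hfr⟩ := exists_mem_Zcl_decAt (D.finA j) hf hne
  refine ⟨L.length + r, D.isFlangePos h hL hR hr, ?_⟩
  rw [h, decAt_append_append _ _ _ hr]
  exact append_mem_Zcl (append_mem_Zcl hx hfr) hy

lemma head_mem_Jt {f y : BW} (hf : f.Sublist (flangeWord (D.A 0)))
    (hne : f ≠ flangeWord (D.A 0)) (hy : y ∈ Zcl (secCl D.sec D.fl)) : f ++ y ∈ Jt t :=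
  D.mem_Jt (L := []) D.clusters_eq (fun _ => rfl) (fun h => absurd h.symm D.k_ne_zero)
    (mem_Zcl_nil.2 rfl) hf hne hy

lemma append_mem_Jt {b : BW} (hb : b ∈ secBad D.sec D.fl) :
    flangeWord (D.A 0) ++ b ∈ Jt t := by
  obtain ⟨L, j, R, h, hR, x, hx, f, hf, hne, y, hy, rfl⟩ := hb
  have := D.mem_Jt (L := D.A 0 ++ L) (j := j.succ) (R := R)
    (by rw [D.clusters_eq, h]; simp [fl]) (by simp) (fun h => hR (by simpa using h))
    (append_mem_Zcl (flangeWord_mem_Zcl (D.finA 0)) hx) hf hne hy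
  simpa using this

lemma exists_assemble_eq {a : BW} {ℓ : Fin D.k → BW} (hℓ : ∀ i, ℓ i ∈ Zt (D.T i))
    (ha : a.Sublist (assemble D ℓ)) (hJ : a ∉ Jt t) :
    ∃ x : Fin D.k → BW, (∀ i, (x i).Sublist (ℓ i)) ∧ a = assemble D x := by
  rw [D.assemble_eq] at ha
  obtain ⟨f, y, rfl, hf, hy⟩ := List.sublist_append_iff.1 ha
  have hfe : f = flangeWord (D.A 0) := by
    by_contra hne
    exact hJ (D.head_mem_Jt hf hne (isDown_Zcl _ _ _ hy (secWord_mem_Zcl D.fl_ne_top hℓ)))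
  subst hfe
  obtain ⟨x, hx, rfl⟩ := exists_secWord_eq (T := D.sec) D.fl_ne_top hℓ hy
    fun h => hJ (D.append_mem_Jt h)
  exact ⟨x, hx, rfl⟩

lemma exists_decompOf {a : BW} (ha : a ∈ Zt t) (hJ : a ∉ Jt t) : ∃ ℓ, decompOf D a ℓ := by
  rw [Zt, D.clusters_eq] at ha
  obtain ⟨f, hf, y, hy, rfl⟩ := exists_of_mem_Zcl_append ha
  obtain ⟨ℓ, hℓ, hs⟩ := exists_sublist_secWord D.fl_ne_top hy
  obtain ⟨x, hx, h⟩ := D.exists_assemble_eq hℓ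
    (((mem_Zcl_of_ne_top (D.finA 0)).1 hf).append hs) hJ
  exact ⟨x, fun i => isDown_Zcl _ _ _ (hx i) (hℓ i), h⟩

lemma decompOf_unique {a : BW} {ℓ ℓ' : Fin D.k → BW} (h : decompOf D a ℓ) (h' : decompOf D a ℓ')
    (hJ : a ∉ Jt t) : ℓ = ℓ' := by
  obtain ⟨h1, rfl⟩ := h
  obtain ⟨h2, h3⟩ := h'
  refine secWord_inj (T := D.sec) D.fl_ne_top D.fl_ne_zero D.fl_ne_nil h1 h2
    (List.append_cancel_left h3) fun h => hJ (D.append_mem_Jt h)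

lemma assemble_mem_Zt {ℓ : Fin D.k → BW} (hℓ : ∀ i, ℓ i ∈ Zt (D.T i)) : assemble D ℓ ∈ Zt t := by
  rw [Zt, D.clusters_eq]
  exact append_mem_Zcl (flangeWord_mem_Zcl (D.finA 0)) (secWord_mem_Zcl D.fl_ne_top hℓ)

lemma assemble_mono {ℓ ℓ' : Fin D.k → BW} (h : ∀ i, (ℓ i).Sublist (ℓ' i)) :
    (assemble D ℓ).Sublist (assemble D ℓ') :=
  (List.Sublist.refl _).append (secWord_mono _ h)

lemma length_assemble (ℓ : Fin D.k → BW) : (assemble D ℓ).length =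
    ∑ i, (ℓ i).length + ((flangeWord (D.A 0)).length + ∑ i, (flangeWord (D.fl i)).length) := by
  rw [D.assemble_eq, List.length_append, length_secWord]
  omega

end SectionData

lemma isDown_Jt (t : Template) : IsDown (Jt t) := by
  rintro a b hab ⟨p, hp, hb⟩
  exact ⟨p, hp, isDown_Zcl _ _ _ hab hb⟩

lemma phiTW_eq {t : Template} {D : SectionData t} {w : List ℝ} {a : BW} (ha : a ∈ Zt t)
    (hJ : a ∉ Jt t) {ℓ : Fin D.k → BW} (hℓ : decompOf D a ℓ) :
    phiTW t D w a = ENNReal.ofReal (∏ i, Fword (vD D w i) (ℓ i)) := by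
  have h : ∃ ℓ, decompOf D a ℓ := ⟨ℓ, hℓ⟩
  rw [phiTW, if_neg (not_not.2 ha), if_neg hJ, dif_pos h,
    D.decompOf_unique h.choose_spec hℓ hJ]

/-- The sum of the entries of `m` preceding the `i`-th one. -/
def offs {k : ℕ} (m : Fin k → ℕ) (i : Fin k) : ℕ := ∑ i' ∈ Finset.univ.filter (· < i), m i'

section

variable {k : ℕ}

@[simp] lemma offs_zero (m : Fin (k + 1) → ℕ) : offs m 0 = 0 := by simp [offs]

@[simp] lemma offs_succ (m : Fin (k + 1) → ℕ) (i : Fin k) :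
    offs m i.succ = m 0 + offs (fun i => m i.succ) i := by
  simp [offs, Finset.sum_filter, Fin.sum_univ_succ]

lemma offs_add_lt {m : Fin k → ℕ} {i : Fin k} {r : ℕ} (hr : r < m i) :
    offs m i + r < ∑ i, m i := by
  induction k with
  | zero => exact i.elim0
  | succ k ih =>
    rw [Fin.sum_univ_succ]
    cases i using Fin.cases with
    | zero => rw [offs_zero]; omega
    | succ i =>
      have := ih (m := fun i => m i.succ) (i := i) hr
      rw [offs_succ]
      omega

@[to_additive]
lemma prod_range_sum {M : Type*} [CommMonoid M] (m : Fin k → ℕ) (f : ℕ → M) :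
    ∏ j ∈ Finset.range (∑ i, m i), f j = ∏ i, ∏ r ∈ Finset.range (m i), f (offs m i + r) := by
  induction k generalizing f with
  | zero => simp
  | succ k ih =>
    rw [Fin.sum_univ_succ, Finset.prod_range_add, ih, Fin.prod_univ_succ]
    simp [Nat.add_assoc]

lemma exists_glue {α : Type*} [Inhabited α] (m : Fin k → ℕ) (g : Fin k → ℕ → α) :
    ∃ n : ℕ → α, ∀ i, ∀ r < m i, n (offs m i + r) = g i r := by
  induction k with
  | zero => exact ⟨fun _ => default, fun i => i.elim0⟩
  | succ k ih =>
    obtain ⟨n, hn⟩ := ih (fun i => m i.succ) fun i => g i.succ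
    refine ⟨fun j => if j < m 0 then g 0 j else n (j - m 0), fun i r hr => ?_⟩
    cases i using Fin.cases with
    | zero => simp [hr]
    | succ i =>
      have := hn i r hr
      rw [offs_succ]
      simp only
      rw [if_neg (by omega), ← this]
      congr 1
      omega

lemma numTop_secCl {T B : Fin k → List (Bool × ℕ∞)} (hB : ∀ i, ∀ c ∈ B i, c.2 ≠ ⊤) :
    numTop (secCl T B) = ∑ i, numTop (T i) := by
  induction k with
  | zero => rfl
  | succ k ih =>
    rw [secCl_succ, numTop_append, numTop_append, numTop_eq_zero (hB 0),
      ih fun i => hB i.succ, Fin.sum_univ_succ, Nat.add_zero]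

lemma infWord_secCl {T B : Fin k → List (Bool × ℕ∞)} (hB : ∀ i, ∀ c ∈ B i, c.2 ≠ ⊤)
    (n : ℕ → ℕ) : infWord (secCl T B) n =
      secWord B fun i => infWord (T i) fun r => n (offs (fun i => numTop (T i)) i + r) := by
  induction k generalizing n with
  | zero => simp [secCl, secWord, infWord_nil]
  | succ k ih =>
    rw [secCl_succ, infWord_append, infWord_append, infWord_of_ne_top (hB 0),
      ih fun i => hB i.succ, secWord_succ, numTop_append, numTop_eq_zero (hB 0)]
    simp only [offs_zero, offs_succ, Nat.zero_add, Nat.add_zero, Nat.add_assoc]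

end

namespace SectionData

variable {t : Template} (D : SectionData t)

/-- The numbers of infinite clusters of the sections. -/
def num (i : Fin D.k) : ℕ := numTop (D.T i).clusters

lemma secOffset_eq (i : Fin D.k) : secOffset D i = offs D.num i := rfl

lemma numTop_eq : numTop t.clusters = ∑ i, D.num i := by
  rw [D.clusters_eq, numTop_append, numTop_eq_zero (D.finA 0), numTop_secCl D.fl_ne_top,
    Nat.zero_add]
  rfl

lemma infWord_eq (n : ℕ → ℕ) : infWord t.clusters n =
    assemble D fun i => infWord (D.T i).clusters fun r => n (offs D.num i + r) := by
  rw [D.clusters_eq, infWord_append, infWord_of_ne_top (D.finA 0), numTop_eq_zero (D.finA 0),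
    infWord_secCl D.fl_ne_top, D.assemble_eq]
  simp only [Nat.zero_add]
  rfl

lemma decompOf_infWord (n : ℕ → ℕ) : decompOf D (infWord t.clusters n)
    fun i => infWord (D.T i).clusters fun r => n (offs D.num i + r) :=
  ⟨fun _ => infWord_mem_Zcl _ _, D.infWord_eq n⟩

lemma vD_eq (w : ℕ → ℝ) (i : Fin D.k) :
    vD D ((List.range (numTop t.clusters)).map w) i =
      weighted (infSigns (D.T i).clusters) fun r => w (offs D.num i + r) := by
  rw [vD, secOffset_eq]
  refine zip_eq_weighted fun r hr => ?_
  have := offs_add_lt (m := D.num) (i := i) hr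
  rw [List.getElem?_drop, List.getElem?_map, List.getElem?_range (by rwa [D.numTop_eq])]
  rfl

end SectionData

/-- Upper neighbours outside the coideal do not contribute. -/
lemma sum_upFinset_Zcl_fRec {cs : List (Bool × ℕ∞)} (halt : Alt (cs.map Prod.fst))
    (hpos : ∀ c ∈ cs, c.2 ≠ 0) (w : ℕ → ℝ) (a : BW) :
    ∑ b ∈ upFinset (Zcl cs) a, fRec (weighted (infSigns cs) w) b =
      (∑ j ∈ Finset.range (numTop cs), w j) * fRec (weighted (infSigns cs) w) a := by
  have h := sum_fRec (weighted (infSigns cs) w) a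
  rw [sum_weighted] at h
  refine Eq.trans (Finset.sum_subset ?_ ?_) h
  · intro b hb
    rw [mem_upFinset] at hb ⊢
    exact ⟨Set.mem_univ _, hb.2⟩
  · intro b hb hb'
    by_contra hne
    exact hb' (mem_upFinset.2
      ⟨mem_Zcl_of_fRec_ne_zero halt hpos hne, (mem_upFinset.1 hb).2⟩)

namespace SectionData

variable {t : Template} (D : SectionData t)

/-- The factor of `φ_{t,w}` coming from the `i`-th section. -/
noncomputable def secF (w : ℕ → ℝ) (i : Fin D.k) (a : BW) : ℝ :=
  fRec (weighted (infSigns (D.T i).clusters) fun r => w (offs D.num i + r)) a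

/-- The product of the section factors. -/
noncomputable def val (w : ℕ → ℝ) (ℓ : Fin D.k → BW) : ℝ := ∏ i, D.secF w i (ℓ i)

/-- The function `φ_{t,w}` for a weight sequence. -/
noncomputable def phi (w : ℕ → ℝ) : BW → ℝ≥0∞ :=
  phiTW t D ((List.range (numTop t.clusters)).map w)

lemma phi_eq {w : ℕ → ℝ} {a : BW} (ha : a ∈ Zt t) (hJ : a ∉ Jt t) {ℓ : Fin D.k → BW}
    (hℓ : decompOf D a ℓ) : D.phi w a = ENNReal.ofReal (D.val w ℓ) := by
  rw [phi, phiTW_eq ha hJ hℓ, val]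
  simp only [vD_eq, Fword_eq_fRec, secF]

lemma secF_nonneg {w : ℕ → ℝ} (hw : ∀ j, 0 < w j) (i : Fin D.k) (a : BW) : 0 ≤ D.secF w i a :=
  fRec_nonneg (weighted_nonneg fun _ => hw _) a

lemma val_nonneg {w : ℕ → ℝ} (hw : ∀ j, 0 < w j) (ℓ : Fin D.k → BW) : 0 ≤ D.val w ℓ :=
  Finset.prod_nonneg fun i _ => D.secF_nonneg hw i _

lemma val_update (w : ℕ → ℝ) (ℓ : Fin D.k → BW) (i : Fin D.k) (b : BW) :
    D.val w (Function.update ℓ i b) =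
      D.secF w i b * ∏ j ∈ Finset.univ.erase i, D.secF w j (ℓ j) := by
  rw [val, ← Finset.mul_prod_erase _ _ (Finset.mem_univ i), Function.update_self]
  congr 1
  refine Finset.prod_congr rfl fun j hj => ?_
  rw [Function.update_of_ne (Finset.ne_of_mem_erase hj)]

lemma exists_phi_infWord {w : ℕ → ℝ} (hw : ∀ j, 0 < w j) :
    ∃ κ : ℝ, 0 < κ ∧ ∀ n : ℕ → ℕ, (∀ j, 1 ≤ n j) → infWord t.clusters n ∉ Jt t →
      D.phi w (infWord t.clusters n) =
        ENNReal.ofReal (κ * ∏ j ∈ Finset.range (numTop t.clusters), w j ^ n j) := by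
  choose κ hκ H using fun i =>
    (D.secFin i).finT.exists_fRec_infWord (w := fun r => w (offs D.num i + r)) fun r => hw _
  refine ⟨∏ i, κ i, Finset.prod_pos fun i _ => hκ i, fun n hn hJ => ?_⟩
  rw [D.phi_eq (infWord_mem_Zcl _ _) hJ (D.decompOf_infWord n), val, D.numTop_eq,
    prod_range_sum, ← Finset.prod_mul_distrib]
  congr 1
  exact Finset.prod_congr rfl fun i _ => H i _ fun r _ => hn _

lemma sum_upFinset {a : BW} (hJ : a ∉ Jt t) {ℓ : Fin D.k → BW}
    (hℓ : decompOf D a ℓ) (f : BW → ℝ≥0∞) :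
    ∑ b ∈ upFinset (Zt t) a, f b =
      ∑ i, ∑ b ∈ upFinset (Zt (D.T i)) (ℓ i), f (assemble D (Function.update ℓ i b)) := by
  rw [Finset.sum_sigma']
  symm
  have hcov : ∀ x : (i : Fin D.k) × BW, x.2 ∈ upFinset (Zt (D.T x.1)) (ℓ x.1) →
      (∀ j, Function.update ℓ x.1 x.2 j ∈ Zt (D.T j)) ∧
      a.Sublist (assemble D (Function.update ℓ x.1 x.2)) := by
    rintro ⟨i, b⟩ hx
    rw [mem_upFinset] at hx
    refine ⟨fun j => ?_, ?_⟩
    · by_cases h : j = i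
      · subst h; simpa using hx.1
      · simpa [h] using hℓ.1 j
    · rw [hℓ.2]
      refine D.assemble_mono fun j => ?_
      by_cases h : j = i
      · subst h; simpa using hx.2.1
      · simp [h]
  refine Finset.sum_bij (fun x _ => assemble D (Function.update ℓ x.1 x.2)) ?_ ?_ ?_ ?_
  · rintro x hx
    obtain ⟨h1, h2⟩ := hcov x (Finset.mem_sigma.1 hx).2
    have hx2 := (mem_upFinset.1 (Finset.mem_sigma.1 hx).2).2.2
    refine mem_upFinset.2 ⟨D.assemble_mem_Zt h1, h2, ?_⟩
    rw [hℓ.2, length_assemble, length_assemble, ← Finset.add_sum_erase _ _ (Finset.mem_univ x.1),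
      ← Finset.add_sum_erase _ (fun i => (ℓ i).length) (Finset.mem_univ x.1),
      Finset.sum_congr rfl fun j hj => by rw [Function.update_of_ne (Finset.ne_of_mem_erase hj)],
      Function.update_self, hx2]
    omega
  · rintro ⟨i, b⟩ hx ⟨i', b'⟩ hx' heq
    obtain ⟨h1, h2⟩ := hcov ⟨i, b⟩ (Finset.mem_sigma.1 hx).2
    obtain ⟨h1', -⟩ := hcov ⟨i', b'⟩ (Finset.mem_sigma.1 hx').2
    have hu := D.decompOf_unique ⟨h1, rfl⟩ ⟨h1', heq⟩ fun h => hJ (isDown_Jt t _ _ h2 h)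
    have hb := (mem_upFinset.1 (Finset.mem_sigma.1 hx).2).2.2
    have hi : i = i' := by
      by_contra hne
      have := congrArg List.length (congrFun hu i)
      simp only [Function.update_self, Function.update_of_ne hne] at this
      simp only at hb
      omega
    subst hi
    have := congrFun hu i
    simp only [Function.update_self] at this
    rw [this]
  · intro b hb
    obtain ⟨hbS, hab, hlen⟩ := mem_upFinset.1 hb
    have hbJ : b ∉ Jt t := fun h => hJ (isDown_Jt t _ _ hab h)
    obtain ⟨ℓ', hℓ', rfl⟩ := D.exists_decompOf hbS hbJ
    obtain ⟨x, hx, hax⟩ := D.exists_assemble_eq hℓ' hab hJ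
    obtain rfl := D.decompOf_unique hℓ ⟨fun i => isDown_Zcl _ _ _ (hx i) (hℓ' i), hax⟩ hJ
    rw [hax, length_assemble, length_assemble] at hlen
    have hle : ∀ i, (ℓ i).length ≤ (ℓ' i).length := fun i => (hx i).length_le
    obtain ⟨i, hi⟩ : ∃ i, (ℓ i).length < (ℓ' i).length := by
      by_contra hcon
      push Not at hcon
      have := Finset.sum_le_sum (s := Finset.univ) fun i _ => hcon i
      omega
    have h1 := Finset.add_sum_erase Finset.univ (fun i => (ℓ i).length) (Finset.mem_univ i)
    have h2 := Finset.add_sum_erase Finset.univ (fun i => (ℓ' i).length) (Finset.mem_univ i)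
    have hoth : ∀ j ≠ i, ℓ j = ℓ' j := by
      intro j hj
      refine (hx j).eq_of_length ?_
      by_contra hne
      have := Finset.sum_lt_sum (s := Finset.univ.erase i) (fun j _ => hle j)
        ⟨j, Finset.mem_erase.2 ⟨hj, Finset.mem_univ _⟩, lt_of_le_of_ne (hle j) hne⟩
      omega
    have h3 : ∑ j ∈ Finset.univ.erase i, (ℓ j).length =
        ∑ j ∈ Finset.univ.erase i, (ℓ' j).length :=
      Finset.sum_congr rfl fun j hj => by rw [hoth j (Finset.ne_of_mem_erase hj)]
    refine ⟨⟨i, ℓ' i⟩, Finset.mem_sigma.2 ⟨Finset.mem_univ _, mem_upFinset.2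
      ⟨hℓ' i, hx i, ?_⟩⟩, ?_⟩
    · simp only at h1 h2 ⊢
      omega
    · congr 1
      funext j
      by_cases hj : j = i
      · subst hj; simp
      · simp [hj, hoth j hj]
  · intro _ _; rfl

lemma phi_harmonic {w : ℕ → ℝ} (hw : ∀ j, 0 < w j)
    (hsum : ∑ j ∈ Finset.range (numTop t.clusters), w j = 1) {a : BW} (ha : a ∈ Zt t)
    (hJ : a ∉ Jt t) : D.phi w a = ∑ b ∈ upFinset (Zt t) a, D.phi w b := by
  obtain ⟨ℓ, hℓ⟩ := D.exists_decompOf ha hJ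
  rw [D.sum_upFinset hJ hℓ]
  have h1 : ∀ i, ∀ b ∈ upFinset (Zt (D.T i)) (ℓ i),
      D.phi w (assemble D (Function.update ℓ i b)) =
        ENNReal.ofReal (D.val w (Function.update ℓ i b)) := by
    intro i b hb
    rw [mem_upFinset] at hb
    have hm : ∀ j, Function.update ℓ i b j ∈ Zt (D.T j) := by
      intro j
      by_cases h : j = i
      · subst h; simpa using hb.1
      · simpa [h] using hℓ.1 j
    refine D.phi_eq (D.assemble_mem_Zt hm) (fun h => hJ (isDown_Jt t _ _ ?_ h)) ⟨hm, rfl⟩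
    rw [hℓ.2]
    refine D.assemble_mono fun j => ?_
    by_cases h : j = i
    · subst h; simpa using hb.2.1
    · simp [h]
  rw [D.phi_eq ha hJ hℓ, Finset.sum_congr rfl fun i _ => Finset.sum_congr rfl (h1 i),
    Finset.sum_congr rfl fun i _ =>
      (ENNReal.ofReal_sum_of_nonneg fun b _ => D.val_nonneg hw _).symm,
    ← ENNReal.ofReal_sum_of_nonneg fun i _ => Finset.sum_nonneg fun b _ => D.val_nonneg hw _]
  congr 1
  have h2 : ∀ i, ∑ b ∈ upFinset (Zt (D.T i)) (ℓ i), D.val w (Function.update ℓ i b) =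
      (∑ r ∈ Finset.range (D.num i), w (offs D.num i + r)) * D.val w ℓ := by
    intro i
    simp only [val_update]
    rw [← Finset.sum_mul]
    have := sum_upFinset_Zcl_fRec (D.T i).alt (D.T i).pos (fun r => w (offs D.num i + r)) (ℓ i)
    rw [val, ← Finset.mul_prod_erase _ _ (Finset.mem_univ i), ← mul_assoc]
    congr 1
  rw [Finset.sum_congr rfl fun i _ => h2 i, ← Finset.sum_mul, ← sum_range_sum, ← D.numTop_eq,
    hsum, one_mul]

end SectionData

/-- Extend a tuple by zeros. -/
def extZero {m : ℕ} (c : Fin m → ℕ) (j : ℕ) : ℕ := if h : j < m then c ⟨j, h⟩ else 0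

@[simp] lemma extZero_val {m : ℕ} (c : Fin m → ℕ) (i : Fin m) : extZero c i = c i := by
  simp [extZero]

lemma length_infWord (cs : List (Bool × ℕ∞)) (n : ℕ → ℕ) :
    (infWord cs n).length =
      ∑ j ∈ Finset.range (numTop cs), n j + (infWord cs fun _ => 0).length := by
  induction cs generalizing n with
  | nil => simp [infWord_nil, numTop, infSigns]
  | cons c cs ih =>
    by_cases hc : c.2 = ⊤
    · rw [infWord_cons_top hc, infWord_cons_top hc, numTop_cons_top hc, Finset.sum_range_succ',
        List.length_append, ih, List.length_append, ih (shift _)]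
      simp
      omega
    · rw [infWord_cons_fin hc, infWord_cons_fin hc, numTop_cons_fin hc, List.length_append, ih,
        List.length_append, List.length_replicate]
      omega

lemma fRec_weighted_eq_sum_filter (ss : List Bool) (w : ℕ → ℝ) (a : BW) :
    fRec (weighted ss w) a =
      ∑ c ∈ (Finset.Nat.antidiagonalTuple (weighted ss w).length (a.length + 1)).filter
        (Fits (weighted ss w) a), ∏ j ∈ Finset.range ss.length, w j ^ extZero c j := by
  rw [fRec_weighted_eq_sum, Finset.sum_filter]
  refine Finset.sum_congr rfl fun c _ => ?_
  rw [← prod_weighted]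
  simp only [extZero_val]

namespace SectionData

variable {t : Template} (D : SectionData t)

lemma exists_mul_phi_le {w : ℕ → ℝ} (hw : ∀ j, 0 < w j) {n₀ : ℕ} (h0 : 1 ≤ n₀)
    (hU : ∀ n : ℕ → ℕ, (∀ j, n₀ ≤ n j) → infWord t.clusters n ∉ Jt t) :
    ∃ ε : ℝ, 0 < ε ∧ ∃ L : ℕ, ∀ a ∈ Zt t, a ∉ Jt t →
      ENNReal.ofReal ε * D.phi w a ≤
        upIter (Zt t) L ((bigWords t.clusters n₀).indicator (D.phi w)) a := by
  obtain ⟨κ, hκ, H⟩ := D.exists_phi_infWord hw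
  have hP : 0 < ∏ j ∈ Finset.range (numTop t.clusters), w j ^ n₀ :=
    Finset.prod_pos fun j _ => pow_pos (hw j) _
  refine ⟨κ * ∏ j ∈ Finset.range (numTop t.clusters), w j ^ n₀, mul_pos hκ hP,
    ∑ i, (1 + D.num i * n₀ + (infWord (D.T i).clusters fun _ => 0).length), fun a ha hJ => ?_⟩
  obtain ⟨ℓ, hℓ⟩ := D.exists_decompOf ha hJ
  set u : Fin D.k → List (Bool × ℝ) := fun i =>
    weighted (infSigns (D.T i).clusters) fun r => w (offs D.num i + r) with hu
  set F : ∀ i, Finset (Fin (u i).length → ℕ) := fun i =>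
    (Finset.Nat.antidiagonalTuple (u i).length ((ℓ i).length + 1)).filter (Fits (u i) (ℓ i))
    with hF
  have hG : ∀ p : (i : Fin D.k) → Fin (u i).length → ℕ, ∃ n : ℕ → ℕ, (∀ j, n₀ ≤ n j) ∧
      ∀ i, ∀ r < D.num i, n (offs D.num i + r) = extZero (p i) r + n₀ := by
    intro p
    obtain ⟨n, hn⟩ := exists_glue D.num fun i r => extZero (p i) r + n₀
    refine ⟨fun j => max (n j) n₀, fun j => le_max_right _ _, fun i r hr => ?_⟩
    simp only [hn i r hr]
    omega
  choose G hG1 hG2 using hG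
  have hlenu : ∀ i, (u i).length = D.num i := fun i => length_weighted _ _
  have hval : D.val w ℓ = ∑ p ∈ Fintype.piFinset F,
      ∏ i, ∏ r ∈ Finset.range (D.num i), w (offs D.num i + r) ^ extZero (p i) r := by
    rw [val]
    simp only [secF, fRec_weighted_eq_sum_filter]
    rw [Finset.prod_univ_sum]
    rfl
  have hphi : ∀ p, D.phi w (infWord t.clusters (G p)) =
      ENNReal.ofReal ((κ * ∏ j ∈ Finset.range (numTop t.clusters), w j ^ n₀) *
        ∏ i, ∏ r ∈ Finset.range (D.num i), w (offs D.num i + r) ^ extZero (p i) r) := by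
    intro p
    rw [H _ (fun j => h0.trans (hG1 p j)) (hU _ (hG1 p)), D.numTop_eq, prod_range_sum,
      prod_range_sum, mul_assoc, ← Finset.prod_mul_distrib]
    congr 2
    refine Finset.prod_congr rfl fun i _ => ?_
    rw [← Finset.prod_mul_distrib]
    refine Finset.prod_congr rfl fun r hr => ?_
    rw [hG2 p i r (Finset.mem_range.1 hr), pow_add, mul_comm]
  have hinj : Set.InjOn (fun p => infWord t.clusters (G p)) (Fintype.piFinset F) := by
    intro p _ p' _ hpp
    have h := infWord_inj t.alt t.pos (fun j => h0.trans (hG1 p j))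
      (fun j => h0.trans (hG1 p' j)) hpp
    funext i r
    have hr : (r : ℕ) < D.num i := (hlenu i) ▸ r.2
    have h1 := h (offs D.num i + r) (by rw [D.numTop_eq]; exact offs_add_lt hr)
    rw [hG2 p i r hr, hG2 p' i r hr, extZero_val, extZero_val] at h1
    omega
  calc ENNReal.ofReal (κ * ∏ j ∈ Finset.range (numTop t.clusters), w j ^ n₀) * D.phi w a
      = ∑ p ∈ Fintype.piFinset F, D.phi w (infWord t.clusters (G p)) := by
        rw [D.phi_eq ha hJ hℓ, hval, ← ENNReal.ofReal_mul (mul_pos hκ hP).le, Finset.mul_sum,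
          ENNReal.ofReal_sum_of_nonneg]
        · exact Finset.sum_congr rfl fun p _ => (hphi p).symm
        · intro p _
          exact mul_nonneg (mul_pos hκ hP).le (Finset.prod_nonneg fun i _ =>
            Finset.prod_nonneg fun r _ => (pow_pos (hw _) _).le)
    _ = ∑ p ∈ Fintype.piFinset F, (bigWords t.clusters n₀).indicator (D.phi w)
          (infWord t.clusters (G p)) := by
        refine Finset.sum_congr rfl fun p _ => ?_
        rw [Set.indicator_of_mem (infWord_mem_bigWords (hG1 p))]
    _ = ∑ b ∈ (Fintype.piFinset F).image fun p => infWord t.clusters (G p),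
          (bigWords t.clusters n₀).indicator (D.phi w) b := by
        rw [Finset.sum_image hinj]
    _ ≤ _ := by
        refine sum_le_upIter (isDown_Zcl _) _ _ _ _ fun b hb => ?_
        obtain ⟨p, hp, rfl⟩ := Finset.mem_image.1 hb
        refine ⟨infWord_mem_Zcl _ _, ?_, ?_⟩
        · rw [D.infWord_eq, hℓ.2]
          refine D.assemble_mono fun i => ?_
          have hpi := Finset.mem_filter.1 (Fintype.mem_piFinset.1 hp i)
          refine sublist_infWord_of_fits (w := fun r => w (offs D.num i + r)) (c := extZero (p i))
            (D.T i).alt (D.T i).pos ?_ ?_ fun j => ?_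
          · simpa using hpi.2
          · simpa using Finset.Nat.mem_antidiagonalTuple.1 hpi.1
          · by_cases hj : j < D.num i
            · rw [hG2 p i j hj]; omega
            · rw [extZero, dif_neg (by rw [hlenu]; exact hj)]
              exact h0.trans (hG1 p _)
        · rw [D.infWord_eq, hℓ.2, length_assemble, length_assemble]
          have : ∀ i, (infWord (D.T i).clusters fun r => G p (offs D.num i + r)).length =
              (ℓ i).length + (1 + D.num i * n₀ + (infWord (D.T i).clusters fun _ => 0).length) := by
            intro i
            have hpi := Finset.Nat.mem_antidiagonalTuple.1
              (Finset.mem_filter.1 (Fintype.mem_piFinset.1 hp i)).1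
            rw [length_infWord]
            have h1 : ∑ j ∈ Finset.range (D.num i), G p (offs D.num i + j) =
                ∑ j ∈ Finset.range (D.num i), extZero (p i) j + D.num i * n₀ := by
              rw [Finset.sum_congr rfl fun j hj => hG2 p i j (Finset.mem_range.1 hj),
                Finset.sum_add_distrib]
              simp
            have h2 : ∑ j ∈ Finset.range (D.num i), extZero (p i) j = (ℓ i).length + 1 := by
              rw [← hpi, ← hlenu, ← Fin.sum_univ_eq_sum_range]
              simp
            have h3 : numTop (D.T i).clusters = D.num i := rfl
            rw [h3, h1, h2]
            omega
          rw [Finset.sum_congr rfl fun i _ => this i, Finset.sum_add_distrib]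
          omega

end SectionData

lemma eq_mul_prod_of_step {cs : List (Bool × ℕ∞)} {φ : BW → ℝ≥0∞} {n₀ : ℕ} {w : ℕ → ℝ}
    (hw : ∀ j, 0 < w j)
    (hstep : ∀ n : ℕ → ℕ, (∀ j, n₀ ≤ n j) → ∀ j,
      φ (infWord cs (n + Pi.single j 1)) = ENNReal.ofReal (w j) * φ (infWord cs n))
    (hfin : φ (infWord cs fun _ => n₀) ≠ ⊤) (n : ℕ → ℕ) (hn : ∀ j, n₀ ≤ n j) :
    φ (infWord cs n) = ENNReal.ofReal ((φ (infWord cs fun _ => n₀)).toReal /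
      (∏ j ∈ Finset.range (numTop cs), w j ^ n₀) *
        ∏ j ∈ Finset.range (numTop cs), w j ^ n j) := by
  have hP : 0 < ∏ j ∈ Finset.range (numTop cs), w j ^ n₀ :=
    Finset.prod_pos fun j _ => pow_pos (hw j) _
  induction hM : ∑ j ∈ Finset.range (numTop cs), (n j - n₀) generalizing n with
  | zero =>
    have h : ∀ j < numTop cs, n j = n₀ := fun j hj => by
      have := Finset.sum_eq_zero_iff.1 hM j (Finset.mem_range.2 hj)
      have := hn j
      omega
    rw [infWord_congr (n' := fun _ => n₀) h,
      Finset.prod_congr (s₁ := Finset.range (numTop cs)) (f := fun j => w j ^ n j) (g := fun j => w j ^ n₀) rfl fun j hj => by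
        rw [h j (Finset.mem_range.1 hj)],
      div_mul_cancel₀ _ hP.ne', ENNReal.ofReal_toReal hfin]
  | succ M ih =>
    obtain ⟨i, hi, hne⟩ := Finset.exists_ne_zero_of_sum_ne_zero (hM.trans_ne (Nat.succ_ne_zero M))
    set n' : ℕ → ℕ := fun j => if j = i then n i - 1 else n j with hn'
    have hnn : n = n' + Pi.single i 1 := by
      funext j
      by_cases hj : j = i
      · subst hj; simp [hn']; omega
      · simp [hn', hj]
    have hn'0 : ∀ j, n₀ ≤ n' j := fun j => by
      have := hn j
      by_cases hj : j = i
      · subst hj; simp only [hn', if_true]; omega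
      · simpa [hn', hj] using this
    have hprod : ∏ j ∈ Finset.range (numTop cs), w j ^ n j =
        w i * ∏ j ∈ Finset.range (numTop cs), w j ^ n' j := by
      rw [← Finset.mul_prod_erase _ _ hi, ← Finset.mul_prod_erase _ (fun j => w j ^ n' j) hi,
        ← mul_assoc]
      congr 1
      · rw [hnn]; simp [pow_succ, mul_comm]
      · refine Finset.prod_congr rfl fun j hj => ?_
        simp [hn', Finset.ne_of_mem_erase hj]
    have hM' : ∑ j ∈ Finset.range (numTop cs), (n' j - n₀) = M := by
      rw [← Finset.add_sum_erase _ _ hi] at hM ⊢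
      have : ∑ j ∈ (Finset.range (numTop cs)).erase i, (n' j - n₀) =
          ∑ j ∈ (Finset.range (numTop cs)).erase i, (n j - n₀) :=
        Finset.sum_congr rfl fun j hj => by simp [hn', Finset.ne_of_mem_erase hj]
      rw [this]
      simp only [hn', if_true]
      omega
    rw [hprod]
    conv_lhs => rw [hnn]
    rw [hstep n' hn'0 i, ih n' hn'0 hM', ← ENNReal.ofReal_mul (hw i).le]
    congr 1
    ring

lemma upFinset_eq_of_up {S V : Set BW} (hVS : V ⊆ S)
    (hup : ∀ a ∈ V, ∀ b ∈ S, CoveredBy a b → b ∈ V) {a : BW} (ha : a ∈ V) :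
    upFinset V a = upFinset S a := by
  ext b
  simp only [mem_upFinset]
  exact ⟨fun h => ⟨hVS h.1, h.2⟩, fun h => ⟨hup a ha b h.1 h.2, h.2⟩⟩

lemma upIter_eq_of_up {S V : Set BW} (hVS : V ⊆ S)
    (hup : ∀ a ∈ V, ∀ b ∈ S, CoveredBy a b → b ∈ V) (g : BW → ℝ≥0∞) (N : ℕ) :
    ∀ a ∈ V, upIter V N g a = upIter S N g a := by
  induction N with
  | zero => simp
  | succ N ih =>
    intro a ha
    rw [upIter_succ, upIter_succ, ← upFinset_eq_of_up hVS hup ha]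
    exact Finset.sum_congr rfl fun b hb => ih b (mem_upFinset.1 hb).1

/-- A harmonic function a fixed fraction of which reaches `U` in a bounded number of steps is
the minimal extension of its restriction to `U`. -/
lemma HarmonicOn.eq_minExt_indicator {V U : Set BW} {Φ : BW → ℝ≥0∞} (hΦ : HarmonicOn V Φ)
    (hfin : ∀ a ∈ V, Φ a ≠ ⊤) (hU : UpperHarmonic V U (U.indicator Φ)) {e : ℝ≥0∞} (he : e ≠ 0)
    {L : ℕ} (hL : ∀ a ∈ V, e * Φ a ≤ upIter V L (U.indicator Φ) a) :
    ∀ a ∈ V, Φ a = minExt V (U.indicator Φ) a := by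
  have hm := hU.harmonicOn_minExt
  set g := U.indicator Φ with hg
  set m := minExt V g with hmdef
  set h := Uᶜ.indicator Φ with hh
  have hadd : ∀ a, g a + h a = Φ a := fun a => by
    rw [hg, hh, ← Pi.add_apply, Set.indicator_self_add_compl]
  have hstep : ∀ a ∈ V, upIter V L h a ≤ (1 - e) * Φ a := fun a ha => by
    have h1 : upIter V L g a + upIter V L h a = Φ a := by
      rw [← upIter_add, funext hadd]
      exact hΦ.upIter_eq L a ha
    have h2 : e * Φ a + upIter V L h a ≤ Φ a :=
      (add_le_add_left (hL a ha) _).trans_eq h1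
    rw [ENNReal.sub_mul fun _ _ => hfin a ha, one_mul]
    refine ENNReal.le_sub_of_add_le_left ?_ h2
    exact ne_top_of_le_ne_top (hfin a ha) (le_self_add.trans h2)
  have hP : ∀ k : ℕ, ∀ a ∈ V, Φ a ≤ m a + (1 - e) ^ k * Φ a := by
    intro k
    induction k with
    | zero => intro a _; simp
    | succ k ih =>
      have h1 : ∀ a ∈ V, Φ a ≤ m a + (1 - e) ^ k * h a := fun a ha => by
        by_cases haU : a ∈ U
        · have : m a = Φ a := by rw [hmdef, hU.minExt_eq haU, hg, Set.indicator_of_mem haU]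
          rw [this]; exact le_self_add
        · rw [hh, Set.indicator_of_mem (by simpa using haU)]
          exact ih a ha
      intro a ha
      calc Φ a = upIter V L Φ a := (hΦ.upIter_eq L a ha).symm
        _ ≤ upIter V L (fun x => m x + (1 - e) ^ k * h x) a := upIter_mono h1 L a ha
        _ = m a + (1 - e) ^ k * upIter V L h a := by
          rw [upIter_add, upIter_mul, hm.upIter_eq L a ha]
        _ ≤ m a + (1 - e) ^ k * ((1 - e) * Φ a) := by gcongr; exact hstep a ha
        _ = _ := by rw [pow_succ, mul_assoc]
  intro a ha
  refine le_antisymm ?_ (hU.minExt_le hΦ (fun b _ => Set.indicator_le_self _ _ _) a ha)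
  have ht : Filter.Tendsto (fun k : ℕ => m a + (1 - e) ^ k * Φ a) Filter.atTop
      (nhds (m a + 0 * Φ a)) := by
    refine tendsto_const_nhds.add
      (ENNReal.Tendsto.mul_const ?_ (Or.inr (hfin a ha)))
    exact ENNReal.tendsto_pow_atTop_nhds_zero_of_lt_one
      (ENNReal.sub_lt_self ENNReal.one_ne_top one_ne_zero he)
  simpa using ge_of_tendsto' ht fun k => hP k a ha

lemma SectionData.phi_eq_minExt {t : Template} (D : SectionData t) {w : ℕ → ℝ}
    (hw : ∀ j, 0 < w j) (hsum : ∑ j ∈ Finset.range (numTop t.clusters), w j = 1) {n₀ : ℕ}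
    (h0 : 1 ≤ n₀) (hU : ∀ n : ℕ → ℕ, (∀ j, n₀ ≤ n j) → infWord t.clusters n ∉ Jt t) :
    ∀ a ∈ Zt t, a ∉ Jt t →
      D.phi w a = minExt (Zt t) ((bigWords t.clusters n₀).indicator (D.phi w)) a := by
  have hVS : Zt t \ Jt t ⊆ Zt t := Set.sdiff_subset
  have hup : ∀ a ∈ Zt t \ Jt t, ∀ b ∈ Zt t, CoveredBy a b → b ∈ Zt t \ Jt t :=
    fun a ha b hb hab => ⟨hb, fun hbJ => ha.2 (isDown_Jt t a b hab.1 hbJ)⟩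
  have hfin : ∀ a ∈ Zt t \ Jt t, D.phi w a ≠ ⊤ := fun a ha => by
    obtain ⟨ℓ, hℓ⟩ := D.exists_decompOf ha.1 ha.2
    rw [D.phi_eq ha.1 ha.2 hℓ]
    exact ENNReal.ofReal_ne_top
  have hharm : HarmonicOn (Zt t \ Jt t) (D.phi w) := fun a ha => by
    rw [upFinset_eq_of_up hVS hup ha, D.phi_harmonic hw hsum ha.1 ha.2]
  have hUV : bigWords t.clusters n₀ ⊆ Zt t \ Jt t := by
    rintro _ ⟨n, hn, rfl⟩
    exact ⟨infWord_mem_Zcl _ _, hU n hn⟩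
  have hUS : UpperHarmonic (Zt t) (bigWords t.clusters n₀)
      ((bigWords t.clusters n₀).indicator (D.phi w)) := by
    refine upperHarmonic_indicator h0 (fun n hn => hfin _ (hUV (infWord_mem_bigWords hn)))
      fun n hn => ?_
    rw [D.phi_harmonic hw hsum (infWord_mem_Zcl _ _) (hU n hn), Zt,
      sum_upFinset_infWord t.alt t.pos fun j => h0.trans (hn j)]
  have hUH : UpperHarmonic (Zt t \ Jt t) (bigWords t.clusters n₀)
      ((bigWords t.clusters n₀).indicator (D.phi w)) :=
    { subset := hUV
      up := fun a ha b hb hab => hUS.up a ha b hb.1 hab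
      zero := hUS.zero
      fin := hUS.fin
      harm := fun a ha => by
        rw [upFinset_eq_of_up hVS hup (hUV ha)]
        exact hUS.harm a ha }
  obtain ⟨ε, hε, L, hL⟩ := D.exists_mul_phi_le hw h0 hU
  intro a ha hJ
  rw [hharm.eq_minExt_indicator hfin hUH (e := ENNReal.ofReal ε) (by simpa using hε)
    (L := L) (fun b hb => by
      rw [upIter_eq_of_up hVS hup _ _ b hb]
      exact hL b hb.1 hb.2) a ⟨ha, hJ⟩]
  exact iSup_congr fun N => upIter_eq_of_up hVS hup _ N a ⟨ha, hJ⟩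

lemma length_filter_top (cs : List (Bool × ℕ∞)) :
    (cs.filter fun c => decide (c.2 = ⊤)).length = numTop cs := by
  simp [numTop, infSigns]

lemma sum_map_range (w : ℕ → ℝ) (m : ℕ) :
    ((List.range m).map w).sum = ∑ j ∈ Finset.range m, w j := by
  induction m with
  | zero => simp
  | succ m ih => simp [List.range_succ, Finset.sum_range_succ, ih]

end Zigzag

namespace Zigzag

/-- part 2 of the Main Theorem.  Every strictly positive, semifinite,
indecomposable harmonic function on `Z(t)`, for a semifinite template `t`, is
proportional to `φ_{t,w}` for some semifinite zigzag growth model `(t, w)`. -/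
theorem semifinite_harmonic_eq_phiTW
    (t : Template) (hsf : ¬t.IsFiniteTemplate) (D : SectionData t)
    (φ : BW → ℝ≥0∞) (hφ : HarmonicOn (Zt t) φ) (hpos : ∀ a ∈ Zt t, 0 < φ a)
    (hsemi : SemifiniteOn (Zt t) φ) (hindec : IndecSemifiniteOn (Zt t) φ) :
    ∃ (w : List ℝ) (c : ℝ), w.length = t.numInf ∧ (∀ x ∈ w, 0 < x) ∧ w.sum = 1 ∧
      0 < c ∧ ∀ a ∈ Zt t, φ a = ENNReal.ofReal c * phiTW t D w a := by
  obtain ⟨n₀, h0, hfin⟩ := exists_forall_infWord_ne_top hφ hsemi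
  obtain ⟨w, hw, hsum, hstep⟩ := exists_weights hφ hpos hindec h0 hfin
  have hU : ∀ n : ℕ → ℕ, (∀ j, n₀ ≤ n j) → infWord t.clusters n ∉ Jt t :=
    fun n hn hJ => hfin n hn (eq_top_of_mem_Jt hφ hpos hJ)
  obtain ⟨κ, hκ, hphi⟩ := D.exists_phi_infWord hw
  have hfin0 := hfin (fun _ => n₀) fun _ => le_rfl
  set C₀ : ℝ := (φ (infWord t.clusters fun _ => n₀)).toReal /
    (∏ j ∈ Finset.range (numTop t.clusters), w j ^ n₀) with hC₀
  have hC₀pos : 0 < C₀ := div_pos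
    (ENNReal.toReal_pos (hpos _ (infWord_mem_Zcl _ _)).ne' hfin0)
    (Finset.prod_pos fun j _ => pow_pos (hw j) _)
  have hC : 0 < C₀ / κ := div_pos hC₀pos hκ
  refine ⟨(List.range (numTop t.clusters)).map w, C₀ / κ, ?_, ?_, ?_, hC, fun a ha => ?_⟩
  · rw [List.length_map, List.length_range]
    exact (length_filter_top _).symm
  · intro x hx
    obtain ⟨j, -, rfl⟩ := List.mem_map.1 hx
    exact hw j
  · rw [sum_map_range, hsum]
  · by_cases hJ : a ∈ Jt t
    · rw [eq_top_of_mem_Jt hφ hpos hJ, phiTW, if_neg (not_not.2 ha), if_pos hJ, ENNReal.mul_top]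
      simpa using hC
    have hind : (bigWords t.clusters n₀).indicator φ = fun x => ENNReal.ofReal (C₀ / κ) *
        (bigWords t.clusters n₀).indicator (D.phi w) x := by
      funext x
      by_cases hx : x ∈ bigWords t.clusters n₀
      · rw [Set.indicator_of_mem hx, Set.indicator_of_mem hx]
        obtain ⟨n, hn, rfl⟩ := hx
        rw [hphi n (fun j => h0.trans (hn j)) (hU n hn), eq_mul_prod_of_step hw hstep hfin0 n hn,
          ← ENNReal.ofReal_mul hC.le, ← mul_assoc, div_mul_cancel₀ _ hκ.ne']
      · rw [Set.indicator_of_notMem hx, Set.indicator_of_notMem hx, mul_zero]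
    change φ a = ENNReal.ofReal (C₀ / κ) * D.phi w a
    rw [eq_minExt_bigWords hφ hpos hsemi hindec h0 hfin a ha, hind,
      D.phi_eq_minExt hw hsum h0 hU a ha hJ, minExt, minExt, ENNReal.mul_iSup]
    simp only [upIter_mul]

end Zigzag
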